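/- arXiv:math/0606145 — 3 statements merged into one kernel-verified Lean document; each statement's English description precedes it below -/
import Mathlib

section
/- For any spherically symmetric smooth initial data u₀, u₁ ∈ C^∞(ℝ³) that are compactly supported, there exists a global smooth solution u : ℝ × ℝ³ → ℝ of the defocusing nonlinear wave equation ∂ₜₜ u = Δu − u⁵ log(2 + u²) with u(0,x) = u₀(x) and ∂ₜu(0,x) = u₁(x), such that u(t,·) is compactly supported for each t; moreover this solution is unique among such solutions. -/
open MeasureTheory Real

noncomputable section

/-- Physical space `ℝ³`. -/
abbrev Sp : Type := EuclideanSpace ℝ (Fin 3)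

/-- The partial derivative of `u : ℝ³ → ℝ` in the `i`-th coordinate direction. -/
noncomputable def pd (i : Fin 3) (u : Sp → ℝ) (x : Sp) : ℝ :=
  fderiv ℝ u x (EuclideanSpace.single i 1)

/-- The spatial Laplacian `Δu = ∑ i, ∂ᵢ∂ᵢ u`. -/
noncomputable def lap (u : Sp → ℝ) (x : Sp) : ℝ := ∑ i, pd i (pd i u) x

/-- The nonlinearity `f(u) = u⁵ log(2 + u²)`. -/
noncomputable def nonlin (u : ℝ) : ℝ := u ^ 5 * Real.log (2 + u ^ 2)

/-- Partial derivative in the first (time) variable. -/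
def dt (f : ℝ → ℝ → ℝ) (t r : ℝ) : ℝ := deriv (fun s => f s r) t

/-- Partial derivative in the second (space) variable. -/
def dr (f : ℝ → ℝ → ℝ) (t r : ℝ) : ℝ := deriv (fun s => f t s) r

/-- Joint smoothness of a function of two real variables. -/
def Sm (f : ℝ → ℝ → ℝ) : Prop := ContDiff ℝ (⊤ : ℕ∞) (fun p : ℝ × ℝ => f p.1 p.2)

theorem two_le_infty : (1 + 1 : WithTop ℕ∞) ≤ ((⊤ : ℕ∞) : WithTop ℕ∞) := by
  have : (1 + 1 : WithTop ℕ∞) = ((2 : ℕ∞) : WithTop ℕ∞) := by norm_num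
  rw [this]
  exact WithTop.coe_le_coe.2 le_top

theorem continuous_comp_pair {X : Type*} [TopologicalSpace X] {f : ℝ → ℝ → ℝ}
    (hf : Continuous (fun p : ℝ × ℝ => f p.1 p.2)) {a b : X → ℝ}
    (ha : Continuous a) (hb : Continuous b) : Continuous (fun x => f (a x) (b x)) :=
  hf.comp (ha.prodMk hb)

theorem contDiff_succ_of_partials {n : ℕ} {f ft fr : ℝ → ℝ → ℝ}
    (hft : ∀ t r, HasDerivAt (fun s => f s r) (ft t r) t)
    (hfr : ∀ t r, HasDerivAt (fun s => f t s) (fr t r) r)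
    (ct : ContDiff ℝ n (fun p : ℝ × ℝ => ft p.1 p.2))
    (cr : ContDiff ℝ n (fun p : ℝ × ℝ => fr p.1 p.2)) :
    ContDiff ℝ (n + 1) (fun p : ℝ × ℝ => f p.1 p.2) := by
  rw [contDiff_succ_iff_hasFDerivAt]
  refine ⟨fun p => (ContinuousLinearMap.toSpanSingleton ℝ (ft p.1 p.2)).coprod
    (ContinuousLinearMap.toSpanSingleton ℝ (fr p.1 p.2)), ?_, ?_⟩
  · have : ∀ p : ℝ × ℝ, (ContinuousLinearMap.toSpanSingleton ℝ (ft p.1 p.2)).coprod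
      (ContinuousLinearMap.toSpanSingleton ℝ (fr p.1 p.2)) =
      ft p.1 p.2 • ContinuousLinearMap.fst ℝ ℝ ℝ + fr p.1 p.2 • ContinuousLinearMap.snd ℝ ℝ ℝ := by
      intro p
      ext <;> simp
    simp_rw [this]
    exact (ct.smul contDiff_const).add (cr.smul contDiff_const)
  · intro x
    have h := hasStrictFDerivAt_uncurry_coprod (𝕜 := ℝ) (u := x) (f := f)
      (f₁ := fun t r => ContinuousLinearMap.toSpanSingleton ℝ (ft t r))
      (f₂ := fun t r => ContinuousLinearMap.toSpanSingleton ℝ (fr t r))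
      (Filter.Eventually.of_forall fun v => (hft v.1 v.2).hasFDerivAt)
      (Filter.Eventually.of_forall fun v => (hfr v.1 v.2).hasFDerivAt) ?_ ?_
    · exact h.hasFDerivAt
    · exact ((ContinuousLinearMap.toSpanSingletonCLE
        (𝕜 := ℝ) (E := ℝ)).continuous.comp ct.continuous).continuousAt
    · exact ((ContinuousLinearMap.toSpanSingletonCLE
        (𝕜 := ℝ) (E := ℝ)).continuous.comp cr.continuous).continuousAt

theorem hasDerivAt_comp_pair {f : ℝ → ℝ → ℝ} (hf : ContDiff ℝ 1 (fun p : ℝ × ℝ => f p.1 p.2))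
    {a b : ℝ → ℝ} {a' b' s : ℝ} (ha : HasDerivAt a a' s) (hb : HasDerivAt b b' s) :
    HasDerivAt (fun s => f (a s) (b s)) (dt f (a s) (b s) * a' + dr f (a s) (b s) * b') s := by
  have hd : HasFDerivAt (fun p : ℝ × ℝ => f p.1 p.2)
      (fderiv ℝ (fun p : ℝ × ℝ => f p.1 p.2) (a s, b s)) (a s, b s) :=
    (hf.differentiable one_ne_zero _).hasFDerivAt
  have h1 : dt f (a s) (b s) = fderiv ℝ (fun p : ℝ × ℝ => f p.1 p.2) (a s, b s) (1, 0) := by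
    have : HasDerivAt (fun x : ℝ => (x, b s)) ((1 : ℝ), (0 : ℝ)) (a s) :=
      (hasDerivAt_id _).prodMk (hasDerivAt_const _ _)
    exact (hd.comp_hasDerivAt (a s) this).deriv
  have h2 : dr f (a s) (b s) = fderiv ℝ (fun p : ℝ × ℝ => f p.1 p.2) (a s, b s) (0, 1) := by
    have : HasDerivAt (fun x : ℝ => (a s, x)) ((0 : ℝ), (1 : ℝ)) (b s) :=
      (hasDerivAt_const _ _).prodMk (hasDerivAt_id _)
    exact (hd.comp_hasDerivAt (b s) this).deriv
  have h3 := hd.comp_hasDerivAt s (ha.prodMk hb)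
  convert! h3 using 1
  have : ((a', b') : ℝ × ℝ) = a' • ((1 : ℝ), (0 : ℝ)) + b' • ((0 : ℝ), (1 : ℝ)) := by simp
  rw [this, map_add, map_smul, map_smul, h1, h2]
  simp [mul_comm]

theorem hasDerivAt_dt {f : ℝ → ℝ → ℝ} (hf : ContDiff ℝ 1 (fun p : ℝ × ℝ => f p.1 p.2)) (t r : ℝ) :
    HasDerivAt (fun s => f s r) (dt f t r) t := by
  simpa using hasDerivAt_comp_pair hf (hasDerivAt_id t) (hasDerivAt_const t r)

theorem hasDerivAt_dr {f : ℝ → ℝ → ℝ} (hf : ContDiff ℝ 1 (fun p : ℝ × ℝ => f p.1 p.2)) (t r : ℝ) :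
    HasDerivAt (fun s => f t s) (dr f t r) r := by
  simpa using hasDerivAt_comp_pair hf (hasDerivAt_const r t) (hasDerivAt_id r)

theorem dt_eq_fderiv {f : ℝ → ℝ → ℝ} (hf : ContDiff ℝ 1 (fun p : ℝ × ℝ => f p.1 p.2)) (p : ℝ × ℝ) :
    dt f p.1 p.2 = fderiv ℝ (fun p : ℝ × ℝ => f p.1 p.2) p (1, 0) := by
  have hd := (hf.differentiable one_ne_zero p).hasFDerivAt
  have : HasDerivAt (fun x : ℝ => (x, p.2)) ((1 : ℝ), (0 : ℝ)) p.1 :=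
    (hasDerivAt_id _).prodMk (hasDerivAt_const _ _)
  exact (hd.comp_hasDerivAt p.1 this).deriv

theorem dr_eq_fderiv {f : ℝ → ℝ → ℝ} (hf : ContDiff ℝ 1 (fun p : ℝ × ℝ => f p.1 p.2)) (p : ℝ × ℝ) :
    dr f p.1 p.2 = fderiv ℝ (fun p : ℝ × ℝ => f p.1 p.2) p (0, 1) := by
  have hd := (hf.differentiable one_ne_zero p).hasFDerivAt
  have : HasDerivAt (fun x : ℝ => (p.1, x)) ((0 : ℝ), (1 : ℝ)) p.2 :=
    (hasDerivAt_const _ _).prodMk (hasDerivAt_id _)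
  exact (hd.comp_hasDerivAt p.2 this).deriv

theorem contDiff_dt {n : ℕ} {f : ℝ → ℝ → ℝ}
    (hf : ContDiff ℝ (n + 1) (fun p : ℝ × ℝ => f p.1 p.2)) :
    ContDiff ℝ n (fun p : ℝ × ℝ => dt f p.1 p.2) := by
  have h1 : ContDiff ℝ 1 (fun p : ℝ × ℝ => f p.1 p.2) := hf.of_le (by simp)
  simp_rw [dt_eq_fderiv h1]
  exact (hf.fderiv_right le_rfl).clm_apply contDiff_const

theorem contDiff_dr {n : ℕ} {f : ℝ → ℝ → ℝ}
    (hf : ContDiff ℝ (n + 1) (fun p : ℝ × ℝ => f p.1 p.2)) :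
    ContDiff ℝ n (fun p : ℝ × ℝ => dr f p.1 p.2) := by
  have h1 : ContDiff ℝ 1 (fun p : ℝ × ℝ => f p.1 p.2) := hf.of_le (by simp)
  simp_rw [dr_eq_fderiv h1]
  exact (hf.fderiv_right le_rfl).clm_apply contDiff_const

namespace Sm

variable {f g : ℝ → ℝ → ℝ}

theorem c1 (hf : Sm f) : ContDiff ℝ 1 (fun p : ℝ × ℝ => f p.1 p.2) :=
  hf.of_le (by exact_mod_cast le_top)

theorem cont (hf : Sm f) : Continuous (fun p : ℝ × ℝ => f p.1 p.2) := hf.continuous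

theorem cont_comp {X : Type*} [TopologicalSpace X] (hf : Sm f) {a b : X → ℝ}
    (ha : Continuous a) (hb : Continuous b) : Continuous (fun x => f (a x) (b x)) :=
  hf.continuous.comp (ha.prodMk hb)

theorem dt (hf : Sm f) : Sm (dt f) :=
  contDiff_infty.2 fun n => contDiff_dt (hf.of_le (by exact_mod_cast le_top))

theorem dr (hf : Sm f) : Sm (dr f) :=
  contDiff_infty.2 fun n => contDiff_dr (hf.of_le (by exact_mod_cast le_top))

theorem add (hf : Sm f) (hg : Sm g) : Sm (fun t r => f t r + g t r) := ContDiff.add hf hg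

theorem hasDt (hf : Sm f) (t r : ℝ) : HasDerivAt (fun s => f s r) (_root_.dt f t r) t :=
  hasDerivAt_dt hf.c1 t r

theorem hasDr (hf : Sm f) (t r : ℝ) : HasDerivAt (fun s => f t s) (_root_.dr f t r) r :=
  hasDerivAt_dr hf.c1 t r

theorem dt_dr (hf : Sm f) (t r : ℝ) : _root_.dt (_root_.dr f) t r = _root_.dr (_root_.dt f) t r := by
  have e1 := dt_eq_fderiv hf.dr.c1 (t, r)
  have e2 := dr_eq_fderiv hf.dt.c1 (t, r)
  simp only at e1 e2
  rw [e1, e2]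
  simp_rw [dr_eq_fderiv hf.c1, dt_eq_fderiv hf.c1]
  have hsymm : IsSymmSndFDerivAt ℝ (fun p : ℝ × ℝ => f p.1 p.2) (t, r) :=
    ContDiffAt.isSymmSndFDerivAt (n := 2) (hf.contDiffAt.of_le two_le_infty) (by simp)
  have hd : DifferentiableAt ℝ (fderiv ℝ (fun p : ℝ × ℝ => f p.1 p.2)) (t, r) :=
    ((hf.fderiv_right (m := 1) two_le_infty).differentiable one_ne_zero) _
  rw [fderiv_clm_apply hd (differentiableAt_const _), fderiv_clm_apply hd (differentiableAt_const _)]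
  simpa using hsymm.eq (1, 0) (0, 1)

end Sm

theorem hasDerivAt_param_integral {F F' : ℝ → ℝ → ℝ} {a b : ℝ}
    (hF : Continuous (fun p : ℝ × ℝ => F p.1 p.2)) (hF' : Continuous (fun p : ℝ × ℝ => F' p.1 p.2))
    (hd : ∀ x θ, HasDerivAt (fun x => F x θ) (F' x θ) x) (x : ℝ) :
    HasDerivAt (fun x => ∫ θ in a..b, F x θ) (∫ θ in a..b, F' x θ) x := by
  have hc : IsCompact ((Metric.closedBall x 1) ×ˢ (Set.uIcc a b)) :=
    (isCompact_closedBall x 1).prod isCompact_uIcc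
  obtain ⟨C, hC⟩ := hc.exists_bound_of_continuousOn hF'.continuousOn
  refine (intervalIntegral.hasDerivAt_integral_of_dominated_loc_of_deriv_le
    (bound := fun _ => C) (Metric.closedBall_mem_nhds x one_pos) ?_ ?_ ?_ ?_ ?_ ?_).2
  · exact Filter.Eventually.of_forall fun y =>
      (hF.comp (Continuous.prodMk_right y)).aestronglyMeasurable
  · exact (hF.comp (Continuous.prodMk_right x)).intervalIntegrable _ _
  · exact (hF'.comp (Continuous.prodMk_right x)).aestronglyMeasurable
  · exact Filter.Eventually.of_forall fun θ hθ y hy => hC (y, θ) ⟨hy, Set.uIoc_subset_uIcc hθ⟩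
  · exact intervalIntegrable_const
  · exact Filter.Eventually.of_forall fun θ _ y _ => hd y θ

/-- Weighted average of `C` along the segment `{(s, θ ρ + s) : |θ| ≤ 1}`. -/
def avg (w : ℝ → ℝ) (C : ℝ → ℝ → ℝ) (s ρ : ℝ) : ℝ :=
  1 / 2 * ∫ θ in (-1 : ℝ)..1, w θ * C s (θ * ρ + s)

theorem continuous_avg {w : ℝ → ℝ} (hw : Continuous w) {C : ℝ → ℝ → ℝ}
    (hC : Continuous (fun p : ℝ × ℝ => C p.1 p.2)) :
    Continuous (fun p : ℝ × ℝ => avg w C p.1 p.2) := by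
  unfold avg
  refine continuous_const.mul
    (intervalIntegral.continuous_parametric_intervalIntegral_of_continuous' ?_ _ _)
  have : Continuous fun q : (ℝ × ℝ) × ℝ => C q.1.1 (q.2 * q.1.2 + q.1.1) :=
    continuous_comp_pair hC (by fun_prop) (by fun_prop)
  exact (hw.comp continuous_snd).mul this

theorem hasDerivAt_avg_left {w : ℝ → ℝ} (hw : Continuous w) {C : ℝ → ℝ → ℝ}
    (hC : ContDiff ℝ 1 (fun p : ℝ × ℝ => C p.1 p.2)) (s ρ : ℝ) :
    HasDerivAt (fun s => avg w C s ρ) (avg w (fun s y => dt C s y + dr C s y) s ρ) s := by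
  have ct := (contDiff_dt (n := 0) (by simpa using hC)).continuous
  have cr := (contDiff_dr (n := 0) (by simpa using hC)).continuous
  unfold avg
  refine (hasDerivAt_param_integral (F := fun s θ => w θ * C s (θ * ρ + s))
    (F' := fun s θ => w θ * (dt C s (θ * ρ + s) + dr C s (θ * ρ + s))) ?_ ?_ ?_ s).const_mul _
  · have : Continuous fun q : ℝ × ℝ => C q.1 (q.2 * ρ + q.1) :=
      continuous_comp_pair hC.continuous (by fun_prop) (by fun_prop)
    fun_prop
  · have h1 : Continuous fun q : ℝ × ℝ => dt C q.1 (q.2 * ρ + q.1) :=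
      continuous_comp_pair ct (by fun_prop) (by fun_prop)
    have h2 : Continuous fun q : ℝ × ℝ => dr C q.1 (q.2 * ρ + q.1) :=
      continuous_comp_pair cr (by fun_prop) (by fun_prop)
    fun_prop
  · intro x θ
    have := hasDerivAt_comp_pair hC (hasDerivAt_id x) ((hasDerivAt_id x).const_add (θ * ρ))
    simpa using this.const_mul (w θ)

theorem hasDerivAt_avg_right {w : ℝ → ℝ} (hw : Continuous w) {C C' : ℝ → ℝ → ℝ}
    (hC : Continuous (fun p : ℝ × ℝ => C p.1 p.2)) (hC' : Continuous (fun p : ℝ × ℝ => C' p.1 p.2))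
    (hd : ∀ s y, HasDerivAt (C s) (C' s y) y) (s ρ : ℝ) :
    HasDerivAt (fun ρ => avg w C s ρ) (avg (fun θ => θ * w θ) C' s ρ) ρ := by
  unfold avg
  refine (hasDerivAt_param_integral (F := fun ρ θ => w θ * C s (θ * ρ + s))
    (F' := fun ρ θ => θ * w θ * C' s (θ * ρ + s)) ?_ ?_ ?_ ρ).const_mul _
  · have : Continuous fun q : ℝ × ℝ => C s (q.2 * q.1 + s) :=
      continuous_comp_pair hC (by fun_prop) (by fun_prop)
    fun_prop
  · have h1 : Continuous fun q : ℝ × ℝ => C' s (q.2 * q.1 + s) :=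
      continuous_comp_pair hC' (by fun_prop) (by fun_prop)
    fun_prop
  · intro x θ
    have h1 : HasDerivAt (fun x => θ * x + s) θ x := by
      simpa using ((hasDerivAt_id x).const_mul θ).add_const s
    have := ((hd s (θ * x + s)).comp x h1).const_mul (w θ)
    convert! this using 1
    ring

theorem contDiff_avg {n : ℕ} : ∀ {w : ℝ → ℝ} (_ : Continuous w) {C : ℝ → ℝ → ℝ}
    (_ : ContDiff ℝ n (fun p : ℝ × ℝ => C p.1 p.2)),
    ContDiff ℝ n (fun p : ℝ × ℝ => avg w C p.1 p.2) := by
  induction n with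
  | zero =>
    intro w hw C hC
    exact contDiff_zero.2 (continuous_avg hw hC.continuous)
  | succ n ih =>
    intro w hw C hC
    have hC' : ContDiff ℝ (n + 1) (fun p : ℝ × ℝ => C p.1 p.2) := by exact_mod_cast hC
    have h1 : ContDiff ℝ 1 (fun p : ℝ × ℝ => C p.1 p.2) := hC'.of_le (by simp)
    have cr := contDiff_dr hC'
    exact_mod_cast contDiff_succ_of_partials (hasDerivAt_avg_left hw h1)
      (hasDerivAt_avg_right hw h1.continuous cr.continuous (fun s y => hasDerivAt_dr h1 s y))
      (ih hw ((contDiff_dt hC').add cr)) (ih (continuous_id.mul hw) cr)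

theorem Sm.avg {w : ℝ → ℝ} (hw : Continuous w) {C : ℝ → ℝ → ℝ} (hC : Sm C) : Sm (avg w C) :=
  contDiff_infty.2 fun _ => contDiff_avg hw (hC.of_le (by exact_mod_cast le_top))

theorem abs_integral_le_of_exp_bound {F : ℝ → ℝ} {k c t : ℝ} (hc : 0 ≤ c)
    (hF : ∀ s ∈ Set.uIcc 0 t, |F s| ≤ c * (k * exp (2 * k * |s|))) :
    |∫ s in (0 : ℝ)..t, F s| ≤ c / 2 * exp (2 * k * |t|) := by
  have c1 : Continuous fun s => c * (k * exp (2 * k * s)) := by fun_prop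
  have c2 : Continuous fun s => c * (k * exp (-(2 * k * s))) := by fun_prop
  rcases le_total 0 t with ht | ht
  · have h1 : |∫ s in (0 : ℝ)..t, F s| ≤ ∫ s in (0 : ℝ)..t, c * (k * exp (2 * k * s)) := by
      rw [← Real.norm_eq_abs]
      refine intervalIntegral.norm_integral_le_of_norm_le (μ := volume) ht
        (Filter.Eventually.of_forall fun s hs => ?_)
        (c1.intervalIntegrable _ _)
      have := hF s (by rw [Set.uIcc_of_le ht]; exact ⟨hs.1.le, hs.2⟩)
      rwa [abs_of_pos hs.1] at this
    have h2 : ∫ s in (0 : ℝ)..t, c * (k * exp (2 * k * s))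
        = c / 2 * exp (2 * k * t) - c / 2 * exp (2 * k * 0) := by
      refine intervalIntegral.integral_eq_sub_of_hasDerivAt
        (f := fun s => c / 2 * exp (2 * k * s)) (fun s _ => ?_)
        (c1.intervalIntegrable _ _)
      have h := (((hasDerivAt_id s).const_mul (2 * k)).exp).const_mul (c / 2)
      convert! h using 1
      simp only [id]
      ring
    rw [abs_of_nonneg ht]
    have : 0 ≤ c / 2 * exp (2 * k * 0) := by positivity
    linarith
  · have h1 : |∫ s in t..(0 : ℝ), F s| ≤ ∫ s in t..(0 : ℝ), c * (k * exp (-(2 * k * s))) := by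
      rw [← Real.norm_eq_abs]
      refine intervalIntegral.norm_integral_le_of_norm_le (μ := volume) ht
        (Filter.Eventually.of_forall fun s hs => ?_)
        (c2.intervalIntegrable _ _)
      have := hF s (by rw [Set.uIcc_of_ge ht]; exact ⟨hs.1.le, hs.2⟩)
      rw [abs_of_nonpos hs.2] at this
      simpa using this
    have h2 : ∫ s in t..(0 : ℝ), c * (k * exp (-(2 * k * s)))
        = -(c / 2 * exp (-(2 * k * 0))) - -(c / 2 * exp (-(2 * k * t))) := by
      refine intervalIntegral.integral_eq_sub_of_hasDerivAt
        (f := fun s => -(c / 2 * exp (-(2 * k * s)))) (fun s _ => ?_)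
        (c2.intervalIntegrable _ _)
      have h := (((((hasDerivAt_id s).const_mul (2 * k)).neg).exp).const_mul (c / 2)).neg
      convert! h using 1
      simp only [id, Pi.neg_apply]
      ring
    rw [abs_of_nonpos ht, intervalIntegral.integral_symm, abs_neg]
    have : 0 ≤ c / 2 * exp (-(2 * k * 0)) := by positivity
    have e : 2 * k * -t = -(2 * k * t) := by ring
    rw [e]
    linarith

/-- Size of the smallest dependence triangle containing `(s, ρ, h)`. -/
def tsize (p : ℝ × ℝ × ℝ) : ℝ := |p.1| + |p.2.1| + |p.2.2|

theorem exists_majorant {b : ℝ × ℝ × ℝ → ℝ} (hb : Continuous b) :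
    ∃ l : ℝ → ℝ, Continuous l ∧ (∀ x y, 0 ≤ x → x ≤ y → l x ≤ l y) ∧ (∀ x, 0 ≤ l x) ∧
      ∀ p, |b p| ≤ l (tsize p) := by
  have hK : IsCompact (Metric.closedBall (0 : ℝ × ℝ × ℝ) 1) := isCompact_closedBall _ _
  have hbdd : ∀ x : ℝ, BddAbove ((fun p : ℝ × ℝ × ℝ => |b (x • p)|) '' Metric.closedBall 0 1) :=
    fun x => hK.bddAbove_image (by fun_prop)
  refine ⟨fun x => sSup ((fun p : ℝ × ℝ × ℝ => |b (x • p)|) '' Metric.closedBall 0 1),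
    ?_, ?_, ?_, ?_⟩
  · exact hK.continuous_sSup (f := fun (x : ℝ) (p : ℝ × ℝ × ℝ) => |b (x • p)|)
      (by simp only [Function.HasUncurry.uncurry, id]; fun_prop)
  · intro x y hx hxy
    refine csSup_le ((Metric.nonempty_closedBall.2 zero_le_one).image _) ?_
    rintro _ ⟨p, hp, rfl⟩
    refine le_csSup (hbdd y) ?_
    rcases hx.eq_or_lt with rfl | hx
    · exact ⟨0, by simp, by simp⟩
    · have hy : 0 < y := hx.trans_le hxy
      refine ⟨(x / y) • p, ?_, ?_⟩
      · rw [mem_closedBall_zero_iff] at hp ⊢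
        rw [norm_smul, Real.norm_of_nonneg (by positivity)]
        have : x / y ≤ 1 := (div_le_one hy).2 hxy
        have h0 : 0 ≤ x / y := by positivity
        nlinarith [norm_nonneg p]
      · simp only [smul_smul]
        rw [mul_div_cancel₀ _ hy.ne']
  · intro x
    exact (abs_nonneg _).trans (le_csSup (hbdd x) ⟨0, by simp, rfl⟩)
  · intro p
    by_cases hp : tsize p = 0
    · refine le_csSup (hbdd _) ⟨0, by simp, ?_⟩
      have : p = 0 := by
        unfold tsize at hp
        have h1 := abs_nonneg p.1
        have h2 := abs_nonneg p.2.1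
        have h3 := abs_nonneg p.2.2
        have e1 : p.1 = 0 := abs_eq_zero.1 (by linarith)
        have e2 : p.2.1 = 0 := abs_eq_zero.1 (by linarith)
        have e3 : p.2.2 = 0 := abs_eq_zero.1 (by linarith)
        exact Prod.ext e1 (Prod.ext e2 e3)
      simp [this]
    · have h1 := abs_nonneg p.1
      have h2 := abs_nonneg p.2.1
      have h3 := abs_nonneg p.2.2
      have hpos : 0 < tsize p := lt_of_le_of_ne (by unfold tsize; positivity) (Ne.symm hp)
      refine le_csSup (hbdd _) ⟨(tsize p)⁻¹ • p, ?_, ?_⟩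
      · rw [mem_closedBall_zero_iff, norm_smul, norm_inv, Real.norm_of_nonneg hpos.le,
          inv_mul_le_iff₀ hpos, mul_one]
        simp only [Prod.norm_def, Real.norm_eq_abs, tsize]
        refine max_le (by linarith) (max_le (by linarith) (by linarith))
      · simp only [smul_smul]
        rw [mul_inv_cancel₀ hp, one_smul]

/-- Weighted average along shrinking segments, with a spectator variable. -/
def avg3 (w : ℝ → ℝ) (X : ℝ × ℝ × ℝ → ℝ) (p : ℝ × ℝ × ℝ) : ℝ :=
  1 / 2 * ∫ θ in (-1 : ℝ)..1, w θ * X (p.1, θ * p.2.1 + p.1, θ * p.2.2)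

theorem continuous_avg3 {w : ℝ → ℝ} (hw : Continuous w) {X : ℝ × ℝ × ℝ → ℝ} (hX : Continuous X) :
    Continuous (avg3 w X) := by
  unfold avg3
  refine continuous_const.mul
    (intervalIntegral.continuous_parametric_intervalIntegral_of_continuous' ?_ _ _)
  simp only [Function.uncurry_def]
  fun_prop

theorem avg3_add {w : ℝ → ℝ} (hw : Continuous w) {X Y : ℝ × ℝ × ℝ → ℝ} (hX : Continuous X)
    (hY : Continuous Y) (p : ℝ × ℝ × ℝ) :
    avg3 w (fun q => X q + Y q) p = avg3 w X p + avg3 w Y p := by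
  unfold avg3
  rw [← mul_add, ← intervalIntegral.integral_add]
  · simp only [mul_add]
  · exact Continuous.intervalIntegrable (by fun_prop) _ _
  · exact Continuous.intervalIntegrable (by fun_prop) _ _

theorem avg3_sub {w : ℝ → ℝ} (hw : Continuous w) {X Y : ℝ × ℝ × ℝ → ℝ} (hX : Continuous X)
    (hY : Continuous Y) (p : ℝ × ℝ × ℝ) :
    avg3 w (fun q => X q - Y q) p = avg3 w X p - avg3 w Y p := by
  unfold avg3
  rw [← mul_sub, ← intervalIntegral.integral_sub]
  · simp only [mul_sub]
  · exact Continuous.intervalIntegrable (by fun_prop) _ _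
  · exact Continuous.intervalIntegrable (by fun_prop) _ _

theorem abs_avg3_le {w : ℝ → ℝ} (hw : ∀ θ ∈ Set.Icc (-1 : ℝ) 1, |w θ| ≤ 1)
    {X : ℝ × ℝ × ℝ → ℝ} {p : ℝ × ℝ × ℝ} {m : ℝ}
    (hX : ∀ θ ∈ Set.Icc (-1 : ℝ) 1, |X (p.1, θ * p.2.1 + p.1, θ * p.2.2)| ≤ m) :
    |avg3 w X p| ≤ m := by
  have hm : 0 ≤ m := (abs_nonneg _).trans (hX 0 ⟨by norm_num, by norm_num⟩)
  unfold avg3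
  have : ‖∫ θ in (-1 : ℝ)..1, w θ * X (p.1, θ * p.2.1 + p.1, θ * p.2.2)‖ ≤ m * |1 - (-1)| := by
    refine intervalIntegral.norm_integral_le_of_norm_le_const fun θ hθ => ?_
    rw [Set.uIoc_of_le (by norm_num)] at hθ
    have hθ' : θ ∈ Set.Icc (-1 : ℝ) 1 := ⟨hθ.1.le, hθ.2⟩
    rw [norm_mul, Real.norm_eq_abs, Real.norm_eq_abs]
    calc _ ≤ 1 * m := mul_le_mul (hw θ hθ') (hX θ hθ') (abs_nonneg _) zero_le_one
      _ = m := one_mul m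
  rw [Real.norm_eq_abs] at this
  rw [abs_mul, abs_of_pos (by norm_num : (0 : ℝ) < 1 / 2)]
  norm_num at this
  linarith

theorem abs_add_abs_sub_le {s t y : ℝ} (hs : s ∈ Set.uIcc 0 t) :
    |s| + |y - s| ≤ |t| + |y - t| := by
  have h : |s| + |t - s| = |t| := by
    rcases le_total 0 t with ht | ht
    · rw [Set.uIcc_of_le ht] at hs
      rw [abs_of_nonneg hs.1, abs_of_nonneg ht, abs_of_nonneg (by linarith [hs.2])]
      ring
    · rw [Set.uIcc_of_ge ht] at hs
      rw [abs_of_nonpos hs.2, abs_of_nonpos ht, abs_of_nonpos (by linarith [hs.1])]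
      ring
  have h2 : |y - s| ≤ |y - t| + |t - s| := abs_sub_le y t s
  linarith

theorem tsize_segment_le {s ρ h θ : ℝ} (hθ : θ ∈ Set.Icc (-1 : ℝ) 1) :
    tsize (s, (θ * ρ + s) - s, θ * h) ≤ tsize (s, ρ, h) := by
  have h1 : |θ| ≤ 1 := abs_le.2 hθ
  simp only [tsize, add_sub_cancel_right, abs_mul]
  nlinarith [abs_nonneg ρ, abs_nonneg h]

/-- Uniqueness for the homogeneous linear Volterra equation. -/
theorem volterra_unique {w : ℝ → ℝ} (hw1 : ∀ θ ∈ Set.Icc (-1 : ℝ) 1, |w θ| ≤ 1)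
    {b Z : ℝ × ℝ × ℝ → ℝ} (hb : Continuous b) (hZ : Continuous Z)
    (hE : ∀ t y h, Z (t, y, h) = ∫ s in (0 : ℝ)..t, b (s, y - s, h) * avg3 w Z (s, y - s, h)) :
    ∀ p, Z p = 0 := by
  rintro ⟨t0, y0, h0⟩
  obtain ⟨l, -, lmono, lnn, hl⟩ := exists_majorant hb
  set σ := tsize (t0, y0 - t0, h0) with hσ
  set k := l σ + 1 with hk
  have hkpos : 0 < k := by have := lnn σ; linarith
  let K : Set (ℝ × ℝ × ℝ) := {p | tsize (p.1, p.2.1 - p.1, p.2.2) ≤ σ}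
  have hKc : IsCompact K := by
    refine Metric.isCompact_of_isClosed_isBounded ?_ ?_
    · exact isClosed_le (by unfold tsize; fun_prop) continuous_const
    · refine (Metric.isBounded_closedBall (x := (0 : ℝ × ℝ × ℝ)) (r := 2 * σ)).subset ?_
      rintro ⟨t, y, h⟩ hp
      simp only [K, tsize, Set.mem_ofPred_eq] at hp
      rw [mem_closedBall_zero_iff]
      simp only [Prod.norm_def, Real.norm_eq_abs]
      have h1 := abs_nonneg t
      have h2 := abs_nonneg (y - t)
      have h3 := abs_nonneg h
      have h4 : |y| ≤ |y - t| + |t| := by simpa using abs_add_le (y - t) t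
      refine max_le (by linarith) (max_le (by linarith) (by linarith))
  have hmem0 : (t0, y0, h0) ∈ K := hσ.ge
  obtain ⟨p, hp, hmax⟩ := hKc.exists_isMaxOn ⟨_, hmem0⟩
    (f := fun p => |Z p| * exp (-(2 * k * |p.1|))) (by fun_prop)
  set m := |Z p| * exp (-(2 * k * |p.1|)) with hm
  have hm0 : 0 ≤ m := by positivity
  have hbd : ∀ q ∈ K, |Z q| ≤ m * exp (2 * k * |q.1|) := by
    intro q hq
    have : |Z q| * exp (-(2 * k * |q.1|)) ≤ m := hmax hq
    rw [exp_neg] at this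
    rwa [mul_inv_le_iff₀ (exp_pos _)] at this
  have key : |Z p| ≤ m / 2 * exp (2 * k * |p.1|) := by
    obtain ⟨t, y, h⟩ := p
    rw [hE]
    refine abs_integral_le_of_exp_bound hm0 fun s hs => ?_
    have hsz : tsize (s, y - s, h) ≤ σ := by
      have h1 := abs_add_abs_sub_le (y := y) hs
      have : tsize (t, y - t, h) ≤ σ := hp
      simp only [tsize] at this ⊢
      linarith
    have hb1 : |b (s, y - s, h)| ≤ k := by
      have h1 := hl (s, y - s, h)
      have h2 := lmono _ σ (by unfold tsize; positivity) hsz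
      linarith
    have ha : |avg3 w Z (s, y - s, h)| ≤ m * exp (2 * k * |s|) := by
      refine abs_avg3_le hw1 fun θ hθ => ?_
      exact hbd (s, θ * (y - s) + s, θ * h) ((tsize_segment_le hθ).trans hsz)
    rw [abs_mul]
    calc _ ≤ k * (m * exp (2 * k * |s|)) := mul_le_mul hb1 ha (abs_nonneg _) hkpos.le
      _ = _ := by ring
  have hm2 : m ≤ m / 2 := by
    have : |Z p| * exp (-(2 * k * |p.1|)) ≤ m / 2 := by
      rw [exp_neg, mul_inv_le_iff₀ (exp_pos _)]
      exact key
    linarith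
  have h00 := hbd _ hmem0
  have : m = 0 := by linarith
  rw [this, zero_mul] at h00
  exact abs_eq_zero.1 (le_antisymm h00 (abs_nonneg _))

theorem continuous_volterra {w : ℝ → ℝ} (hw : Continuous w) {G : ℝ × ℝ × ℝ → ℝ → ℝ}
    (hG : Continuous fun q : (ℝ × ℝ × ℝ) × ℝ => G q.1 q.2) {X : ℝ × ℝ × ℝ → ℝ}
    (hX : Continuous X) :
    Continuous fun p : ℝ × ℝ × ℝ =>
      ∫ s in (0 : ℝ)..p.1, G (s, p.2.1 - s, p.2.2) (avg3 w X (s, p.2.1 - s, p.2.2)) := by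
  have hA := continuous_avg3 hw hX
  refine intervalIntegral.continuous_parametric_intervalIntegral_of_continuous
    (f := fun (p : ℝ × ℝ × ℝ) s => G (s, p.2.1 - s, p.2.2) (avg3 w X (s, p.2.1 - s, p.2.2)))
    ?_ continuous_fst
  have h1 : Continuous fun q : (ℝ × ℝ × ℝ) × ℝ => (q.2, q.1.2.1 - q.2, q.1.2.2) := by fun_prop
  exact hG.comp (h1.prodMk (hA.comp h1))

/-- Global existence for the Volterra equation with Lipschitz right-hand side. -/
theorem volterra_exists {w : ℝ → ℝ} (hw : Continuous w)
    (hw1 : ∀ θ ∈ Set.Icc (-1 : ℝ) 1, |w θ| ≤ 1)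
    {Q : ℝ × ℝ × ℝ → ℝ} (hQ : Continuous Q) {G : ℝ × ℝ × ℝ → ℝ → ℝ}
    (hG : Continuous fun q : (ℝ × ℝ × ℝ) × ℝ => G q.1 q.2)
    {b : ℝ × ℝ × ℝ → ℝ} (hb : Continuous b)
    (hLip : ∀ p u v, |G p u - G p v| ≤ b p * |u - v|) :
    ∃ X : ℝ × ℝ × ℝ → ℝ, Continuous X ∧ ∀ t y h, X (t, y, h) = Q (t, y, h) +
      ∫ s in (0 : ℝ)..t, G (s, y - s, h) (avg3 w X (s, y - s, h)) := by
  have hGQ : Continuous fun p => G p (avg3 w Q p) :=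
    hG.comp (continuous_id.prodMk (continuous_avg3 hw hQ))
  obtain ⟨l, lc, lmono, lnn, hl⟩ :=
    exists_majorant (b := fun p => |b p| + |G p (avg3 w Q p)|) (hb.abs.add hGQ.abs)
  have hlb : ∀ p, |b p| ≤ l (tsize p) := fun p => by
    have := (le_abs_self _).trans (hl p)
    have h2 := abs_nonneg (G p (avg3 w Q p))
    linarith
  have hlG : ∀ p, |G p (avg3 w Q p)| ≤ l (tsize p) := fun p => by
    have := (le_abs_self _).trans (hl p)
    have h2 := abs_nonneg (b p)
    linarith
  let κ : ℝ × ℝ × ℝ → ℝ := fun p => l (tsize (p.1, p.2.1 - p.1, p.2.2))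
  have hκ : Continuous κ := lc.comp (by unfold tsize; fun_prop)
  let Ω : ℝ × ℝ × ℝ → ℝ := fun p => exp (2 * κ p * |p.1|)
  have hΩ : Continuous Ω := by fun_prop
  have hΩpos : ∀ p, 0 < Ω p := fun p => exp_pos _
  have hsz : ∀ {t y h s : ℝ}, s ∈ Set.uIcc 0 t → l (tsize (s, y - s, h)) ≤ κ (t, y, h) := by
    intro t y h s hs
    refine lmono _ _ (by unfold tsize; positivity) ?_
    have h1 := abs_add_abs_sub_le (y := y) hs
    simp only [tsize]
    linarith
  have havg : ∀ {E : ℝ × ℝ × ℝ → ℝ} {m : ℝ}, (∀ p, |E p| ≤ m) → ∀ {t y h s : ℝ},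
      s ∈ Set.uIcc 0 t → |avg3 w (fun q => Ω q * E q) (s, y - s, h)|
        ≤ m * exp (2 * κ (t, y, h) * |s|) := by
    intro E m hE t y h s hs
    refine abs_avg3_le hw1 fun θ hθ => ?_
    rw [abs_mul, abs_of_pos (hΩpos _), mul_comm]
    refine mul_le_mul (hE _) ?_ (hΩpos _).le ((abs_nonneg _).trans (hE 0))
    refine exp_le_exp.2 ?_
    have : κ (s, θ * (y - s) + s, θ * h) ≤ κ (t, y, h) :=
      (lmono _ _ (by unfold tsize; positivity) (tsize_segment_le hθ)).trans (hsz hs)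
    have h0 := abs_nonneg s
    nlinarith
  let I : (ℝ × ℝ × ℝ → ℝ) → ℝ × ℝ × ℝ → ℝ := fun E p => ∫ s in (0 : ℝ)..p.1,
    G (s, p.2.1 - s, p.2.2) (avg3 w (fun q => Q q + Ω q * E q) (s, p.2.1 - s, p.2.2))
  have hIc : ∀ {E : ℝ × ℝ × ℝ → ℝ}, Continuous E → Continuous (I E) := fun hE =>
    continuous_volterra hw hG (by fun_prop)
  have hIdiff : ∀ {E E' : ℝ × ℝ × ℝ → ℝ}, Continuous E → Continuous E' → ∀ {m : ℝ},
      (∀ p, |E p - E' p| ≤ m) → ∀ p, |I E p - I E' p| ≤ m / 2 * Ω p := by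
    rintro E E' hE hE' m hm ⟨t, y, h⟩
    have hm0 : 0 ≤ m := (abs_nonneg _).trans (hm 0)
    have hci : ∀ {E : ℝ × ℝ × ℝ → ℝ}, Continuous E → IntervalIntegrable (fun s =>
        G (s, y - s, h) (avg3 w (fun q => Q q + Ω q * E q) (s, y - s, h))) volume 0 t := by
      intro E hE
      have hA := continuous_avg3 hw (X := fun q => Q q + Ω q * E q) (by fun_prop)
      have h1 : Continuous fun s : ℝ => (s, y - s, h) := by fun_prop
      exact (hG.comp (h1.prodMk (hA.comp h1))).intervalIntegrable _ _
    simp only [I]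
    rw [← intervalIntegral.integral_sub (hci hE) (hci hE')]
    refine abs_integral_le_of_exp_bound hm0 fun s hs => ?_
    refine (hLip _ _ _).trans ?_
    rw [avg3_add hw hQ (by fun_prop), avg3_add hw hQ (by fun_prop), add_sub_add_left_eq_sub,
      ← avg3_sub hw (by fun_prop) (by fun_prop)]
    simp only [← mul_sub]
    have h1 := havg (E := fun p => E p - E' p) hm (y := y) (h := h) hs
    have h2 : b (s, y - s, h) ≤ κ (t, y, h) := (le_abs_self _).trans ((hlb _).trans (hsz hs))
    have hk0 : 0 ≤ κ (t, y, h) := lnn _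
    calc _ ≤ κ (t, y, h) * (m * exp (2 * κ (t, y, h) * |s|)) :=
          mul_le_mul h2 h1 (abs_nonneg _) hk0
      _ = _ := by ring
  have hI0 : ∀ p, |I (fun _ => 0) p| ≤ 1 / 2 * Ω p := by
    rintro ⟨t, y, h⟩
    simp only [I, mul_zero, add_zero]
    refine abs_integral_le_of_exp_bound zero_le_one fun s hs => ?_
    refine (hlG _).trans ((hsz hs).trans ?_)
    have hk0 : 0 ≤ κ (t, y, h) := lnn _
    have : 1 ≤ exp (2 * κ (t, y, h) * |s|) := one_le_exp (by positivity)
    nlinarith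
  let T : BoundedContinuousFunction (ℝ × ℝ × ℝ) ℝ → BoundedContinuousFunction (ℝ × ℝ × ℝ) ℝ :=
    fun E => BoundedContinuousFunction.ofNormedAddCommGroup (fun p => (Ω p)⁻¹ * I E p)
      ((hΩ.inv₀ fun p => (hΩpos p).ne').mul (hIc E.continuous)) (1 / 2 + ‖E‖ / 2) (fun p => by
        rw [norm_mul, norm_inv, Real.norm_of_nonneg (hΩpos p).le, inv_mul_le_iff₀ (hΩpos p)]
        have h1 := hIdiff E.continuous (continuous_const (y := (0 : ℝ))) (m := ‖E‖)
          (fun p => by simpa using E.norm_coe_le_norm p) p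
        have h2 := hI0 p
        have h3 : |I E p| ≤ |I E p - I (fun _ => 0) p| + |I (fun _ => 0) p| := by
          simpa using abs_add_le (I E p - I (fun _ => 0) p) (I (fun _ => 0) p)
        rw [Real.norm_eq_abs]
        nlinarith)
  have hT : ContractingWith (1 / 2) T := by
    refine ⟨by rw [← NNReal.coe_lt_coe]; norm_num, LipschitzWith.of_dist_le_mul fun E E' => ?_⟩
    rw [BoundedContinuousFunction.dist_le (by positivity)]
    intro p
    have h1 := hIdiff E.continuous E'.continuous (m := dist E E')
      (fun p => by simpa [Real.dist_eq] using E.dist_coe_le_dist (g := E') p) p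
    simp only [T, BoundedContinuousFunction.coe_ofNormedAddCommGroup, Real.dist_eq]
    rw [← mul_sub, abs_mul, abs_inv, abs_of_pos (hΩpos p), inv_mul_le_iff₀ (hΩpos p)]
    refine h1.trans (le_of_eq ?_)
    push_cast
    ring
  have hfix := hT.fixedPoint_isFixedPt
  set E := ContractingWith.fixedPoint T hT with hEdef
  refine ⟨fun q => Q q + Ω q * E q, by have := E.continuous; fun_prop, fun t y h => ?_⟩
  have h1 : (Ω (t, y, h))⁻¹ * I E (t, y, h) = E (t, y, h) :=
    DFunLike.congr_fun hfix (t, y, h)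
  rw [inv_mul_eq_iff_eq_mul₀ (hΩpos _).ne'] at h1
  simp only
  rw [← h1]

theorem hadamard_quotient {Γ : ℝ × ℝ × ℝ → ℝ} (hΓ : ContDiff ℝ 1 Γ) (s ρ u h k : ℝ) :
    Γ (s, ρ + h, u + k) - Γ (s, ρ, u)
      = h * (∫ τ in (0 : ℝ)..1, fderiv ℝ Γ (s, ρ + τ * h, u + τ * k) (0, 1, 0))
        + k * ∫ τ in (0 : ℝ)..1, fderiv ℝ Γ (s, ρ + τ * h, u + τ * k) (0, 0, 1) := by
  have hc : Continuous (fderiv ℝ Γ) := hΓ.continuous_fderiv one_ne_zero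
  rw [← intervalIntegral.integral_const_mul, ← intervalIntegral.integral_const_mul,
    ← intervalIntegral.integral_add (Continuous.intervalIntegrable (by fun_prop) _ _)
      (Continuous.intervalIntegrable (by fun_prop) _ _)]
  have hd : ∀ τ ∈ Set.uIcc (0 : ℝ) 1, HasDerivAt (fun τ => Γ (s, ρ + τ * h, u + τ * k))
      (h * fderiv ℝ Γ (s, ρ + τ * h, u + τ * k) (0, 1, 0)
        + k * fderiv ℝ Γ (s, ρ + τ * h, u + τ * k) (0, 0, 1)) τ := by
    intro τ _
    have h1 : HasDerivAt (fun τ : ℝ => (s, ρ + τ * h, u + τ * k)) ((0 : ℝ), h, k) τ := by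
      refine (hasDerivAt_const _ _).prodMk (HasDerivAt.prodMk ?_ ?_)
      · simpa using ((hasDerivAt_id τ).mul_const h).const_add ρ
      · simpa using ((hasDerivAt_id τ).mul_const k).const_add u
    have h2 := (hΓ.differentiable one_ne_zero (s, ρ + τ * h, u + τ * k)).hasFDerivAt.comp_hasDerivAt
      τ h1
    convert! h2 using 1
    have : ((0 : ℝ), h, k) = h • ((0 : ℝ), (1 : ℝ), (0 : ℝ)) + k • ((0 : ℝ), (0 : ℝ), (1 : ℝ)) := by
      ext <;> simp
    rw [this, map_add, map_smul, map_smul]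
    rfl
  have := intervalIntegral.integral_eq_sub_of_hasDerivAt hd
    (Continuous.intervalIntegrable (by fun_prop) _ _)
  rw [this]
  simp

theorem hadamard_quotient_one {q : ℝ → ℝ} (hq : ContDiff ℝ 1 q) (y h : ℝ) :
    q (y + h) - q y = h * ∫ τ in (0 : ℝ)..1, deriv q (y + τ * h) := by
  have hc : Continuous (deriv q) := hq.continuous_deriv le_rfl
  have hd : ∀ τ ∈ Set.uIcc (0 : ℝ) 1, HasDerivAt (fun τ => q (y + τ * h))
      (h * deriv q (y + τ * h)) τ := by
    intro τ _
    have h1 : HasDerivAt (fun τ => y + τ * h) h τ := by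
      simpa using ((hasDerivAt_id τ).mul_const h).const_add y
    have := (hq.differentiable one_ne_zero (y + τ * h)).hasDerivAt.comp τ h1
    rwa [mul_comm] at this
  rw [← intervalIntegral.integral_const_mul, intervalIntegral.integral_eq_sub_of_hasDerivAt hd
    (Continuous.intervalIntegrable (by fun_prop) _ _)]
  simp

/-- A continuous solution of the Volterra equation with `C¹` coefficients is differentiable in
the second variable, and its derivative solves the linearized equation. -/
theorem volterra_hasDerivAt {w : ℝ → ℝ} (hw : Continuous w)
    (hw1 : ∀ θ ∈ Set.Icc (-1 : ℝ) 1, |w θ| ≤ 1) {q : ℝ → ℝ} (hq : ContDiff ℝ 1 q)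
    {Γ : ℝ × ℝ × ℝ → ℝ} (hΓ : ContDiff ℝ 1 Γ) {C : ℝ → ℝ → ℝ}
    (hC : Continuous fun p : ℝ × ℝ => C p.1 p.2)
    (hE : ∀ t y, C t y = q y + ∫ s in (0 : ℝ)..t, Γ (s, y - s, avg w C s (y - s))) :
    ∃ C' : ℝ → ℝ → ℝ, Continuous (fun p : ℝ × ℝ => C' p.1 p.2) ∧
      (∀ t y, HasDerivAt (C t) (C' t y) y) ∧
      ∀ t y, C' t y = deriv q y + ∫ s in (0 : ℝ)..t,
        (fderiv ℝ Γ (s, y - s, avg w C s (y - s)) (0, 1, 0)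
          + fderiv ℝ Γ (s, y - s, avg w C s (y - s)) (0, 0, 1)
            * avg (fun θ => θ * w θ) C' s (y - s)) := by
  have hcΓ : Continuous (fderiv ℝ Γ) := hΓ.continuous_fderiv one_ne_zero
  have hcq : Continuous (deriv q) := hq.continuous_deriv le_rfl
  have hW := continuous_avg hw hC
  have hW' : ∀ {X : Type} [TopologicalSpace X] {a c : X → ℝ}, Continuous a → Continuous c →
      Continuous fun x => avg w C (a x) (c x) := fun ha hc => continuous_comp_pair hW ha hc
  let δW : ℝ × ℝ × ℝ → ℝ := fun p => avg w C p.1 (p.2.1 + p.2.2) - avg w C p.1 p.2.1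
  have hδW : Continuous δW := (hW' (by fun_prop) (by fun_prop)).sub (hW' (by fun_prop) (by fun_prop))
  let P : (ℝ × ℝ × ℝ) → ℝ → ℝ × ℝ × ℝ :=
    fun p τ => (p.1, p.2.1 + τ * p.2.2, avg w C p.1 p.2.1 + τ * δW p)
  have hP : Continuous fun x : (ℝ × ℝ × ℝ) × ℝ => P x.1 x.2 := by
    have h1 : Continuous fun x : (ℝ × ℝ × ℝ) × ℝ => avg w C x.1.1 x.1.2.1 :=
      hW' (by fun_prop) (by fun_prop)
    fun_prop
  let Γ1 : ℝ × ℝ × ℝ → ℝ := fun p => ∫ τ in (0 : ℝ)..1, fderiv ℝ Γ (P p τ) (0, 1, 0)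
  let Γ2 : ℝ × ℝ × ℝ → ℝ := fun p => ∫ τ in (0 : ℝ)..1, fderiv ℝ Γ (P p τ) (0, 0, 1)
  have hΓ1 : Continuous Γ1 :=
    intervalIntegral.continuous_parametric_intervalIntegral_of_continuous'
      (f := fun p τ => fderiv ℝ Γ (P p τ) (0, 1, 0)) ((hcΓ.comp hP).clm_apply continuous_const) _ _
  have hΓ2 : Continuous Γ2 :=
    intervalIntegral.continuous_parametric_intervalIntegral_of_continuous'
      (f := fun p τ => fderiv ℝ Γ (P p τ) (0, 0, 1)) ((hcΓ.comp hP).clm_apply continuous_const) _ _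
  let Q : ℝ × ℝ × ℝ → ℝ := fun p => ∫ τ in (0 : ℝ)..1, deriv q (p.2.1 + τ * p.2.2)
  have hQ : Continuous Q :=
    intervalIntegral.continuous_parametric_intervalIntegral_of_continuous'
      (f := fun (p : ℝ × ℝ × ℝ) τ => deriv q (p.2.1 + τ * p.2.2)) (by fun_prop) _ _
  have hw' : Continuous fun θ => θ * w θ := by fun_prop
  have hw1' : ∀ θ ∈ Set.Icc (-1 : ℝ) 1, |θ * w θ| ≤ 1 := fun θ hθ => by
    rw [abs_mul]
    exact mul_le_one₀ (abs_le.2 hθ) (abs_nonneg _) (hw1 θ hθ)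
  obtain ⟨X, hX, hXE⟩ := volterra_exists hw' hw1' hQ (G := fun p u => Γ1 p + Γ2 p * u)
    (by fun_prop) (b := fun p => |Γ2 p|) (by fun_prop)
    (fun p u v => by rw [← abs_mul]; apply le_of_eq; congr 1; ring)
  have hδC : Continuous fun p : ℝ × ℝ × ℝ => C p.1 (p.2.1 + p.2.2) - C p.1 p.2.1 :=
    (continuous_comp_pair hC (by fun_prop) (by fun_prop)).sub
      (continuous_comp_pair hC (by fun_prop) (by fun_prop))
  have hδW_eq : ∀ p, δW p = avg3 w (fun p => C p.1 (p.2.1 + p.2.2) - C p.1 p.2.1) p := by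
    intro p
    rw [avg3_sub hw (X := fun p => C p.1 (p.2.1 + p.2.2)) (Y := fun p => C p.1 p.2.1)
      (continuous_comp_pair hC (by fun_prop) (by fun_prop))
      (continuous_comp_pair hC (by fun_prop) (by fun_prop))]
    simp only [δW, avg, avg3]
    congr 4
    funext θ
    congr 2
    ring
  have hXmul : ∀ p : ℝ × ℝ × ℝ, p.2.2 * avg3 (fun θ => θ * w θ) X p
      = avg3 w (fun p => p.2.2 * X p) p := by
    intro p
    simp only [avg3]
    rw [mul_left_comm, ← intervalIntegral.integral_const_mul]
    congr 2
    funext θ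
    ring
  have hcomp : ∀ {F : ℝ × ℝ × ℝ → ℝ}, Continuous F → ∀ y h t : ℝ,
      IntervalIntegrable (fun s => F (s, y - s, h)) volume 0 t := fun hF y h t =>
    Continuous.intervalIntegrable (by fun_prop) _ _
  have hΓW : ∀ y t, IntervalIntegrable (fun s => Γ (s, y - s, avg w C s (y - s))) volume 0 t := by
    intro y t
    have h1 : Continuous fun s : ℝ => avg w C s (y - s) := hW' (by fun_prop) (by fun_prop)
    have h2 := hΓ.continuous
    exact Continuous.intervalIntegrable (by fun_prop) _ _
  have hzero := volterra_unique hw1 hΓ2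
    (Z := fun p => p.2.2 * X p - (C p.1 (p.2.1 + p.2.2) - C p.1 p.2.1)) (by fun_prop) (by
      intro t y h
      have hav := continuous_avg3 hw' hX
      have hE1 : C t (y + h) - C t y = h * Q (t, y, h) + ∫ s in (0 : ℝ)..t,
          (h * Γ1 (s, y - s, h) + δW (s, y - s, h) * Γ2 (s, y - s, h)) := by
        rw [hE, hE, add_sub_add_comm, hadamard_quotient_one hq,
          ← intervalIntegral.integral_sub (hΓW _ _) (hΓW _ _)]
        congr 2
        funext s
        have := hadamard_quotient hΓ s (y - s) (avg w C s (y - s)) h (δW (s, y - s, h))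
        simp only [δW, add_sub_cancel] at this
        rw [show y + h - s = y - s + h by ring, this]
      have hi1 := hcomp (F := fun p => h * (Γ1 p + Γ2 p * avg3 (fun θ => θ * w θ) X p))
        (by fun_prop) y h t
      have hi2 := hcomp (F := fun p => h * Γ1 p + δW p * Γ2 p) (by fun_prop) y h t
      simp only at hi1 hi2 ⊢
      rw [hE1, hXE, mul_add, add_sub_add_left_eq_sub, ← intervalIntegral.integral_const_mul,
        ← intervalIntegral.integral_sub hi1 hi2]
      congr 1
      funext s
      rw [avg3_sub hw (by fun_prop) hδC, ← hδW_eq, ← hXmul]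
      simp only
      ring)
  refine ⟨fun t y => X (t, y, 0), by fun_prop, fun t y => ?_, fun t y => ?_⟩
  · rw [hasDerivAt_iff_tendsto_slope_zero]
    have h1 : Filter.Tendsto (fun h => X (t, y, h)) (nhdsWithin 0 {0}ᶜ) (nhds (X (t, y, 0))) := by
      have : Continuous fun h => X (t, y, h) := by fun_prop
      exact this.continuousAt.tendsto.mono_left nhdsWithin_le_nhds
    refine h1.congr' ?_
    filter_upwards [self_mem_nhdsWithin] with h hh
    have := hzero (t, y, h)
    simp only at this
    rw [smul_eq_mul, eq_inv_mul_iff_mul_eq₀ hh]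
    linarith
  · change X (t, y, 0) = _
    rw [hXE]
    have e : ∀ s ρ, avg3 (fun θ => θ * w θ) X (s, ρ, 0)
        = avg (fun θ => θ * w θ) (fun t y => X (t, y, 0)) s ρ := by
      intro s ρ
      simp [avg3, avg]
    simp only [e]
    simp [Q, Γ1, Γ2, P, δW]

theorem volterra_contDiff (n : ℕ) : ∀ {w : ℝ → ℝ}, Continuous w →
    (∀ θ ∈ Set.Icc (-1 : ℝ) 1, |w θ| ≤ 1) → ∀ {q : ℝ → ℝ}, ContDiff ℝ n q →
    ∀ {Γ : ℝ × ℝ × ℝ → ℝ}, ContDiff ℝ n Γ → ∀ {C : ℝ → ℝ → ℝ},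
    Continuous (fun p : ℝ × ℝ => C p.1 p.2) →
    (∀ t y, C t y = q y + ∫ s in (0 : ℝ)..t, Γ (s, y - s, avg w C s (y - s))) →
    ContDiff ℝ n (fun p : ℝ × ℝ => C p.1 p.2) := by
  induction n with
  | zero =>
    intro w _ _ q _ Γ _ C hC _
    exact contDiff_zero.2 hC
  | succ n ih =>
    intro w hw hw1 q hq Γ hΓ C hC hE
    have hq' : ContDiff ℝ (n + 1) q := by exact_mod_cast hq
    have hΓ' : ContDiff ℝ (n + 1) Γ := by exact_mod_cast hΓ
    have hCn := ih hw hw1 (hq'.of_le (by simp)) (hΓ'.of_le (by simp)) hC hE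
    have hWn := contDiff_avg hw hCn
    obtain ⟨C', hC', hd, hE'⟩ := volterra_hasDerivAt hw hw1 (hq'.of_le (by simp))
      (hΓ'.of_le (by simp)) hC hE
    have hfd : ContDiff ℝ n (fderiv ℝ Γ) := hΓ'.fderiv_right le_rfl
    have hP : ContDiff ℝ n fun p : ℝ × ℝ × ℝ => (p.1, p.2.1, avg w C p.1 p.2.1) := by
      have : ContDiff ℝ n fun p : ℝ × ℝ × ℝ => avg w C p.1 p.2.1 :=
        hWn.comp (f := fun p : ℝ × ℝ × ℝ => (p.1, p.2.1)) (by fun_prop)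
      fun_prop
    have hC'n : ContDiff ℝ n (fun p : ℝ × ℝ => C' p.1 p.2) := by
      refine ih (w := fun θ => θ * w θ) (by fun_prop) (fun θ hθ => ?_)
        (q := deriv q) ?_
        (Γ := fun p => fderiv ℝ Γ (p.1, p.2.1, avg w C p.1 p.2.1) (0, 1, 0)
          + fderiv ℝ Γ (p.1, p.2.1, avg w C p.1 p.2.1) (0, 0, 1) * p.2.2) ?_ hC' hE'
      · rw [abs_mul]
        exact mul_le_one₀ (abs_le.2 hθ) (abs_nonneg _) (hw1 θ hθ)
      · exact (contDiff_succ_iff_deriv.1 hq').2.2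
      · have h1 := (hfd.comp hP).clm_apply (contDiff_const (c := ((0 : ℝ), (1 : ℝ), (0 : ℝ))))
        have h2 := (hfd.comp hP).clm_apply (contDiff_const (c := ((0 : ℝ), (0 : ℝ), (1 : ℝ))))
        exact h1.add (h2.mul (by fun_prop))
    have := contDiff_succ_of_partials (n := n) (f := C)
      (ft := fun t y => Γ (t, y - t, avg w C t (y - t))) (fr := C') ?_ hd ?_ hC'n
    · exact_mod_cast this
    · intro t y
      have hW := continuous_avg hw hC
      have h1 : Continuous fun s : ℝ => avg w C s (y - s) :=
        continuous_comp_pair hW (by fun_prop) (by fun_prop)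
      have h2 := hΓ.continuous
      have h3 : Continuous fun s => Γ (s, y - s, avg w C s (y - s)) := by fun_prop
      have := (h3.integral_hasStrictDerivAt 0 t).hasDerivAt.const_add (q y)
      refine this.congr_of_eventuallyEq (Filter.Eventually.of_forall fun t => hE t y)
    · have h1 : ContDiff ℝ n fun p : ℝ × ℝ => avg w C p.1 (p.2 - p.1) :=
        hWn.comp (f := fun p : ℝ × ℝ => (p.1, p.2 - p.1)) (by fun_prop)
      exact (hΓ'.of_le (by simp)).comp
        (f := fun p : ℝ × ℝ => (p.1, p.2 - p.1, avg w C p.1 (p.2 - p.1))) (by fun_prop)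

theorem eq_of_mul_eq {f g : ℝ → ℝ} (hf : Continuous f) (hg : Continuous g)
    (h : ∀ r, r * f r = r * g r) (r : ℝ) : f r = g r := by
  have := Continuous.ext_on (dense_compl_singleton (0 : ℝ)) hf hg
    (fun r hr => mul_left_cancel₀ hr (h r))
  rw [this]

theorem integral_odd_eq_zero {f : ℝ → ℝ} (hf : ∀ x, f (-x) = -f x) (a : ℝ) :
    ∫ x in (-a)..a, f x = 0 := by
  have h := intervalIntegral.integral_comp_neg (a := -a) (b := a) f
  simp only [hf, intervalIntegral.integral_neg, neg_neg] at h
  linarith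

theorem deriv_even {f : ℝ → ℝ} (hf : ∀ x, f (-x) = f x) (x : ℝ) : deriv f (-x) = -deriv f x := by
  have : f = fun x => f (-x) := funext fun x => (hf x).symm
  have h := deriv_comp_neg f (-x)
  rw [← this, neg_neg] at h
  exact h

/-- Global smooth solution of the radial semilinear wave equation with Lipschitz nonlinearity. -/
theorem exists_radial_solution {g : ℝ → ℝ} (hg : ContDiff ℝ (⊤ : ℕ∞) g) {L : ℝ}
    (hL : ∀ u v, |g u - g v| ≤ L * |u - v|) {V0 V1 : ℝ → ℝ} (h0 : ContDiff ℝ (⊤ : ℕ∞) V0)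
    (h1 : ContDiff ℝ (⊤ : ℕ∞) V1) (e0 : ∀ r, V0 (-r) = V0 r) (e1 : ∀ r, V1 (-r) = V1 r) :
    ∃ V : ℝ → ℝ → ℝ, Sm V ∧ (∀ t r, V t (-r) = V t r) ∧ (∀ r, V 0 r = V0 r) ∧
      (∀ r, dt V 0 r = V1 r) ∧
      ∀ t r, r * dt (dt V) t r = r * dr (dr V) t r + 2 * dr V t r - r * g (V t r) := by
  have h0' : ContDiff ℝ (⊤ : ℕ∞) (deriv V0) := (contDiff_infty_iff_deriv.1 h0).2
  have d0 : ∀ r, HasDerivAt V0 (deriv V0 r) r := fun r =>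
    (h0.differentiable (by simp) r).hasDerivAt
  let q : ℝ → ℝ := fun y => V0 y + y * deriv V0 y + y * V1 y
  have hq : ContDiff ℝ (⊤ : ℕ∞) q := (h0.add (contDiff_id.mul h0')).add (contDiff_id.mul h1)
  have hgc := hg.continuous
  obtain ⟨X, hX, hXE⟩ := volterra_exists (w := fun _ => 1) continuous_const (by simp)
    (Q := fun p => q p.2.1) (by have := hq.continuous; fun_prop)
    (G := fun p u => -(p.2.1 * g u)) (by fun_prop) (b := fun p => |p.2.1| * L) (by fun_prop)
    (fun p u v => by
      rw [neg_sub_neg, ← mul_sub, abs_mul, mul_assoc, abs_sub_comm u v]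
      exact mul_le_mul_of_nonneg_left (hL v u) (abs_nonneg _))
  let B : ℝ → ℝ → ℝ := fun t y => X (t, y, 0)
  have hBE : ∀ t y, B t y = q y + ∫ s in (0 : ℝ)..t,
      -((y - s) * g (avg (fun _ => 1) B s (y - s))) := by
    intro t y
    change X (t, y, 0) = _
    rw [hXE]
    simp [avg3, avg, B]
  have hB : Sm B := by
    refine contDiff_infty.2 fun n => volterra_contDiff n (w := fun _ => 1) continuous_const (by simp)
      (q := q) (hq.of_le (by exact_mod_cast le_top)) (Γ := fun p => -(p.2.1 * g p.2.2)) ?_ ?_ hBE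
    · have : ContDiff ℝ n g := hg.of_le (by exact_mod_cast le_top)
      fun_prop
    · simp only [B]; fun_prop
  set V := avg (fun _ => 1) B with hVdef
  have hV : Sm V := hB.avg continuous_const
  have hVe : ∀ t r, V t (-r) = V t r := by
    intro t r
    simp only [hVdef, avg]
    congr 1
    have := intervalIntegral.integral_comp_neg (a := -1) (b := 1)
      (fun θ => (1 : ℝ) * B t (θ * r + t))
    rw [neg_neg] at this
    rw [← this]
    congr 1
    funext θ
    rw [neg_mul, mul_neg]
  have hBt : ∀ t y, dt B t y = -((y - t) * g (V t (y - t))) := by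
    intro t y
    have h3 : Continuous fun s => -((y - s) * g (V s (y - s))) := by
      have := hV.cont_comp (a := fun s : ℝ => s) (b := fun s => y - s) (by fun_prop) (by fun_prop)
      exact (Continuous.mul (by fun_prop) (hgc.comp this)).neg
    have := (h3.integral_hasStrictDerivAt 0 t).hasDerivAt.const_add (q y)
    exact (this.congr_of_eventuallyEq (Filter.Eventually.of_forall fun t => hBE t y)).deriv
  have hBrc : ∀ t r, Continuous fun θ : ℝ => dr B t (θ * r + t) := fun t r =>
    hB.dr.cont_comp (by fun_prop) (by fun_prop)
  have hBtc : ∀ t r, Continuous fun θ : ℝ => dt B t (θ * r + t) := fun t r =>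
    hB.dt.cont_comp (by fun_prop) (by fun_prop)
  have hBc : ∀ t r, Continuous fun θ : ℝ => B t (θ * r + t) := fun t r =>
    hB.cont_comp (by fun_prop) (by fun_prop)
  have hBθ : ∀ t r θ, HasDerivAt (fun θ : ℝ => B t (θ * r + t)) (dr B t (θ * r + t) * r) θ := by
    intro t r θ
    have h : HasDerivAt (fun θ => θ * r + t) r θ := by
      simpa using ((hasDerivAt_id θ).mul_const r).add_const t
    exact (hB.hasDr t (θ * r + t)).comp θ h
  have hVt : ∀ t r, r * dt V t r = 1 / 2 * (B t (r + t) - B t (-r + t)) := by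
    intro t r
    have e := (hasDerivAt_avg_left (w := fun _ => 1) continuous_const hB.c1 t r).deriv
    change dt V t r = _ at e
    rw [e]
    have i1 : ∫ θ in (-1 : ℝ)..1, dr B t (θ * r + t) * r = B t (r + t) - B t (-r + t) := by
      rw [intervalIntegral.integral_eq_sub_of_hasDerivAt (fun θ _ => hBθ t r θ)
        (((hBrc t r).mul continuous_const).intervalIntegrable _ _)]
      simp
    have i2 : ∫ θ in (-1 : ℝ)..1, dt B t (θ * r + t) = 0 := by
      refine integral_odd_eq_zero (fun θ => ?_) 1
      rw [hBt, hBt]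
      simp only [add_sub_cancel_right, neg_mul, hVe, neg_neg]
    simp only [avg, one_mul]
    rw [intervalIntegral.integral_add ((hBtc t r).intervalIntegrable _ _)
      ((hBrc t r).intervalIntegrable _ _), i2, ← i1, intervalIntegral.integral_mul_const]
    ring
  have hVr : ∀ t r, V t r + r * dr V t r = 1 / 2 * (B t (r + t) + B t (-r + t)) := by
    intro t r
    have e := (hasDerivAt_avg_right (w := fun _ => 1) continuous_const hB.continuous
      hB.dr.continuous hB.hasDr t r).deriv
    change dr V t r = _ at e
    rw [e]
    have hc2 : Continuous fun θ => r * (θ * dr B t (θ * r + t)) :=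
      continuous_const.mul (continuous_id.mul (hBrc t r))
    have hc3 : Continuous fun θ => B t (θ * r + t) + r * (θ * dr B t (θ * r + t)) :=
      (hBc t r).add hc2
    have i1 : ∫ θ in (-1 : ℝ)..1, (B t (θ * r + t) + r * (θ * dr B t (θ * r + t)))
        = B t (r + t) + B t (-r + t) := by
      rw [intervalIntegral.integral_eq_sub_of_hasDerivAt
        (f := fun θ => θ * B t (θ * r + t)) (fun θ _ => ?_)
        (hc3.intervalIntegrable _ _)]
      · simp
      · refine ((hasDerivAt_id θ).mul (hBθ t r θ)).congr_deriv ?_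
        simp only [id]
        ring
    rw [← i1, intervalIntegral.integral_add ((hBc t r).intervalIntegrable _ _)
      (hc2.intervalIntegrable _ _),
      intervalIntegral.integral_const_mul]
    simp only [hVdef, avg, one_mul, mul_one]
    ring
  have hat : ∀ t r, HasDerivAt (fun t => B t (r + t)) (dt B t (r + t) + dr B t (r + t)) t := by
    intro t r
    have := hasDerivAt_comp_pair hB.c1 (hasDerivAt_id t) ((hasDerivAt_id t).const_add r)
    simpa using this
  have hqev : ∀ r, q r - q (-r) = 2 * (r * V1 r) := by
    intro r
    simp only [q, e0, e1, deriv_even e0]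
    ring
  have hB0 : ∀ y, B 0 y = q y := fun y => by rw [hBE]; simp
  refine ⟨V, hV, hVe, fun r => ?_, fun r => ?_, fun t r => ?_⟩
  · have hd0 : ∀ θ : ℝ, HasDerivAt (fun θ : ℝ => θ * V0 (θ * r))
        (V0 (θ * r) + θ * r * deriv V0 (θ * r)) θ := by
      intro θ
      have h := (hasDerivAt_id θ).mul ((d0 (θ * r)).comp θ ((hasDerivAt_id θ).mul_const r))
      refine h.congr_deriv ?_
      simp only [id, Function.comp]
      ring
    have hc0 := h0.continuous
    have hc0' := h0'.continuous
    have hc1 := h1.continuous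
    simp only [hVdef, avg, hB0, add_zero, one_mul, q]
    rw [intervalIntegral.integral_add (Continuous.intervalIntegrable (by fun_prop) _ _)
      (Continuous.intervalIntegrable (by fun_prop) _ _),
      integral_odd_eq_zero (f := fun θ => θ * r * V1 (θ * r)) (fun θ => by
        simp only [neg_mul, e1]),
      intervalIntegral.integral_eq_sub_of_hasDerivAt (fun θ _ => hd0 θ)
        (Continuous.intervalIntegrable (by fun_prop) _ _)]
    simp only [one_mul, neg_mul, e0]
    ring
  · refine eq_of_mul_eq (hV.dt.cont_comp continuous_const continuous_id) h1.continuous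
      (fun r => ?_) r
    change r * dt V 0 r = _
    have := hqev r
    rw [hVt, add_zero, add_zero, hB0, hB0]
    linarith
  · have ht : r * dt (dt V) t r = 1 / 2 * ((dt B t (r + t) + dr B t (r + t))
        - (dt B t (-r + t) + dr B t (-r + t))) := by
      have a1 := (hV.dt.hasDt t r).const_mul r
      have a2 := ((hat t r).sub (hat t (-r))).const_mul (1 / 2)
      exact a1.unique (a2.congr_of_eventuallyEq (Filter.Eventually.of_forall fun t => hVt t r))
    have hr : r * dr (dr V) t r + 2 * dr V t r = 1 / 2 * (dr B t (r + t) - dr B t (-r + t)) := by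
      have a1 := (hV.hasDr t r).add ((hasDerivAt_id r).mul (hV.dr.hasDr t r))
      have b1 := (hB.hasDr t (r + t)).comp r ((hasDerivAt_id r).add_const t)
      have b2 := (hB.hasDr t (-r + t)).comp r ((hasDerivAt_neg r).add_const t)
      have a2 := (b1.add b2).const_mul (1 / 2)
      have := a1.unique (a2.congr_of_eventuallyEq (Filter.Eventually.of_forall fun r => hVr t r))
      simp only [id] at this
      linarith
    rw [ht, hr, hBt, hBt]
    simp only [add_sub_cancel_right, hVe]
    ring

/-- The quotient `V_r / r` of an even function `V`, as a smooth function. -/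
def radialQuot (V : ℝ → ℝ → ℝ) : ℝ → ℝ → ℝ :=
  avg (fun _ => 1) fun t y => dr (dr V) t (y - t)

theorem Sm.radialQuot {V : ℝ → ℝ → ℝ} (hV : Sm V) : Sm (radialQuot V) := by
  refine Sm.avg (C := fun t y => _root_.dr (_root_.dr V) t (y - t)) continuous_const ?_
  exact ContDiff.comp (g := fun p : ℝ × ℝ => _root_.dr (_root_.dr V) p.1 p.2) hV.dr.dr
    (f := fun p : ℝ × ℝ => (p.1, p.2 - p.1)) (by fun_prop)

theorem dr_neg_of_even {V : ℝ → ℝ → ℝ} (he : ∀ t r, V t (-r) = V t r) (t r : ℝ) :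
    dr V t (-r) = -dr V t r := deriv_even (he t) r

theorem deriv_odd {f : ℝ → ℝ} (hf : ∀ x, f (-x) = -f x) (x : ℝ) : deriv f (-x) = deriv f x := by
  have h2 := deriv_comp_neg f x
  have : (fun x => f (-x)) = -f := funext hf
  rw [this, deriv.neg] at h2
  linarith

theorem dr_dr_neg_of_even {V : ℝ → ℝ → ℝ} (he : ∀ t r, V t (-r) = V t r) (t r : ℝ) :
    dr (dr V) t (-r) = dr (dr V) t r :=
  deriv_odd (dr_neg_of_even he t) r

theorem radialQuot_even {V : ℝ → ℝ → ℝ} (he : ∀ t r, V t (-r) = V t r) (t r : ℝ) :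
    radialQuot V t (-r) = radialQuot V t r := by
  simp only [radialQuot, avg, add_sub_cancel_right, mul_neg, dr_dr_neg_of_even he]

theorem mul_radialQuot {V : ℝ → ℝ → ℝ} (hV : Sm V) (he : ∀ t r, V t (-r) = V t r) (t r : ℝ) :
    r * radialQuot V t r = dr V t r := by
  have hc : Continuous fun θ : ℝ => dr (dr V) t (θ * r) :=
    hV.dr.dr.cont_comp continuous_const (by fun_prop)
  have hd : ∀ θ : ℝ, HasDerivAt (fun θ => dr V t (θ * r)) (dr (dr V) t (θ * r) * r) θ := fun θ => by
    have h : HasDerivAt (fun θ => θ * r) r θ := by simpa using (hasDerivAt_id θ).mul_const r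
    exact (hV.dr.hasDr t (θ * r)).comp θ h
  have h1 : ∫ θ in (-1 : ℝ)..1, dr (dr V) t (θ * r) * r = dr V t r - dr V t (-r) := by
    rw [intervalIntegral.integral_eq_sub_of_hasDerivAt (fun θ _ => hd θ)
      ((hc.mul continuous_const).intervalIntegrable _ _)]
    simp
  rw [intervalIntegral.integral_mul_const, dr_neg_of_even he] at h1
  simp only [radialQuot, avg, add_sub_cancel_right, one_mul]
  linarith

theorem hasFDerivAt_radial {V : ℝ → ℝ → ℝ} (hV : Sm V) (he : ∀ t r, V t (-r) = V t r)
    (p : ℝ × Sp) : HasFDerivAt (fun p : ℝ × Sp => V p.1 ‖p.2‖)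
      (dt V p.1 ‖p.2‖ • ContinuousLinearMap.fst ℝ ℝ Sp
        + radialQuot V p.1 ‖p.2‖ • (innerSL ℝ p.2).comp (ContinuousLinearMap.snd ℝ ℝ Sp)) p := by
  obtain ⟨t, x⟩ := p
  set w := radialQuot V t ‖x‖ with hw
  set a := dt V t ‖x‖ with ha
  have hN : HasFDerivAt (fun q : ℝ × ℝ => V q.1 q.2 - w / 2 * q.2 ^ 2)
      (a • ContinuousLinearMap.fst ℝ ℝ ℝ) (t, ‖x‖) := by
    have h1 : HasFDerivAt (fun q : ℝ × ℝ => V q.1 q.2)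
        (a • ContinuousLinearMap.fst ℝ ℝ ℝ + dr V t ‖x‖ • ContinuousLinearMap.snd ℝ ℝ ℝ)
        (t, ‖x‖) := by
      have := (hV.c1.differentiable one_ne_zero (t, ‖x‖)).hasFDerivAt
      convert! this using 1
      ext
      · have e := dt_eq_fderiv hV.c1 (t, ‖x‖)
        simp only at e
        simp [ha, e]
      · have e := dr_eq_fderiv hV.c1 (t, ‖x‖)
        simp only at e
        simp [e]
    have h2 : HasFDerivAt (fun q : ℝ × ℝ => w / 2 * q.2 ^ 2)
        ((w / 2 * (2 * ‖x‖)) • ContinuousLinearMap.snd ℝ ℝ ℝ) (t, ‖x‖) := by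
      have := ((hasFDerivAt_snd (𝕜 := ℝ) (p := (t, ‖x‖))).pow 2).const_mul (w / 2)
      convert! this using 1
      ext <;> simp
    convert! h1.sub h2 using 1
    rw [← mul_radialQuot hV he, ← hw]
    ext <;> simp
    ring
  have hN' : HasFDerivAt (fun q : ℝ × Sp => V q.1 ‖q.2‖ - w / 2 * ‖q.2‖ ^ 2)
      (a • ContinuousLinearMap.fst ℝ ℝ Sp) (t, x) := by
    rw [hasFDerivAt_iff_isLittleO] at hN ⊢
    have hcont : Filter.Tendsto (fun q : ℝ × Sp => (q.1, ‖q.2‖)) (nhds (t, x)) (nhds (t, ‖x‖)) := by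
      have : Continuous fun q : ℝ × Sp => (q.1, ‖q.2‖) := by fun_prop
      exact this.tendsto (t, x)
    have h3 := hN.comp_tendsto hcont
    refine (h3.trans_isBigO ?_).congr_left ?_
    · refine Asymptotics.IsBigO.of_bound 1 (Filter.Eventually.of_forall fun q => ?_)
      simp only [Function.comp, Prod.norm_def, Prod.fst_sub, Prod.snd_sub, one_mul]
      exact max_le_max le_rfl (abs_norm_sub_norm_le _ _)
    · intro q
      simp
  have h4 : HasFDerivAt (fun q : ℝ × Sp => w / 2 * ‖q.2‖ ^ 2)
      (w • (innerSL ℝ x).comp (ContinuousLinearMap.snd ℝ ℝ Sp)) (t, x) := by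
    have := ((hasFDerivAt_snd (𝕜 := ℝ) (E := ℝ) (F := Sp) (p := (t, x))).norm_sq).const_mul (w / 2)
    convert! this using 1
    ext <;> simp
    ring
  have := hN'.add h4
  refine this.congr_of_eventuallyEq (Filter.Eventually.of_forall fun q => ?_)
  simp

theorem contDiff_radial (n : ℕ) : ∀ {V : ℝ → ℝ → ℝ}, Sm V → (∀ t r, V t (-r) = V t r) →
    ContDiff ℝ n (fun p : ℝ × Sp => V p.1 ‖p.2‖) := by
  induction n with
  | zero =>
    intro V hV _
    exact contDiff_zero.2 (hV.cont_comp continuous_fst continuous_snd.norm)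
  | succ n ih =>
    intro V hV he
    have : ContDiff ℝ (n + 1) (fun p : ℝ × Sp => V p.1 ‖p.2‖) := by
      rw [contDiff_succ_iff_hasFDerivAt]
      refine ⟨_, ?_, hasFDerivAt_radial hV he⟩
      have h1 := ih hV.dt (fun t r => by simp only [dt, he])
      have h2 := ih hV.radialQuot (radialQuot_even he)
      refine (h1.smul contDiff_const).add (h2.smul (ContDiff.clm_comp ?_ contDiff_const))
      exact (innerSL ℝ).contDiff.comp contDiff_snd
    exact_mod_cast this

theorem hasFDerivAt_radial_slice {V : ℝ → ℝ → ℝ} (hV : Sm V) (he : ∀ t r, V t (-r) = V t r) (t : ℝ)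
    (x : Sp) : HasFDerivAt (fun x : Sp => V t ‖x‖) (radialQuot V t ‖x‖ • innerSL ℝ x) x := by
  have h := (hasFDerivAt_radial hV he (t, x)).comp x (hasFDerivAt_prodMk_right (𝕜 := ℝ) t x)
  convert! h using 1
  ext y
  simp

theorem lap_radial {V : ℝ → ℝ → ℝ} (hV : Sm V) (he : ∀ t r, V t (-r) = V t r) (t : ℝ) (x : Sp) :
    lap (fun x => V t ‖x‖) x = dr (dr V) t ‖x‖ + 2 * radialQuot V t ‖x‖ := by
  set W := radialQuot V
  have hW : Sm W := hV.radialQuot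
  have heW : ∀ t r, W t (-r) = W t r := radialQuot_even he
  have h1 : ∀ i, pd i (fun x : Sp => V t ‖x‖) = fun x => W t ‖x‖ * x i := by
    intro i
    funext x
    rw [pd, (hasFDerivAt_radial_slice hV he t x).fderiv]
    simp [W, EuclideanSpace.inner_single_right]
  have h2 : ∀ i, pd i (fun x : Sp => W t ‖x‖ * x i) x
      = W t ‖x‖ + radialQuot W t ‖x‖ * (x i) ^ 2 := by
    intro i
    have hx : HasFDerivAt (fun x : Sp => x i) (EuclideanSpace.proj i : Sp →L[ℝ] ℝ) x :=
      (EuclideanSpace.proj i : Sp →L[ℝ] ℝ).hasFDerivAt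
    have h : HasFDerivAt (fun x : Sp => W t ‖x‖ * x i) _ x := (hasFDerivAt_radial_slice hW heW t x).mul hx
    rw [pd, h.fderiv]
    simp [EuclideanSpace.inner_single_right]
    ring
  have h3 : dr (dr V) t ‖x‖ = W t ‖x‖ + ‖x‖ ^ 2 * radialQuot W t ‖x‖ := by
    have e : dr V t = fun r => r * W t r := funext fun r => (mul_radialQuot hV he t r).symm
    have := ((hasDerivAt_id ‖x‖).mul (hW.hasDr t ‖x‖)).deriv
    rw [dr, e]
    refine this.trans ?_
    rw [← mul_radialQuot hW heW]
    simp only [id]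
    ring
  rw [lap]
  simp only [h1, h2, h3, EuclideanSpace.norm_sq_eq, Fin.sum_univ_three, Real.norm_eq_abs, sq_abs]
  ring

/-- A smooth even solution of the radial equation lifts to a smooth solution on `ℝ³`. -/
theorem radial_lift {V : ℝ → ℝ → ℝ} (hV : Sm V) (he : ∀ t r, V t (-r) = V t r) {g : ℝ → ℝ}
    (hg : Continuous g)
    (hE : ∀ t r, r * dt (dt V) t r = r * dr (dr V) t r + 2 * dr V t r - r * g (V t r)) :
    ContDiff ℝ (⊤ : ℕ∞) (fun p : ℝ × Sp => V p.1 ‖p.2‖) ∧ ∀ (t : ℝ) (x : Sp),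
      deriv (deriv fun s => V s ‖x‖) t = lap (fun x => V t ‖x‖) x - g (V t ‖x‖) := by
  refine ⟨contDiff_infty.2 fun n => contDiff_radial n hV he, fun t x => ?_⟩
  rw [lap_radial hV he]
  have hc : ∀ {f : ℝ → ℝ → ℝ}, Sm f → Continuous (f t) := fun hf =>
    hf.cont_comp continuous_const continuous_id
  refine eq_of_mul_eq (f := fun r => dt (dt V) t r)
    (g := fun r => dr (dr V) t r + 2 * radialQuot V t r - g (V t r)) (hc hV.dt.dt) ?_ (fun r => ?_) _
  · exact ((hc hV.dr.dr).add (continuous_const.mul (hc hV.radialQuot))).sub (hg.comp (hc hV))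
  · rw [hE, ← mul_radialQuot hV he]
    ring

/-- The radial profile of a smooth radial function on `ℝ³`. -/
theorem exists_profile {u : Sp → ℝ} (hu : ContDiff ℝ (⊤ : ℕ∞) u)
    (hrad : ∀ x y : Sp, ‖x‖ = ‖y‖ → u x = u y) (hsupp : HasCompactSupport u) :
    ∃ U : ℝ → ℝ, ContDiff ℝ (⊤ : ℕ∞) U ∧ (∀ r, U (-r) = U r) ∧ (∀ x, u x = U ‖x‖) ∧
      ∃ R, 0 ≤ R ∧ ∀ r, R < |r| → U r = 0 := by
  have hn : ∀ r : ℝ, ‖EuclideanSpace.single (0 : Fin 3) r‖ = |r| := fun r => by simp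
  refine ⟨fun r => u (r • EuclideanSpace.single 0 1), by fun_prop, fun r => ?_, fun x => ?_, ?_⟩
  · exact hrad _ _ (by simp [norm_smul])
  · exact hrad _ _ (by simp [norm_smul])
  · obtain ⟨R, hR⟩ := hsupp.isCompact.isBounded.subset_closedBall (0 : Sp)
    refine ⟨max R 0, le_max_right _ _, fun r hr => ?_⟩
    by_contra hne
    have := hR (subset_tsupport u hne)
    rw [mem_closedBall_zero_iff] at this
    simp [norm_smul] at this
    exact absurd (hr.trans_le this) (not_lt.2 (le_max_left _ _))

theorem integrable_of_vanish {f : Sp → ℝ} (hf : Continuous f) {x0 : Sp} {R : ℝ}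
    (h : ∀ x, R < ‖x - x0‖ → f x = 0) : Integrable f :=
  hf.integrable_of_hasCompactSupport (HasCompactSupport.intro (isCompact_closedBall x0 R)
    fun x hx => h x (by simpa [dist_eq_norm] using hx))

theorem hasDerivAt_integral_cone {H H' : ℝ → Sp → ℝ}
    (hH : Continuous fun p : ℝ × Sp => H p.1 p.2) (hH' : Continuous fun p : ℝ × Sp => H' p.1 p.2)
    (hd : ∀ t x, HasDerivAt (fun t => H t x) (H' t x) t) {x0 : Sp} {R : ℝ}
    (hs : ∀ t x, |R - t| < ‖x - x0‖ → H t x = 0)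
    (hs' : ∀ t x, |R - t| < ‖x - x0‖ → H' t x = 0) (t : ℝ) :
    HasDerivAt (fun t => ∫ x, H t x) (∫ x, H' t x) t := by
  have hc : ∀ {G : ℝ → Sp → ℝ}, Continuous (fun p : ℝ × Sp => G p.1 p.2) → ∀ t, Continuous (G t) :=
    fun hG t => hG.comp (f := fun x : Sp => (t, x)) (by fun_prop)
  set K := Metric.closedBall x0 (|R - t| + 1)
  have hK : IsCompact K := isCompact_closedBall _ _
  obtain ⟨C, hC⟩ := ((isCompact_closedBall t 1).prod hK).exists_bound_of_continuousOn hH'.continuousOn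
  refine (hasDerivAt_integral_of_dominated_loc_of_deriv_le (F := H) (F' := H')
    (bound := K.indicator fun _ => C) (Metric.closedBall_mem_nhds t one_pos)
    (Filter.Eventually.of_forall fun s => (hc hH s).aestronglyMeasurable)
    (integrable_of_vanish (hc hH t) (hs t)) (hc hH' t).aestronglyMeasurable
    (Filter.Eventually.of_forall fun x s hs1 => ?_) ?_
    (Filter.Eventually.of_forall fun x s _ => hd s x)).2
  · by_cases hx : x ∈ K
    · rw [Set.indicator_of_mem hx]
      exact hC (s, x) ⟨hs1, hx⟩
    · rw [Set.indicator_of_notMem hx, hs' s x, norm_zero]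
      rw [Metric.mem_closedBall, Real.dist_eq] at hs1
      simp only [K, Metric.mem_closedBall, dist_eq_norm, not_le] at hx
      have : |R - s| ≤ |R - t| + |s - t| := by
        have := abs_sub_le R t s
        rwa [abs_sub_comm t s] at this
      linarith
  · exact (integrable_indicator_iff hK.measurableSet).2
      (integrableOn_const hK.measure_lt_top.ne)

/-- Directional derivative of a function on space-time. -/
def Dd (a : ℝ × Sp) (W : ℝ × Sp → ℝ) (p : ℝ × Sp) : ℝ := fderiv ℝ W p a

/-- The time direction. -/
def eT : ℝ × Sp := (1, 0)

/-- The `i`-th space direction. -/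
def eX (i : Fin 3) : ℝ × Sp := (0, EuclideanSpace.single i 1)

theorem contDiff_Dd {W : ℝ × Sp → ℝ} (hW : ContDiff ℝ (⊤ : ℕ∞) W) (a : ℝ × Sp) :
    ContDiff ℝ (⊤ : ℕ∞) (Dd a W) :=
  (hW.fderiv_right (m := (⊤ : ℕ∞)) (by simp)).clm_apply contDiff_const

theorem Dd_comm {W : ℝ × Sp → ℝ} (hW : ContDiff ℝ (⊤ : ℕ∞) W) (a b p : ℝ × Sp) :
    Dd a (Dd b W) p = Dd b (Dd a W) p := by
  have hs : IsSymmSndFDerivAt ℝ W p :=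
    ContDiffAt.isSymmSndFDerivAt (n := 2) (hW.contDiffAt.of_le two_le_infty) (by simp)
  have hd : DifferentiableAt ℝ (fderiv ℝ W) p :=
    (hW.fderiv_right (m := (⊤ : ℕ∞)) (by simp)).differentiable (by simp) p
  have e : ∀ a b, Dd a (Dd b W) p = fderiv ℝ (fderiv ℝ W) p a b := by
    intro a b
    unfold Dd
    rw [fderiv_clm_apply hd (differentiableAt_const b)]
    simp
  rw [e, e]
  exact hs a b

theorem hasDerivAt_Dd_time {W : ℝ × Sp → ℝ} (hW : Differentiable ℝ W) (t : ℝ) (x : Sp) :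
    HasDerivAt (fun t => W (t, x)) (Dd eT W (t, x)) t :=
  (hW (t, x)).hasFDerivAt.comp_hasDerivAt t ((hasDerivAt_id t).prodMk (hasDerivAt_const t x))

theorem fderiv_slice {W : ℝ × Sp → ℝ} (hW : Differentiable ℝ W) (t : ℝ) (x : Sp) (i : Fin 3) :
    fderiv ℝ (fun x => W (t, x)) x (EuclideanSpace.single i 1) = Dd (eX i) W (t, x) := by
  have h := (hW (t, x)).hasFDerivAt.comp x (hasFDerivAt_prodMk_right (𝕜 := ℝ) t x)
  have := h.fderiv
  simp only [Function.comp_def] at this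
  rw [this]
  simp [Dd, eX]

theorem integral_mul_Dd {φ ψ : ℝ × Sp → ℝ} (hφ : ContDiff ℝ 1 φ) (hψ : ContDiff ℝ 1 ψ) {t R : ℝ}
    {x0 : Sp} (hs : ∀ x, R < ‖x - x0‖ → φ (t, x) = 0)
    (hs' : ∀ i x, R < ‖x - x0‖ → Dd (eX i) φ (t, x) = 0) (i : Fin 3) :
    ∫ x, φ (t, x) * Dd (eX i) ψ (t, x) = -∫ x, Dd (eX i) φ (t, x) * ψ (t, x) := by
  have dφ := hφ.differentiable one_ne_zero
  have dψ := hψ.differentiable one_ne_zero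
  have cφ := hφ.continuous_fderiv one_ne_zero
  have cψ := hψ.continuous_fderiv one_ne_zero
  have c1 := hφ.continuous
  have c2 := hψ.continuous
  have c3 : Continuous (Dd (eX i) φ) := by unfold Dd; fun_prop
  have c4 : Continuous (Dd (eX i) ψ) := by unfold Dd; fun_prop
  have key := integral_mul_fderiv_eq_neg_fderiv_mul_of_integrable (μ := (volume : Measure Sp))
    (f := fun x => φ (t, x)) (g := fun x => ψ (t, x)) (v := EuclideanSpace.single i 1)
    ?_ ?_ ?_ (fun x _ => by fun_prop) (fun x _ => by fun_prop)
  · simp only [fderiv_slice dφ, fderiv_slice dψ] at key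
    exact key
  · simp only [fderiv_slice dφ]
    exact integrable_of_vanish (x0 := x0) (R := R) (by fun_prop)
      (fun x hx => by rw [hs' i x hx, zero_mul])
  · simp only [fderiv_slice dψ]
    exact integrable_of_vanish (x0 := x0) (R := R) (by fun_prop)
      (fun x hx => by rw [hs x hx, zero_mul])
  · exact integrable_of_vanish (x0 := x0) (R := R) (by fun_prop)
      (fun x hx => by rw [hs x hx, zero_mul])

theorem energy_flux_nonpos {z ρ a e y0 y1 y2 b0 b1 b2 : ℝ} (hz : 0 ≤ z) (hρ : 0 < ρ)
    (hzy : z ≠ 0 → y0 ^ 2 + y1 ^ 2 + y2 ^ 2 ≤ ρ ^ 2)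
    (he : 1 / 2 * (a ^ 2 + (b0 ^ 2 + b1 ^ 2 + b2 ^ 2)) ≤ e) :
    z * (-(2 * ρ)) * e - (z * (-(2 * y0)) * (a * b0) + z * (-(2 * y1)) * (a * b1)
      + z * (-(2 * y2)) * (a * b2)) ≤ 0 := by
  by_cases h0 : z = 0
  · simp [h0]
  have hy := hzy h0
  set S := y0 * b0 + y1 * b1 + y2 * b2 with hS
  have hS2 : S ^ 2 ≤ ρ ^ 2 * (b0 ^ 2 + b1 ^ 2 + b2 ^ 2) := by
    have h1 : S ^ 2 ≤ (y0 ^ 2 + y1 ^ 2 + y2 ^ 2) * (b0 ^ 2 + b1 ^ 2 + b2 ^ 2) := by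
      have e1 := sq_nonneg (y0 * b1 - y1 * b0)
      have e2 := sq_nonneg (y0 * b2 - y2 * b0)
      have e3 := sq_nonneg (y1 * b2 - y2 * b1)
      simp only [hS]
      nlinarith
    refine h1.trans (mul_le_mul_of_nonneg_right hy (by positivity))
  have h2 : ρ * (a * S) ≤ ρ * (ρ * e) := by
    have := sq_nonneg (ρ * a - S)
    nlinarith [mul_pos hρ hρ]
  have h3 : a * S ≤ ρ * e := le_of_mul_le_mul_left h2 hρ
  have : z * (a * S) ≤ z * (ρ * e) := mul_le_mul_of_nonneg_left h3 hz
  simp only [hS] at this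
  linarith

/-- Cutoff adapted to the backward light cone with vertex `(R, x0)`. -/
def coneCutoff (R : ℝ) (x0 : Sp) (p : ℝ × Sp) : ℝ :=
  expNegInvGlue ((R - p.1) ^ 2 - ‖p.2 - x0‖ ^ 2)

theorem contDiff_coneCutoff (R : ℝ) (x0 : Sp) : ContDiff ℝ (⊤ : ℕ∞) (coneCutoff R x0) := by
  refine ContDiff.comp (g := expNegInvGlue) expNegInvGlue.contDiff ?_
  exact (by fun_prop : ContDiff ℝ (⊤ : ℕ∞) fun p : ℝ × Sp => (R - p.1) ^ 2).sub
    ((contDiff_snd.sub contDiff_const).norm_sq ℝ)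

theorem Dd_coneCutoff (R : ℝ) (x0 : Sp) (p a : ℝ × Sp) : Dd a (coneCutoff R x0) p
    = deriv expNegInvGlue ((R - p.1) ^ 2 - ‖p.2 - x0‖ ^ 2)
      * (-(2 * (R - p.1) * a.1) - 2 * inner ℝ (p.2 - x0) a.2) := by
  have h0 : DifferentiableAt ℝ expNegInvGlue ((R - p.1) ^ 2 - ‖p.2 - x0‖ ^ 2) :=
    (expNegInvGlue.contDiff (n := ⊤)).differentiable (by simp) _
  have h1 : HasFDerivAt (fun p : ℝ × Sp => (R - p.1) ^ 2 - ‖p.2 - x0‖ ^ 2) _ p :=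
    ((hasFDerivAt_fst.const_sub R).pow 2).sub ((hasFDerivAt_snd.sub_const x0).norm_sq)
  have h2 := (h0.hasDerivAt.comp_hasFDerivAt p h1).fderiv
  unfold Dd coneCutoff
  simp only [Function.comp_def] at h2
  rw [h2]
  simp [inner_sub_left]

theorem deriv_expNegInvGlue_of_neg {s : ℝ} (hs : s < 0) : deriv expNegInvGlue s = 0 := by
  have : expNegInvGlue =ᶠ[nhds s] fun _ => 0 := by
    filter_upwards [Iio_mem_nhds hs] with x hx using expNegInvGlue.zero_of_nonpos (le_of_lt hx)
  rw [this.deriv_eq, deriv_const]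

theorem sq_sub_norm_sq_neg {R t : ℝ} {x0 x : Sp} (h : |R - t| < ‖x - x0‖) :
    (R - t) ^ 2 - ‖x - x0‖ ^ 2 < 0 := by
  have h0 := abs_nonneg (R - t)
  rw [← sq_abs (R - t)]
  nlinarith

theorem energy_local {W : ℝ × Sp → ℝ} (hW : ContDiff ℝ (⊤ : ℕ∞) W) {T R Λ : ℝ} {x0 : Sp}
    (hTR : T < R) (hΛ : 0 ≤ Λ)
    (hE : ∀ t ∈ Set.Icc 0 T, ∀ x, ‖x - x0‖ ≤ R →
      |Dd eT (Dd eT W) (t, x) - ∑ i, Dd (eX i) (Dd (eX i) W) (t, x)| ≤ Λ * |W (t, x)|)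
    (h0 : ∀ x ∈ Metric.ball x0 R, W (0, x) = 0)
    (h1 : ∀ x ∈ Metric.ball x0 R, Dd eT W (0, x) = 0) :
    ∀ t ∈ Set.Icc 0 T, W (t, x0) = 0 := by
  set φ := coneCutoff R x0 with hφdef
  have hφ : ContDiff ℝ (⊤ : ℕ∞) φ := contDiff_coneCutoff R x0
  have hφnn : ∀ p, 0 ≤ φ p := fun p => expNegInvGlue.nonneg _
  have hφ0 : ∀ t x, |R - t| < ‖x - x0‖ → φ (t, x) = 0 := fun t x h =>
    expNegInvGlue.zero_of_nonpos (sq_sub_norm_sq_neg h).le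
  have hDφ0 : ∀ a t x, |R - t| < ‖x - x0‖ → Dd a φ (t, x) = 0 := fun a t x h => by
    rw [hφdef, Dd_coneCutoff, deriv_expNegInvGlue_of_neg (sq_sub_norm_sq_neg h), zero_mul]
  have c1 : ∀ {G : ℝ × Sp → ℝ}, ContDiff ℝ (⊤ : ℕ∞) G → ContDiff ℝ 1 G := fun h =>
    h.of_le (by exact_mod_cast le_top)
  have df : ∀ {G : ℝ × Sp → ℝ}, ContDiff ℝ (⊤ : ℕ∞) G → Differentiable ℝ G := fun h =>
    h.differentiable (by simp)
  set a := Dd eT W with ha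
  have hac : ContDiff ℝ (⊤ : ℕ∞) a := contDiff_Dd hW eT
  let b : Fin 3 → ℝ × Sp → ℝ := fun i => Dd (eX i) W
  have hbc : ∀ i, ContDiff ℝ (⊤ : ℕ∞) (b i) := fun i => contDiff_Dd hW (eX i)
  let e : ℝ × Sp → ℝ := fun p => 1 / 2 * (a p ^ 2 + (b 0 p ^ 2 + b 1 p ^ 2 + b 2 p ^ 2) + W p ^ 2)
  have hb0 := hbc 0
  have hb1 := hbc 1
  have hb2 := hbc 2
  have hec : ContDiff ℝ (⊤ : ℕ∞) e := by fun_prop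
  have henn : ∀ p, 0 ≤ e p := fun p => by simp only [e]; positivity
  let H' : ℝ × Sp → ℝ := fun p => Dd eT φ p * e p + φ p * (a p * Dd eT a p
    + (b 0 p * Dd (eX 0) a p + b 1 p * Dd (eX 1) a p + b 2 p * Dd (eX 2) a p) + W p * a p)
  have cDa : ∀ v, Continuous (Dd v a) := fun v => (contDiff_Dd hac v).continuous
  have cDφ : ∀ v, Continuous (Dd v φ) := fun v => (contDiff_Dd hφ v).continuous
  have cDb : ∀ v i, Continuous (Dd v (b i)) := fun v i => (contDiff_Dd (hbc i) v).continuous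
  have cφ := hφ.continuous
  have ca := hac.continuous
  have ce := hec.continuous
  have cW := hW.continuous
  have cb : ∀ i, Continuous (b i) := fun i => (hbc i).continuous
  have cH' : Continuous H' := by
    have := cDa eT; have := cDa (eX 0); have := cDa (eX 1); have := cDa (eX 2)
    have := cDφ eT; have := cb 0; have := cb 1; have := cb 2
    fun_prop
  have hd : ∀ t x, HasDerivAt (fun t => φ (t, x) * e (t, x)) (H' (t, x)) t := by
    intro t x
    have k := fun {G : ℝ × Sp → ℝ} (hG : ContDiff ℝ (⊤ : ℕ∞) G) => hasDerivAt_Dd_time (df hG) t x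
    have hb : ∀ i, HasDerivAt (fun t => b i (t, x)) (Dd (eX i) a (t, x)) t := fun i => by
      rw [ha, Dd_comm hW]
      exact k (hbc i)
    have he : HasDerivAt (fun t => e (t, x)) (a (t, x) * Dd eT a (t, x)
        + (b 0 (t, x) * Dd (eX 0) a (t, x) + b 1 (t, x) * Dd (eX 1) a (t, x)
          + b 2 (t, x) * Dd (eX 2) a (t, x)) + W (t, x) * a (t, x)) t := by
      have := ((((k hac).pow 2).add ((((hb 0).pow 2).add ((hb 1).pow 2)).add ((hb 2).pow 2))).add
        ((k hW).pow 2)).const_mul (1 / 2)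
      refine this.congr_deriv ?_
      simp only [← ha]
      push_cast
      ring
    exact (k hφ).mul he
  have vH' : ∀ t x, |R - t| < ‖x - x0‖ → H' (t, x) = 0 := fun t x h => by
    simp only [H', hDφ0 _ t x h, hφ0 t x h, zero_mul, add_zero]
  have hJ := hasDerivAt_integral_cone (H := fun t x => φ (t, x) * e (t, x))
    (H' := fun t x => H' (t, x)) (by fun_prop) (by fun_prop) hd (x0 := x0) (R := R)
    (fun t x h => by simp only [hφ0 t x h, zero_mul]) vH'
  set J : ℝ → ℝ := fun t => ∫ x, φ (t, x) * e (t, x) with hJdef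
  have hib : ∀ t i, ∫ x, φ (t, x) * (a (t, x) * Dd (eX i) (b i) (t, x)
      + b i (t, x) * Dd (eX i) a (t, x)) = -∫ x, Dd (eX i) φ (t, x) * (a (t, x) * b i (t, x)) := by
    intro t i
    have := integral_mul_Dd (c1 hφ) (ψ := fun p => a p * b i p) (c1 (hac.mul (hbc i))) (t := t)
      (hφ0 t) (fun j x h => hDφ0 _ t x h) i
    rw [← this]
    congr 1
    funext x
    congr 1
    have h2 : HasFDerivAt (fun p => a p * b i p) _ (t, x) :=
      ((df hac) (t, x)).hasFDerivAt.mul ((df (hbc i)) (t, x)).hasFDerivAt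
    simp only [Dd]
    rw [h2.fderiv]
    simp
  let B : ℝ × Sp → ℝ := fun p => Dd eT a p - ∑ i, Dd (eX i) (b i) p
  have hJ' : ∀ t ∈ Set.Ioo 0 T, ∫ x, H' (t, x) ≤ (1 + Λ) * J t := by
    intro t ht
    have hint : ∀ {G : ℝ × Sp → ℝ}, Continuous G →
        (∀ x, |R - t| < ‖x - x0‖ → G (t, x) = 0) → Integrable fun x => G (t, x) :=
      fun hG hv => integrable_of_vanish (x0 := x0) (R := |R - t|) (by fun_prop) hv
    have hP := fun i => hint (G := fun p => φ p * (a p * Dd (eX i) (b i) p + b i p * Dd (eX i) a p))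
      (by have := cDa (eX i); have := cDb (eX i) i; have := cb i; fun_prop)
      (fun x h => by simp only [hφ0 t x h, zero_mul])
    have hQ := fun i => hint (G := fun p => Dd (eX i) φ p * (a p * b i p))
      (by have := cDφ (eX i); have := cb i; fun_prop)
      (fun x h => by simp only [hDφ0 _ t x h, zero_mul])
    have cB : Continuous B := by
      have := cDa eT
      have := fun i => cDb (eX i) i
      fun_prop
    have hM := hint (G := fun p => Dd eT φ p * e p + φ p * (a p * B p + W p * a p))
      (by have := cDφ eT; fun_prop)
      (fun x h => by simp only [hφ0 t x h, hDφ0 _ t x h, zero_mul, add_zero])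
    have hP1 : Integrable fun x => φ (t, x) * (a (t, x) * Dd (eX 0) (b 0) (t, x)
          + b 0 (t, x) * Dd (eX 0) a (t, x)) + φ (t, x) * (a (t, x) * Dd (eX 1) (b 1) (t, x)
          + b 1 (t, x) * Dd (eX 1) a (t, x)) := (hP 0).add (hP 1)
    have hP2 : Integrable fun x => φ (t, x) * (a (t, x) * Dd (eX 0) (b 0) (t, x)
          + b 0 (t, x) * Dd (eX 0) a (t, x)) + φ (t, x) * (a (t, x) * Dd (eX 1) (b 1) (t, x)
          + b 1 (t, x) * Dd (eX 1) a (t, x)) + φ (t, x) * (a (t, x) * Dd (eX 2) (b 2) (t, x)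
          + b 2 (t, x) * Dd (eX 2) a (t, x)) := hP1.add (hP 2)
    have hQ1 : Integrable fun x => Dd (eX 0) φ (t, x) * (a (t, x) * b 0 (t, x))
          + Dd (eX 1) φ (t, x) * (a (t, x) * b 1 (t, x)) := (hQ 0).add (hQ 1)
    have hQ2 : Integrable fun x => Dd (eX 0) φ (t, x) * (a (t, x) * b 0 (t, x))
          + Dd (eX 1) φ (t, x) * (a (t, x) * b 1 (t, x))
          + Dd (eX 2) φ (t, x) * (a (t, x) * b 2 (t, x)) := hQ1.add (hQ 2)
    have e1 : ∫ x, H' (t, x) = (∫ x, (Dd eT φ (t, x) * e (t, x)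
        + φ (t, x) * (a (t, x) * B (t, x) + W (t, x) * a (t, x))))
        + ((∫ x, φ (t, x) * (a (t, x) * Dd (eX 0) (b 0) (t, x)
          + b 0 (t, x) * Dd (eX 0) a (t, x)))
        + (∫ x, φ (t, x) * (a (t, x) * Dd (eX 1) (b 1) (t, x)
          + b 1 (t, x) * Dd (eX 1) a (t, x)))
        + (∫ x, φ (t, x) * (a (t, x) * Dd (eX 2) (b 2) (t, x)
          + b 2 (t, x) * Dd (eX 2) a (t, x)))) := by
      rw [← integral_add (hP 0) (hP 1), ← integral_add hP1 (hP 2), ← integral_add hM hP2]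
      congr 1
      funext x
      simp only [H', B, Fin.sum_univ_three]
      ring
    have e2 : ∫ x, H' (t, x) = ∫ x, ((Dd eT φ (t, x) * e (t, x)
        + φ (t, x) * (a (t, x) * B (t, x) + W (t, x) * a (t, x)))
        - (Dd (eX 0) φ (t, x) * (a (t, x) * b 0 (t, x))
          + Dd (eX 1) φ (t, x) * (a (t, x) * b 1 (t, x))
          + Dd (eX 2) φ (t, x) * (a (t, x) * b 2 (t, x)))) := by
      rw [e1, hib, hib, hib, integral_sub hM hQ2, integral_add hQ1 (hQ 2), integral_add (hQ 0) (hQ 1)]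
      ring
    rw [e2, hJdef, ← integral_const_mul]
    refine integral_mono (hM.sub hQ2)
      ((hint (G := fun p => φ p * e p) (by fun_prop)
        (fun x h => by simp only [hφ0 t x h, zero_mul])).const_mul _) fun x => ?_
    simp only
    have hρ : 0 < R - t := by linarith [ht.2]
    have hflux := energy_flux_nonpos
      (z := deriv expNegInvGlue ((R - t) ^ 2 - ‖x - x0‖ ^ 2)) (ρ := R - t) (a := a (t, x))
      (e := e (t, x)) (y0 := x 0 - x0 0) (y1 := x 1 - x0 1) (y2 := x 2 - x0 2)
      (b0 := b 0 (t, x)) (b1 := b 1 (t, x)) (b2 := b 2 (t, x))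
      expNegInvGlue.monotone.deriv_nonneg hρ (fun hz => by
        by_contra hlt
        push Not at hlt
        refine hz (deriv_expNegInvGlue_of_neg ?_)
        rw [EuclideanSpace.norm_sq_eq]
        simp only [Fin.sum_univ_three, PiLp.sub_apply, Real.norm_eq_abs, sq_abs]
        linarith) (by
        simp only [e]
        have := sq_nonneg (W (t, x))
        linarith)
    have eT' : Dd eT φ (t, x) = deriv expNegInvGlue ((R - t) ^ 2 - ‖x - x0‖ ^ 2)
        * (-(2 * (R - t))) := by
      rw [hφdef, Dd_coneCutoff]
      simp [eT]
    have eX' : ∀ i, Dd (eX i) φ (t, x) = deriv expNegInvGlue ((R - t) ^ 2 - ‖x - x0‖ ^ 2)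
        * (-(2 * (x i - x0 i))) := by
      intro i
      rw [hφdef, Dd_coneCutoff]
      simp [eX, EuclideanSpace.inner_single_right]
    rw [eT', eX', eX', eX']
    have hfin : φ (t, x) * (a (t, x) * B (t, x) + W (t, x) * a (t, x))
        ≤ (1 + Λ) * (φ (t, x) * e (t, x)) := by
      by_cases hx : ‖x - x0‖ ≤ R
      · have hB : |B (t, x)| ≤ Λ * |W (t, x)| := hE t ⟨ht.1.le, ht.2.le⟩ x hx
        have h3 : a (t, x) * B (t, x) + W (t, x) * a (t, x) ≤ (1 + Λ) * e (t, x) := by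
          have h4 : a (t, x) * B (t, x) ≤ |a (t, x)| * (Λ * |W (t, x)|) :=
            (le_abs_self _).trans (by
              rw [abs_mul]; exact mul_le_mul_of_nonneg_left hB (abs_nonneg _))
          have h5 : W (t, x) * a (t, x) ≤ |a (t, x)| * |W (t, x)| :=
            (le_abs_self _).trans (by rw [abs_mul, mul_comm])
          have h6 : |a (t, x)| * |W (t, x)| ≤ e (t, x) := by
            have h7 := two_mul_le_add_sq |a (t, x)| |W (t, x)|
            rw [sq_abs, sq_abs] at h7
            simp only [e]
            have := sq_nonneg (b 0 (t, x))
            have := sq_nonneg (b 1 (t, x))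
            have := sq_nonneg (b 2 (t, x))
            linarith
          nlinarith
        have := mul_le_mul_of_nonneg_left h3 (hφnn (t, x))
        linarith
      · rw [hφ0 t x (by rw [abs_of_pos hρ]; linarith [ht.1])]
        simp
    linarith
  have hanti : AntitoneOn (fun t => J t * exp (-((1 + Λ) * t))) (Set.Icc 0 T) := by
    have hder : ∀ t, HasDerivAt (fun t => J t * exp (-((1 + Λ) * t)))
        ((∫ x, H' (t, x)) * exp (-((1 + Λ) * t))
          + J t * (exp (-((1 + Λ) * t)) * -((1 + Λ) * 1))) t := fun t =>
      (hJ t).mul (((hasDerivAt_id t).const_mul (1 + Λ)).neg.exp)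
    refine antitoneOn_of_deriv_nonpos (convex_Icc 0 T)
      (fun t _ => (hder t).continuousAt.continuousWithinAt)
      (fun t _ => (hder t).differentiableAt.differentiableWithinAt) fun t ht => ?_
    rw [interior_Icc] at ht
    rw [(hder t).deriv]
    have := mul_le_mul_of_nonneg_right (hJ' t ht) (exp_pos (-((1 + Λ) * t))).le
    linarith
  intro t ht
  have hRpos : 0 < R := by linarith [ht.1, ht.2]
  have hJ0 : J 0 = 0 := by
    refine integral_eq_zero_of_ae (Filter.Eventually.of_forall fun x => ?_)
    simp only [Pi.zero_apply]
    by_cases hx : x ∈ Metric.ball x0 R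
    · have hb : ∀ i, b i (0, x) = 0 := fun i => by
        simp only [b]
        rw [← fderiv_slice (df hW)]
        have : (fun x => W (0, x)) =ᶠ[nhds x] fun _ => 0 := by
          filter_upwards [Metric.isOpen_ball.mem_nhds hx] with y hy using h0 y hy
        rw [this.fderiv_eq]
        simp
      have h1' : a (0, x) = 0 := h1 x hx
      simp only [e, hb, h0 x hx, h1']
      norm_num
    · have : φ (0, x) = 0 := by
        refine expNegInvGlue.zero_of_nonpos ?_
        rw [Metric.mem_ball, not_lt, dist_eq_norm] at hx
        simp only [sub_zero]
        nlinarith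
      rw [this, zero_mul]
  have hR : 0 < R - t := by linarith [ht.2]
  have hJt : J t ≤ 0 := by
    have := hanti (Set.left_mem_Icc.2 (ht.1.trans ht.2)) ht ht.1
    simp only [hJ0, zero_mul] at this
    exact nonpos_of_mul_nonpos_left this (exp_pos _)
  have hcont : Continuous fun x => φ (t, x) * e (t, x) := by fun_prop
  have hz : (fun x => φ (t, x) * e (t, x)) = 0 := by
    have hnn : ∀ x, 0 ≤ φ (t, x) * e (t, x) := fun x => mul_nonneg (hφnn _) (henn _)
    have hI : Integrable fun x => φ (t, x) * e (t, x) :=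
      integrable_of_vanish (x0 := x0) (R := |R - t|) hcont
        (fun x h => by simp only [hφ0 t x h, zero_mul])
    have := (integral_eq_zero_iff_of_nonneg hnn hI).1 (le_antisymm hJt (integral_nonneg hnn))
    exact (hcont.ae_eq_iff_eq volume continuous_zero).1 this
  have h5 := congrFun hz x0
  simp only [Pi.zero_apply, mul_eq_zero] at h5
  have hpos : φ (t, x0) ≠ 0 := by
    refine (expNegInvGlue.pos_of_pos ?_).ne'
    have := pow_pos hR 2
    simpa using this
  have h6 := h5.resolve_left hpos
  simp only [e] at h6
  have h7 : W (t, x0) ^ 2 = 0 := by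
    have := sq_nonneg (W (t, x0))
    have := sq_nonneg (a (t, x0))
    have := sq_nonneg (b 0 (t, x0))
    have := sq_nonneg (b 1 (t, x0))
    have := sq_nonneg (b 2 (t, x0))
    linarith
  exact pow_eq_zero_iff (two_ne_zero) |>.1 h7

theorem Dd_sub {U V : ℝ × Sp → ℝ} (hU : Differentiable ℝ U) (hV : Differentiable ℝ V)
    (a : ℝ × Sp) : Dd a (fun p => U p - V p) = fun p => Dd a U p - Dd a V p := by
  funext p
  simp only [Dd]
  rw [fderiv_fun_sub (hU p) (hV p)]
  rfl

theorem deriv_time_eq_Dd {u : ℝ → Sp → ℝ} (hu : ContDiff ℝ (⊤ : ℕ∞) fun p : ℝ × Sp => u p.1 p.2)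
    (t : ℝ) (x : Sp) : deriv (fun s => u s x) t = Dd eT (fun p => u p.1 p.2) (t, x) :=
  (hasDerivAt_Dd_time (hu.differentiable (by simp)) t x).deriv

theorem deriv_deriv_time_eq_Dd {u : ℝ → Sp → ℝ}
    (hu : ContDiff ℝ (⊤ : ℕ∞) fun p : ℝ × Sp => u p.1 p.2) (t : ℝ) (x : Sp) :
    deriv (deriv fun s => u s x) t = Dd eT (Dd eT fun p => u p.1 p.2) (t, x) := by
  have : (deriv fun s => u s x) = fun t => Dd eT (fun p => u p.1 p.2) (t, x) :=
    funext fun t => deriv_time_eq_Dd hu t x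
  rw [this]
  exact (hasDerivAt_Dd_time ((contDiff_Dd hu eT).differentiable (by simp)) t x).deriv

theorem lap_eq_Dd {u : ℝ → Sp → ℝ} (hu : ContDiff ℝ (⊤ : ℕ∞) fun p : ℝ × Sp => u p.1 p.2)
    (t : ℝ) (x : Sp) :
    lap (u t) x = ∑ i, Dd (eX i) (Dd (eX i) fun p => u p.1 p.2) (t, x) := by
  unfold lap
  refine Finset.sum_congr rfl fun i _ => ?_
  have : pd i (u t) = fun x => Dd (eX i) (fun p => u p.1 p.2) (t, x) :=
    funext fun x => fderiv_slice (hu.differentiable (by simp)) t x i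
  rw [this]
  exact fderiv_slice ((contDiff_Dd hu (eX i)).differentiable (by simp)) t x i

theorem exists_lipschitz_on_Icc {g : ℝ → ℝ} (hg : ContDiff ℝ 1 g) (K : ℝ) :
    ∃ Λ, 0 ≤ Λ ∧ ∀ y ∈ Set.Icc (-K) K, ∀ z ∈ Set.Icc (-K) K, |g y - g z| ≤ Λ * |y - z| := by
  obtain ⟨C, hC⟩ := (isCompact_Icc (a := -K) (b := K)).exists_bound_of_continuousOn
    (hg.continuous_deriv le_rfl).continuousOn
  refine ⟨max C 0, le_max_right _ _, fun y hy z hz => ?_⟩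
  exact (convex_Icc (-K) K).norm_image_sub_le_of_norm_deriv_le
    (fun x _ => hg.differentiable one_ne_zero x)
    (fun x hx => (hC x hx).trans (le_max_left _ _)) hz hy

/-- Domain of dependence: two solutions whose data agree on a ball agree at its centre, up to
times smaller than the radius. -/
theorem eq_of_data_eq {g : ℝ → ℝ} (hg : ContDiff ℝ 1 g) {u v : ℝ → Sp → ℝ}
    (hu : ContDiff ℝ (⊤ : ℕ∞) fun p : ℝ × Sp => u p.1 p.2)
    (hv : ContDiff ℝ (⊤ : ℕ∞) fun p : ℝ × Sp => v p.1 p.2) {T R : ℝ} {x0 : Sp} (hTR : T < R)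
    (eu : ∀ t ∈ Set.Icc 0 T, ∀ x, deriv (deriv fun s => u s x) t = lap (u t) x - g (u t x))
    (ev : ∀ t ∈ Set.Icc 0 T, ∀ x, deriv (deriv fun s => v s x) t = lap (v t) x - g (v t x))
    (d0 : ∀ x ∈ Metric.ball x0 R, u 0 x = v 0 x)
    (d1 : ∀ x ∈ Metric.ball x0 R, deriv (fun s => u s x) 0 = deriv (fun s => v s x) 0) :
    ∀ t ∈ Set.Icc 0 T, u t x0 = v t x0 := by
  have du := hu.differentiable (by simp)
  have dv := hv.differentiable (by simp)
  have hc : IsCompact (Set.Icc 0 T ×ˢ Metric.closedBall x0 R) :=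
    isCompact_Icc.prod (isCompact_closedBall x0 R)
  obtain ⟨K1, hK1⟩ := hc.exists_bound_of_continuousOn hu.continuous.continuousOn
  obtain ⟨K2, hK2⟩ := hc.exists_bound_of_continuousOn hv.continuous.continuousOn
  obtain ⟨Λ, hΛ, hL⟩ := exists_lipschitz_on_Icc hg (max K1 K2)
  have hs : ∀ a, Dd a (fun p : ℝ × Sp => u p.1 p.2 - v p.1 p.2)
      = fun p => Dd a (fun p => u p.1 p.2) p - Dd a (fun p => v p.1 p.2) p := Dd_sub du dv
  have hs2 : ∀ a, Dd a (Dd a (fun p : ℝ × Sp => u p.1 p.2 - v p.1 p.2))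
      = fun p => Dd a (Dd a (fun p => u p.1 p.2)) p - Dd a (Dd a (fun p => v p.1 p.2)) p :=
    fun a => by
      rw [hs a]
      exact Dd_sub ((contDiff_Dd hu a).differentiable (by simp))
        ((contDiff_Dd hv a).differentiable (by simp)) a
  have key := energy_local (W := fun p => u p.1 p.2 - v p.1 p.2) (hu.sub hv) hTR hΛ
    (x0 := x0) ?_ (fun x hx => sub_eq_zero.2 (d0 x hx)) ?_
  · exact fun t ht => sub_eq_zero.1 (key t ht)
  · intro t ht x hx
    have hmem : (t, x) ∈ Set.Icc 0 T ×ˢ Metric.closedBall x0 R :=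
      ⟨ht, by simpa [dist_eq_norm] using hx⟩
    have h1 := (hK1 _ hmem).trans (le_max_left K1 K2)
    have h2 := (hK2 _ hmem).trans (le_max_right K1 K2)
    have h3 := hL _ (abs_le.1 h1) _ (abs_le.1 h2)
    have eu' := eu t ht x
    have ev' := ev t ht x
    rw [deriv_deriv_time_eq_Dd hu, lap_eq_Dd hu] at eu'
    rw [deriv_deriv_time_eq_Dd hv, lap_eq_Dd hv] at ev'
    simp only [hs2, Finset.sum_sub_distrib]
    rw [eu', ev', ← abs_neg]
    convert h3 using 2
    ring
  · intro x hx
    have := d1 x hx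
    rw [deriv_time_eq_Dd hu, deriv_time_eq_Dd hv] at this
    simp only [hs]
    exact sub_eq_zero.2 this

theorem sq_integral_mul_le {f g : ℝ → ℝ} (hf : Continuous f) (hg : Continuous g) {a b : ℝ}
    (hab : a ≤ b) :
    (∫ x in a..b, f x * g x) ^ 2 ≤ (∫ x in a..b, f x ^ 2) * ∫ x in a..b, g x ^ 2 := by
  have h : ∀ s : ℝ, 0 ≤ (∫ x in a..b, f x ^ 2) * (s * s) + (2 * ∫ x in a..b, f x * g x) * s
      + ∫ x in a..b, g x ^ 2 := by
    intro s
    have h0 : 0 ≤ ∫ x in a..b, (s * f x + g x) ^ 2 :=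
      intervalIntegral.integral_nonneg hab fun x _ => sq_nonneg _
    have e : ∫ x in a..b, (s * f x + g x) ^ 2
        = ∫ x in a..b, ((s * s) * f x ^ 2 + (2 * s) * (f x * g x) + g x ^ 2) := by
      congr 1
      funext x
      ring
    have i1 : IntervalIntegrable (fun x => (s * s) * f x ^ 2) volume a b :=
      (by fun_prop : Continuous _).intervalIntegrable _ _
    have i2 : IntervalIntegrable (fun x => (2 * s) * (f x * g x)) volume a b :=
      (by fun_prop : Continuous _).intervalIntegrable _ _
    have i3 : IntervalIntegrable (fun x => (s * s) * f x ^ 2 + (2 * s) * (f x * g x)) volume a b :=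
      (by fun_prop : Continuous _).intervalIntegrable _ _
    have i4 : IntervalIntegrable (fun x => g x ^ 2) volume a b :=
      (by fun_prop : Continuous _).intervalIntegrable _ _
    rw [e, intervalIntegral.integral_add i3 i4, intervalIntegral.integral_add i1 i2,
      intervalIntegral.integral_const_mul, intervalIntegral.integral_const_mul] at h0
    linarith
  have := discrim_le_zero h
  unfold discrim at this
  linarith

/-- The logarithmic weight `log (2 + v²)`. -/
def lw (v : ℝ) : ℝ := Real.log (2 + v ^ 2)

theorem half_le_lw (v : ℝ) : 2 / 3 ≤ lw v := by
  have h : Real.log 2 ≤ lw v := Real.log_le_log (by norm_num) (by nlinarith [sq_nonneg v])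
  linarith [Real.log_two_gt_d9]

theorem lw_nonneg (v : ℝ) : 0 ≤ lw v := by linarith [half_le_lw v]

theorem contDiff_lw : ContDiff ℝ (⊤ : ℕ∞) lw :=
  ContDiff.log (by fun_prop) fun v => by positivity

theorem hasDerivAt_lw (v : ℝ) : HasDerivAt lw (2 * v / (2 + v ^ 2)) v := by
  have h : HasDerivAt (fun v : ℝ => 2 + v ^ 2) (2 * v) v := by
    simpa using (hasDerivAt_pow 2 v).const_add 2
  exact h.log (by positivity)

theorem nonlin_eq : nonlin = fun v => v ^ 5 * lw v := rfl

theorem contDiff_nonlin : ContDiff ℝ (⊤ : ℕ∞) nonlin := by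
  rw [nonlin_eq]
  have := contDiff_lw
  fun_prop

theorem hasDerivAt_nonlin (v : ℝ) :
    HasDerivAt nonlin (5 * v ^ 4 * lw v + v ^ 5 * (2 * v / (2 + v ^ 2))) v := by
  have := (hasDerivAt_pow 5 v).mul (hasDerivAt_lw v)
  exact this.congr_deriv (by norm_num)

theorem abs_deriv_nonlin_le (v : ℝ) : |deriv nonlin v| ≤ 8 * (v ^ 4 * lw v) := by
  rw [(hasDerivAt_nonlin v).deriv]
  have h1 := half_le_lw v
  have h2 : v ^ 5 * (2 * v / (2 + v ^ 2)) = 2 * v ^ 4 * (v ^ 2 / (2 + v ^ 2)) := by ring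
  have h3 : v ^ 2 / (2 + v ^ 2) ≤ 1 := by
    rw [div_le_one (by positivity)]
    linarith
  have h4 : 0 ≤ v ^ 2 / (2 + v ^ 2) := by positivity
  have h5 : 0 ≤ v ^ 4 := by positivity
  rw [h2, abs_of_nonneg (by have := lw_nonneg v; positivity)]
  nlinarith [mul_nonneg h5 (sub_nonneg.2 h3), mul_nonneg h5 (sub_nonneg.2 h1)]

theorem nonneg_of_hasDerivAt_mul_nonneg {h h' : ℝ → ℝ} (hd : ∀ v, HasDerivAt h (h' v) v)
    (h0 : h 0 = 0) (hp : ∀ v, 0 ≤ v → 0 ≤ h' v) (hn : ∀ v, v ≤ 0 → h' v ≤ 0) (v : ℝ) :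
    0 ≤ h v := by
  have hc : Continuous h := continuous_iff_continuousAt.2 fun v => (hd v).continuousAt
  rcases le_total 0 v with hv | hv
  · have : MonotoneOn h (Set.Ici 0) := monotoneOn_of_deriv_nonneg (convex_Ici 0) hc.continuousOn
      (fun x _ => (hd x).differentiableAt.differentiableWithinAt) fun x hx => by
        rw [interior_Ici] at hx
        rw [(hd x).deriv]
        exact hp x (le_of_lt hx)
    rw [← h0]
    exact this (Set.self_mem_Ici) hv hv
  · have : AntitoneOn h (Set.Iic 0) := antitoneOn_of_deriv_nonpos (convex_Iic 0) hc.continuousOn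
      (fun x _ => (hd x).differentiableAt.differentiableWithinAt) fun x hx => by
        rw [interior_Iic] at hx
        rw [(hd x).deriv]
        exact hn x (le_of_lt hx)
    rw [← h0]
    exact this hv Set.self_mem_Iic hv

/-- The potential of the nonlinearity. -/
def pot (v : ℝ) : ℝ := ∫ s in (0 : ℝ)..v, nonlin s

theorem hasDerivAt_pot (v : ℝ) : HasDerivAt pot (nonlin v) v :=
  intervalIntegral.integral_hasDerivAt_right
    (contDiff_nonlin.continuous.intervalIntegrable _ _)
    (contDiff_nonlin.continuous.stronglyMeasurableAtFilter _ _) contDiff_nonlin.continuous.continuousAt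

theorem continuous_pot : Continuous pot :=
  continuous_iff_continuousAt.2 fun v => (hasDerivAt_pot v).continuousAt

theorem pot_zero : pot 0 = 0 := by simp [pot]

theorem pot_nonneg (v : ℝ) : 0 ≤ pot v := by
  refine nonneg_of_hasDerivAt_mul_nonneg hasDerivAt_pot pot_zero (fun v hv => ?_) (fun v hv => ?_) v
  · exact mul_nonneg (by positivity) (lw_nonneg v)
  · exact mul_nonpos_of_nonpos_of_nonneg (Odd.pow_nonpos (by decide) hv) (lw_nonneg v)

theorem six_mul_pot_le (v : ℝ) : 6 * pot v ≤ v ^ 6 * lw v := by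
  have hd : ∀ v, HasDerivAt (fun v => v ^ 6 * lw v - 6 * pot v) (2 * v ^ 7 / (2 + v ^ 2)) v := by
    intro v
    have := ((hasDerivAt_pow 6 v).mul (hasDerivAt_lw v)).sub ((hasDerivAt_pot v).const_mul 6)
    refine this.congr_deriv ?_
    rw [nonlin_eq]
    push_cast
    ring
  have := nonneg_of_hasDerivAt_mul_nonneg hd (by simp [pot_zero]) (fun v hv => by positivity)
    (fun v hv => div_nonpos_of_nonpos_of_nonneg
      (mul_nonpos_of_nonneg_of_nonpos zero_le_two (Odd.pow_nonpos (by decide) hv))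
      (by positivity)) v
  linarith

theorem two_thirds_le (v : ℝ) : 2 / 3 * (v ^ 6 * lw v) ≤ nonlin v * v - 2 * pot v := by
  have := six_mul_pot_le v
  have e : nonlin v * v = v ^ 6 * lw v := by rw [nonlin_eq]; ring
  rw [e]
  linarith

/-- Vanishing outside the strip `|r| ≤ L`, for times in a neighbourhood of `[-T, T]`. -/
def Van (T L : ℝ) (f : ℝ → ℝ → ℝ) : Prop := ∀ t r, |t| < T + 1 → L < |r| → f t r = 0

theorem Van.dt {T L : ℝ} {f : ℝ → ℝ → ℝ} (hf : Van T L f) : Van T L (dt f) := by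
  intro t r ht hr
  have : (fun s => f s r) =ᶠ[nhds t] fun _ => 0 := by
    filter_upwards [(isOpen_Iio.preimage continuous_abs).mem_nhds ht] with s hs using hf s r hs hr
  unfold _root_.dt
  rw [this.deriv_eq, deriv_const]

theorem Van.dr {T L : ℝ} {f : ℝ → ℝ → ℝ} (hf : Van T L f) : Van T L (dr f) := by
  intro t r ht hr
  have : (fun s => f t s) =ᶠ[nhds r] fun _ => 0 := by
    filter_upwards [(isOpen_Ioi.preimage continuous_abs).mem_nhds hr] with s hs using hf t s ht hs
  unfold _root_.dr
  rw [this.deriv_eq, deriv_const]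

/-- The one-dimensional reduction `r V(t, r)` of a radial profile. -/
def mulr (V : ℝ → ℝ → ℝ) (t r : ℝ) : ℝ := r * V t r

theorem Sm.mulr {V : ℝ → ℝ → ℝ} (hV : Sm V) : Sm (mulr V) :=
  ContDiff.mul contDiff_snd hV

theorem Van.mulr {T L : ℝ} {f : ℝ → ℝ → ℝ} (hf : Van T L f) : Van T L (mulr f) := fun t r ht hr => by
  simp only [_root_.mulr, hf t r ht hr, mul_zero]

theorem dt_mulr {V : ℝ → ℝ → ℝ} (hV : Sm V) (t r : ℝ) : dt (mulr V) t r = r * dt V t r :=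
  ((hV.hasDt t r).const_mul r).deriv

theorem dr_mulr {V : ℝ → ℝ → ℝ} (hV : Sm V) (t r : ℝ) :
    dr (mulr V) t r = V t r + r * dr V t r := by
  have : HasDerivAt (fun s => mulr V t s) (1 * V t r + r * dr V t r) r :=
    (hasDerivAt_id r).mul (hV.hasDr t r)
  rw [dr, this.deriv, one_mul]

theorem dt_dt_mulr {V : ℝ → ℝ → ℝ} (hV : Sm V) (t r : ℝ) :
    dt (dt (mulr V)) t r = r * dt (dt V) t r := by
  have : dt (mulr V) = mulr (dt V) := funext fun t => funext fun r => dt_mulr hV t r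
  rw [this, dt_mulr hV.dt]

theorem dr_dr_mulr {V : ℝ → ℝ → ℝ} (hV : Sm V) (t r : ℝ) :
    dr (dr (mulr V)) t r = r * dr (dr V) t r + 2 * dr V t r := by
  have h : dr (mulr V) = fun t r => V t r + mulr (dr V) t r :=
    funext fun t => funext fun r => dr_mulr hV t r
  have h2 : HasDerivAt (fun s => V t s + mulr (dr V) t s)
      (dr V t r + (dr V t r + r * dr (dr V) t r)) r := by
    rw [← dr_mulr hV.dr]
    exact (hV.hasDr t r).add (hV.dr.mulr.hasDr t r)
  rw [h, dr, h2.deriv]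
  ring

/-- A smooth even radial profile solving the radial equation on `[0, t₁]`, with support in the
strip `|r| ≤ L`. -/
structure RadialSol (T L t₁ : ℝ) (V : ℝ → ℝ → ℝ) : Prop where
  sm : Sm V
  even : ∀ t r, V t (-r) = V t r
  eq : ∀ t ∈ Set.Icc 0 t₁, ∀ r,
    r * dt (dt V) t r = r * dr (dr V) t r + 2 * dr V t r - r * nonlin (V t r)
  van : Van T L V
  nonneg_T : 0 ≤ T
  nonneg_L : 0 ≤ L
  pos : 0 < t₁
  le_T : t₁ ≤ T

namespace RadialSol

variable {T L t₁ : ℝ} {V : ℝ → ℝ → ℝ}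

theorem abs_lt (h : RadialSol T L t₁ V) {t : ℝ} (ht : t ∈ Set.Icc 0 t₁) : |t| < T + 1 := by
  rw [abs_of_nonneg ht.1]
  linarith [ht.2, h.le_T]

theorem lt_abs (h : RadialSol T L t₁ V) : L < |L + 1| := by
  rw [abs_of_nonneg (by linarith [h.nonneg_L])]
  linarith

theorem wave (h : RadialSol T L t₁ V) {t : ℝ} (ht : t ∈ Set.Icc 0 t₁) (r : ℝ) :
    dt (dt (mulr V)) t r = dr (dr (mulr V)) t r - r * nonlin (V t r) := by
  rw [dt_dt_mulr h.sm, dr_dr_mulr h.sm, h.eq t ht r]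

/-- The total energy. -/
def energy (L : ℝ) (V : ℝ → ℝ → ℝ) (t : ℝ) : ℝ := ∫ r in (0 : ℝ)..(L + 1),
  (1 / 2 * dt (mulr V) t r ^ 2 + 1 / 2 * dr (mulr V) t r ^ 2 + r ^ 2 * pot (V t r))

theorem energy_eq (h : RadialSol T L t₁ V) : ∀ t ∈ Set.Icc 0 t₁, energy L V t = energy L V 0 := by
  have hψ := h.sm.mulr
  have c1 := hψ.dt.cont
  have c2 := hψ.dr.cont
  have c3 := h.sm.cont
  have c4 := hψ.dt.dt.cont
  have c5 := hψ.dr.dt.cont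
  have c6 := h.sm.dt.cont
  have c7 := continuous_pot
  have c8 := contDiff_nonlin.continuous
  have hd : ∀ t, HasDerivAt (energy L V) (∫ r in (0 : ℝ)..(L + 1),
      (dt (mulr V) t r * dt (dt (mulr V)) t r + dr (mulr V) t r * dt (dr (mulr V)) t r
        + r ^ 2 * (nonlin (V t r) * dt V t r))) t := by
    intro t
    refine hasDerivAt_param_integral (F := fun t r => 1 / 2 * dt (mulr V) t r ^ 2
      + 1 / 2 * dr (mulr V) t r ^ 2 + r ^ 2 * pot (V t r))
      (F' := fun t r => dt (mulr V) t r * dt (dt (mulr V)) t r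
        + dr (mulr V) t r * dt (dr (mulr V)) t r + r ^ 2 * (nonlin (V t r) * dt V t r))
      (by fun_prop) (by fun_prop) (fun t r => ?_) t
    have := ((((hψ.dt.hasDt t r).pow 2).const_mul (1 / 2)).add
      (((hψ.dr.hasDt t r).pow 2).const_mul (1 / 2))).add
      (((hasDerivAt_pot (V t r)).comp t (h.sm.hasDt t r)).const_mul (r ^ 2))
    refine this.congr_deriv ?_
    push_cast
    ring
  refine constant_of_has_deriv_right_zero (fun t _ => (hd t).continuousAt.continuousWithinAt)
    fun t ht => ?_
  have ht' : t ∈ Set.Icc 0 t₁ := ⟨ht.1, ht.2.le⟩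
  refine HasDerivAt.hasDerivWithinAt ((hd t).congr_deriv ?_)
  have hB : ∀ r, HasDerivAt (fun r => dt (mulr V) t r * dr (mulr V) t r)
      (dt (mulr V) t r * dt (dt (mulr V)) t r + dr (mulr V) t r * dt (dr (mulr V)) t r
        + r ^ 2 * (nonlin (V t r) * dt V t r)) r := by
    intro r
    have := (hψ.dt.hasDr t r).mul (hψ.dr.hasDr t r)
    refine this.congr_deriv ?_
    rw [h.wave ht' r, ← hψ.dt_dr, dt_mulr h.sm]
    ring
  rw [intervalIntegral.integral_eq_sub_of_hasDerivAt (fun r _ => hB r)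
    ((by
      have := hψ.dt.cont_comp (a := fun _ : ℝ => t) continuous_const continuous_id
      have := hψ.dr.cont_comp (a := fun _ : ℝ => t) continuous_const continuous_id
      fun_prop : Continuous _).intervalIntegrable _ _)]
  rw [h.van.mulr.dt t (L + 1) (h.abs_lt ht') h.lt_abs, dt_mulr h.sm t 0]
  ring

/-- The density of the Morawetz spacetime integral. -/
def mor (V : ℝ → ℝ → ℝ) (t r : ℝ) : ℝ := r * (V t r ^ 6 * lw (V t r))

theorem continuous_mor (hV : Sm V) : Continuous fun p : ℝ × ℝ => mor V p.1 p.2 := by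
  have c3 := hV.cont
  have := contDiff_lw.continuous
  unfold mor
  fun_prop

theorem abs_momentum_le (h : RadialSol T L t₁ V) (t : ℝ) :
    |∫ r in (0 : ℝ)..(L + 1), dt (mulr V) t r * dr (mulr V) t r| ≤ energy L V t := by
  have hψ := h.sm.mulr
  have c1 := hψ.dt.cont
  have c2 := hψ.dr.cont
  have c3 := h.sm.cont
  have c7 := continuous_pot
  have hL := h.nonneg_L
  refine (intervalIntegral.abs_integral_le_integral_abs (by linarith)).trans ?_
  refine intervalIntegral.integral_mono_on (by linarith)
    ((by fun_prop : Continuous _).intervalIntegrable _ _)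
    ((by fun_prop : Continuous _).intervalIntegrable _ _) fun r _ => ?_
  have h1 := two_mul_le_add_sq |dt (mulr V) t r| |dr (mulr V) t r|
  rw [sq_abs, sq_abs] at h1
  rw [abs_mul]
  have := mul_nonneg (sq_nonneg r) (pot_nonneg (V t r))
  linarith

theorem morawetz (h : RadialSol T L t₁ V) : ∀ t ∈ Set.Icc 0 t₁,
    ∫ s in (0 : ℝ)..t, ∫ r in (0 : ℝ)..(L + 1), mor V s r ≤ 3 * energy L V 0 := by
  have hψ := h.sm.mulr
  have c1 := hψ.dt.cont
  have c2 := hψ.dr.cont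
  have c3 := h.sm.cont
  have c3' := h.sm.dr.cont
  have c4 := hψ.dt.dt.cont
  have c5 := hψ.dr.dt.cont
  have c6 := hψ.dr.dr.cont
  have c7 := continuous_pot
  have c8 := contDiff_nonlin.continuous
  have c9 := contDiff_lw.continuous
  have hL := h.nonneg_L
  have cm := continuous_mor h.sm
  set P : ℝ → ℝ := fun t => ∫ r in (0 : ℝ)..(L + 1), dt (mulr V) t r * dr (mulr V) t r
  have hP : ∀ t, HasDerivAt P (∫ r in (0 : ℝ)..(L + 1), (dt (dt (mulr V)) t r * dr (mulr V) t r
      + dt (mulr V) t r * dt (dr (mulr V)) t r)) t := fun t =>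
    hasDerivAt_param_integral (F := fun t r => dt (mulr V) t r * dr (mulr V) t r)
      (F' := fun t r => dt (dt (mulr V)) t r * dr (mulr V) t r
      + dt (mulr V) t r * dt (dr (mulr V)) t r) (by fun_prop) (by fun_prop)
      (fun t r => (hψ.dt.hasDt t r).mul (hψ.dr.hasDt t r)) t
  have cD : Continuous fun s => ∫ r in (0 : ℝ)..(L + 1), mor V s r :=
    intervalIntegral.continuous_parametric_intervalIntegral_of_continuous' (by exact cm) 0 (L + 1)
  have hX : ∀ t, HasDerivAt (fun t => ∫ s in (0 : ℝ)..t, ∫ r in (0 : ℝ)..(L + 1), mor V s r)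
      (∫ r in (0 : ℝ)..(L + 1), mor V t r) t := fun t =>
    intervalIntegral.integral_hasDerivAt_right (cD.intervalIntegrable _ _)
      (cD.stronglyMeasurableAtFilter _ _) cD.continuousAt
  have hder : ∀ t ∈ Set.Icc 0 t₁, (∫ r in (0 : ℝ)..(L + 1), (dt (dt (mulr V)) t r * dr (mulr V) t r
      + dt (mulr V) t r * dt (dr (mulr V)) t r))
      + 2 / 3 * ∫ r in (0 : ℝ)..(L + 1), mor V t r ≤ 0 := by
    intro t ht
    have hB : ∀ r, HasDerivAt (fun r => 1 / 2 * dt (mulr V) t r ^ 2 + 1 / 2 * dr (mulr V) t r ^ 2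
        - r ^ 2 * pot (V t r))
        (dt (dt (mulr V)) t r * dr (mulr V) t r + dt (mulr V) t r * dt (dr (mulr V)) t r
          + r * (nonlin (V t r) * V t r - 2 * pot (V t r))) r := by
      intro r
      have := ((((hψ.dt.hasDr t r).pow 2).const_mul (1 / 2)).add
        (((hψ.dr.hasDr t r).pow 2).const_mul (1 / 2))).sub
        (((hasDerivAt_pow 2 r)).mul ((hasDerivAt_pot (V t r)).comp r (h.sm.hasDr t r)))
      refine this.congr_deriv ?_
      rw [h.wave ht r, ← hψ.dt_dr, dr_mulr h.sm]
      simp only [Function.comp_def]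
      push_cast
      ring
    have hI := intervalIntegral.integral_eq_sub_of_hasDerivAt (a := 0) (b := L + 1)
      (fun r _ => hB r) ((by fun_prop : Continuous _).intervalIntegrable _ _)
    rw [intervalIntegral.integral_add ((by fun_prop : Continuous _).intervalIntegrable _ _)
      ((by fun_prop : Continuous _).intervalIntegrable _ _)] at hI
    have hlt := h.abs_lt ht
    have hll := h.lt_abs
    rw [h.van.mulr.dt _ _ hlt hll, h.van.mulr.dr _ _ hlt hll, h.van _ _ hlt hll, pot_zero] at hI
    have hm : 2 / 3 * ∫ r in (0 : ℝ)..(L + 1), mor V t r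
        ≤ ∫ r in (0 : ℝ)..(L + 1), r * (nonlin (V t r) * V t r - 2 * pot (V t r)) := by
      rw [← intervalIntegral.integral_const_mul]
      refine intervalIntegral.integral_mono_on (by linarith)
        ((by fun_prop : Continuous _).intervalIntegrable _ _)
        ((by fun_prop : Continuous _).intervalIntegrable _ _) fun r hr => ?_
      have := mul_le_mul_of_nonneg_left (two_thirds_le (V t r)) hr.1
      unfold mor
      linarith
    have hs1 := sq_nonneg (dt (mulr V) t 0)
    have hs2 := sq_nonneg (dr (mulr V) t 0)
    linarith
  intro t ht
  have hanti : AntitoneOn (fun t => P t + 2 / 3 * ∫ s in (0 : ℝ)..t,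
      ∫ r in (0 : ℝ)..(L + 1), mor V s r) (Set.Icc 0 t₁) := by
    have hdd := fun t => (hP t).add ((hX t).const_mul (2 / 3))
    refine antitoneOn_of_deriv_nonpos (convex_Icc 0 t₁)
      (fun t _ => (hdd t).continuousAt.continuousWithinAt)
      (fun t _ => (hdd t).differentiableAt.differentiableWithinAt) fun t ht => ?_
    rw [interior_Icc] at ht
    have := hder t ⟨ht.1.le, ht.2.le⟩
    rw [← (hdd t).deriv] at this
    exact this
  have h1 := hanti (Set.left_mem_Icc.2 h.pos.le) ht ht.1
  simp only [intervalIntegral.integral_same, mul_zero, add_zero] at h1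
  have h2 := (abs_le.1 (h.abs_momentum_le 0)).2
  have h3 := (abs_le.1 (h.abs_momentum_le t)).1
  rw [h.energy_eq t ht] at h3
  simp only [P] at h1
  linarith

end RadialSol

theorem integral_le_of_vanish {f : ℝ → ℝ} (hf : Continuous f) (h0 : ∀ y, 0 ≤ f y) {B c d : ℝ}
    (hB : 0 ≤ B) (hcd : c ≤ d) (hv : ∀ y, B < |y| → f y = 0) :
    ∫ y in c..d, f y ≤ ∫ y in (-B)..B, f y := by
  have hi : ∀ a b, IntervalIntegrable f volume a b := fun a b => hf.intervalIntegrable a b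
  have key : ∀ d, -B ≤ d → ∫ y in (-B)..d, f y ≤ ∫ y in (-B)..B, f y := by
    intro d hd
    rcases le_total d B with h | h
    · rw [← intervalIntegral.integral_add_adjacent_intervals (hi (-B) d) (hi d B)]
      linarith [intervalIntegral.integral_nonneg (μ := volume) h fun y _ => h0 y]
    · rw [← intervalIntegral.integral_add_adjacent_intervals (hi (-B) B) (hi B d)]
      have : ∫ y in B..d, f y = 0 := by
        rw [intervalIntegral.integral_of_le h]
        refine setIntegral_eq_zero_of_forall_eq_zero fun y hy => hv y ?_
        exact lt_of_lt_of_le hy.1 (le_abs_self y)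
      linarith
  rcases le_total c (-B) with h | h
  · rw [← intervalIntegral.integral_add_adjacent_intervals (hi c (-B)) (hi (-B) d)]
    have hz : ∀ e, e ≤ -B → c ≤ e → ∫ y in c..e, f y = 0 := fun e he hce => by
      rw [intervalIntegral.integral_of_le hce, integral_Ioc_eq_integral_Ioo]
      refine setIntegral_eq_zero_of_forall_eq_zero fun y hy => hv y ?_
      have := neg_le_abs y
      have := hy.2
      linarith
    rw [hz (-B) le_rfl h, zero_add]
    rcases le_total (-B) d with hd | hd
    · exact key d hd
    · rw [intervalIntegral.integral_symm]
      have h1 := intervalIntegral.integral_nonneg (μ := volume) hd fun y _ => h0 y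
      have h2 := intervalIntegral.integral_nonneg (μ := volume) (by linarith : -B ≤ B)
        fun y _ => h0 y
      linarith
  · have h1 := key d (h.trans hcd)
    rw [← intervalIntegral.integral_add_adjacent_intervals (hi (-B) c) (hi c d)] at h1
    linarith [intervalIntegral.integral_nonneg (μ := volume) h fun y _ => h0 y]

namespace RadialSol

variable {T L t₁ : ℝ} {V : ℝ → ℝ → ℝ}

theorem energy_nonneg (h : RadialSol T L t₁ V) (t : ℝ) : 0 ≤ energy L V t := by
  refine intervalIntegral.integral_nonneg (by linarith [h.nonneg_L]) fun r _ => ?_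
  have := mul_nonneg (sq_nonneg r) (pot_nonneg (V t r))
  positivity

theorem mul_sq_le (h : RadialSol T L t₁ V) {t : ℝ} (ht : t ∈ Set.Icc 0 t₁) (r : ℝ) :
    |r| * V t r ^ 2 ≤ 2 * energy L V 0 := by
  wlog hr : 0 ≤ r generalizing r
  · have := this (-r) (by linarith)
    rwa [abs_neg, h.even] at this
  have hE := h.energy_nonneg 0
  rw [abs_of_nonneg hr]
  rcases lt_or_ge L r with hL | hL
  · rw [h.van t r (h.abs_lt ht) (hL.trans_le (le_abs_self r))]
    linarith
  rcases hr.eq_or_lt with h0 | h0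
  · rw [← h0]
    linarith
  have hψ := h.sm.mulr
  have c1 := hψ.dt.cont
  have c2 := hψ.dr.cont
  have c2' : Continuous (dr (mulr V) t) := hψ.dr.cont_comp continuous_const continuous_id
  have c3 := h.sm.cont
  have c7 := continuous_pot
  have e1 : ∫ s in (0 : ℝ)..r, dr (mulr V) t s = r * V t r := by
    rw [intervalIntegral.integral_eq_sub_of_hasDerivAt (fun s _ => hψ.hasDr t s)
      (c2'.intervalIntegrable _ _)]
    simp [mulr]
  have e2 := sq_integral_mul_le (f := fun _ => 1) continuous_const c2' hr
  simp only [one_mul, one_pow, intervalIntegral.integral_const, sub_zero, smul_eq_mul,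
    mul_one] at e2
  rw [e1] at e2
  have e3 : ∫ s in (0 : ℝ)..r, dr (mulr V) t s ^ 2 ≤ 2 * energy L V t := by
    calc ∫ s in (0 : ℝ)..r, dr (mulr V) t s ^ 2
        ≤ ∫ s in (0 : ℝ)..(L + 1), dr (mulr V) t s ^ 2 := by
          rw [← intervalIntegral.integral_add_adjacent_intervals (a := 0) (b := r) (c := L + 1)
            ((by fun_prop : Continuous _).intervalIntegrable _ _)
            ((by fun_prop : Continuous _).intervalIntegrable _ _)]
          linarith [intervalIntegral.integral_nonneg (μ := volume) (by linarith : r ≤ L + 1)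
            fun s _ => sq_nonneg (dr (mulr V) t s)]
      _ ≤ 2 * energy L V t := by
          unfold energy
          rw [← intervalIntegral.integral_const_mul]
          refine intervalIntegral.integral_mono_on (by linarith)
            ((by fun_prop : Continuous _).intervalIntegrable _ _)
            ((by fun_prop : Continuous _).intervalIntegrable _ _) fun s _ => ?_
          have := mul_nonneg (sq_nonneg s) (pot_nonneg (V t s))
          have := sq_nonneg (dt (mulr V) t s)
          linarith
  rw [h.energy_eq t ht] at e3
  have e4 : r * (r * V t r ^ 2) ≤ r * (2 * energy L V 0) := by
    have := mul_le_mul_of_nonneg_left e3 hr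
    nlinarith
  exact le_of_mul_le_mul_left e4 h0

/-- The time derivative of `r V`. -/
def chi (V : ℝ → ℝ → ℝ) : ℝ → ℝ → ℝ := dt (mulr V)

/-- The outgoing derivative of `∂ₜ(r V)`. -/
def beta (V : ℝ → ℝ → ℝ) (t r : ℝ) : ℝ := dt (chi V) t r + dr (chi V) t r

/-- The forcing term in the transport equation for `beta`. -/
def force (V : ℝ → ℝ → ℝ) (t r : ℝ) : ℝ := deriv nonlin (V t r) * chi V t r

theorem sm_chi (hV : Sm V) : Sm (chi V) := hV.mulr.dt

theorem sm_beta (hV : Sm V) : Sm (beta V) := (sm_chi hV).dt.add (sm_chi hV).dr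

theorem continuous_force (hV : Sm V) : Continuous fun p : ℝ × ℝ => force V p.1 p.2 := by
  have c1 : Continuous (deriv nonlin) :=
    ContDiff.continuous_deriv (n := 1) (contDiff_nonlin.of_le (by exact_mod_cast le_top)) le_rfl
  exact (c1.comp hV.cont).mul (sm_chi hV).cont

theorem van_beta (h : RadialSol T L t₁ V) : Van T L (beta V) := fun t r ht hr => by
  simp only [beta, chi, h.van.mulr.dt.dt t r ht hr, h.van.mulr.dt.dr t r ht hr, add_zero]

theorem van_force (h : RadialSol T L t₁ V) : Van T L (force V) := fun t r ht hr => by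
  simp only [force, chi, h.van.mulr.dt t r ht hr, mul_zero]

theorem transport (h : RadialSol T L t₁ V) {t : ℝ} (ht : t ∈ Set.Ioo 0 t₁) (y : ℝ) :
    HasDerivAt (fun s => beta V s (y - s)) (-force V t (y - t)) t := by
  have hψ := h.sm.mulr
  have hχ := sm_chi h.sm
  have h1 := hasDerivAt_comp_pair (sm_beta h.sm).c1 (hasDerivAt_id t) ((hasDerivAt_id t).const_sub y)
  refine h1.congr_deriv ?_
  simp only [id]
  set r := y - t
  have b1 : dt (beta V) t r = dt (dt (chi V)) t r + dt (dr (chi V)) t r :=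
    ((hχ.dt.hasDt t r).add (hχ.dr.hasDt t r)).deriv
  have b2 : dr (beta V) t r = dr (dt (chi V)) t r + dr (dr (chi V)) t r :=
    ((hχ.dt.hasDr t r).add (hχ.dr.hasDr t r)).deriv
  have b3 : dt (dt (chi V)) t r
      = dt (dr (dr (mulr V))) t r - r * (deriv nonlin (V t r) * dt V t r) := by
    have e1 : HasDerivAt (fun s => dr (dr (mulr V)) s r - r * nonlin (V s r))
        (dt (dr (dr (mulr V))) t r - r * (deriv nonlin (V t r) * dt V t r)) t := by
      have e0 : HasDerivAt nonlin (deriv nonlin (V t r)) (V t r) :=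
        ((contDiff_nonlin.differentiable (by simp)) (V t r)).hasDerivAt
      have e3 : HasDerivAt (fun s => nonlin (V s r)) (deriv nonlin (V t r) * dt V t r) t :=
        HasDerivAt.comp (h₂ := nonlin) (h := fun s => V s r) t e0 (h.sm.hasDt t r)
      exact (hψ.dr.dr.hasDt t r).sub (e3.const_mul r)
    have e2 : (fun s => dt (chi V) s r)
        =ᶠ[nhds t] fun s => dr (dr (mulr V)) s r - r * nonlin (V s r) := by
      filter_upwards [Ioo_mem_nhds ht.1 ht.2] with s hs
      exact h.wave ⟨hs.1.le, hs.2.le⟩ r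
    exact (e1.congr_of_eventuallyEq e2).deriv
  have b4 : dt (dr (dr (mulr V))) t r = dr (dr (chi V)) t r := by
    rw [hψ.dr.dt_dr]
    have : dt (dr (mulr V)) = dr (chi V) := funext fun t => funext fun r => hψ.dt_dr t r
    rw [this]
  rw [b1, b2, b3, b4, hχ.dt_dr]
  simp only [force, chi, dt_mulr h.sm]
  ring

/-- Monotone majorant of `|beta|` along the incoming characteristic through `(0, y)`. -/
def maj (V : ℝ → ℝ → ℝ) (t y : ℝ) : ℝ := |beta V 0 y| + ∫ s in (0 : ℝ)..t, |force V s (y - s)|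

theorem continuous_abs_force (hV : Sm V) :
    Continuous fun p : ℝ × ℝ => |force V p.2 (p.1 - p.2)| :=
  (continuous_comp_pair (continuous_force hV) continuous_snd
    (continuous_fst.sub continuous_snd)).abs

theorem continuous_maj (hV : Sm V) : Continuous fun p : ℝ × ℝ => maj V p.1 p.2 := by
  refine ((sm_beta hV).cont_comp continuous_const continuous_snd).abs.add ?_
  refine intervalIntegral.continuous_parametric_intervalIntegral_of_continuous
    (f := fun (p : ℝ × ℝ) s => |force V s (p.2 - s)|) ?_ continuous_fst
  exact (continuous_abs_force hV).comp (f := fun q : (ℝ × ℝ) × ℝ => (q.1.2, q.2)) (by fun_prop)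

theorem force_intervalIntegrable (hV : Sm V) (y a b : ℝ) :
    IntervalIntegrable (fun s => |force V s (y - s)|) volume a b :=
  ((continuous_abs_force hV).comp (f := fun s : ℝ => (y, s)) (by fun_prop)).intervalIntegrable _ _

theorem maj_sub (hV : Sm V) (y a b : ℝ) :
    maj V b y = maj V a y + ∫ s in a..b, |force V s (y - s)| := by
  unfold maj
  rw [← intervalIntegral.integral_add_adjacent_intervals (force_intervalIntegrable hV y 0 a)
    (force_intervalIntegrable hV y a b)]
  ring

theorem maj_mono (hV : Sm V) (y : ℝ) {a b : ℝ} (hab : a ≤ b) : maj V a y ≤ maj V b y := by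
  rw [maj_sub hV y a b]
  linarith [intervalIntegral.integral_nonneg (μ := volume) hab
    fun s _ => abs_nonneg (force V s (y - s))]

theorem maj_nonneg (hV : Sm V) (y : ℝ) {t : ℝ} (ht : 0 ≤ t) : 0 ≤ maj V t y := by
  refine le_trans ?_ (maj_mono hV y ht)
  simp [maj]

theorem abs_beta_le (h : RadialSol T L t₁ V) {t : ℝ} (ht : t ∈ Set.Icc 0 t₁) (r : ℝ) :
    |beta V t r| ≤ maj V t (r + t) := by
  set y := r + t with hy
  have hr : r = y - t := by rw [hy]; ring
  have cf : Continuous fun s => -force V s (y - s) :=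
    (continuous_comp_pair (continuous_force h.sm) continuous_id
      (continuous_const.sub continuous_id)).neg
  have h1 := intervalIntegral.integral_eq_sub_of_hasDerivAt_of_le ht.1
    (f := fun s => beta V s (y - s)) (f' := fun s => -force V s (y - s))
    ((sm_beta h.sm).cont_comp continuous_id (continuous_const.sub continuous_id)).continuousOn
    (fun s hs => h.transport ⟨hs.1, hs.2.trans_le ht.2⟩ y) (cf.intervalIntegrable _ _)
  have h2 := intervalIntegral.abs_integral_le_integral_abs (μ := volume)
    (f := fun s => -force V s (y - s)) ht.1
  simp only [abs_neg] at h2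
  rw [h1, sub_zero, ← hr] at h2
  unfold maj
  have h3 := abs_sub_abs_le_abs_sub (beta V t r) (beta V 0 y)
  linarith

theorem maj_van (h : RadialSol T L t₁ V) {t : ℝ} (ht : t ∈ Set.Icc 0 t₁) (y : ℝ)
    (hy : L + T + 1 < |y|) : maj V t y = 0 := by
  have hT := h.nonneg_T
  have h1 : beta V 0 y = 0 := h.van_beta 0 y (by rw [abs_zero]; linarith) (by linarith)
  have h2 : ∫ s in (0 : ℝ)..t, |force V s (y - s)| = ∫ s in (0 : ℝ)..t, (0 : ℝ) := by
    refine intervalIntegral.integral_congr fun s hs => ?_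
    rw [Set.uIcc_of_le ht.1] at hs
    have hs' : s ∈ Set.Icc 0 t₁ := ⟨hs.1, hs.2.trans ht.2⟩
    have h3 := abs_sub_abs_le_abs_sub y s
    have h4 := h.abs_lt hs'
    simp only [h.van_force s (y - s) h4 (by linarith), abs_zero]
  unfold maj
  rw [h1, h2]
  simp

/-- The squared norm of the majorant, the quantity controlled by the Morawetz estimate. -/
def majNorm (T L : ℝ) (V : ℝ → ℝ → ℝ) (t : ℝ) : ℝ :=
  ∫ y in (-(L + T + 1))..(L + T + 1), maj V t y ^ 2

theorem continuous_majNorm (hV : Sm V) : Continuous (majNorm T L V) :=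
  intervalIntegral.continuous_parametric_intervalIntegral_of_continuous'
    (by exact (continuous_maj hV).pow 2) _ _

theorem integral_maj_sq_le (h : RadialSol T L t₁ V) {t c d : ℝ} (ht : t ∈ Set.Icc 0 t₁)
    (hcd : c ≤ d) : ∫ y in c..d, maj V t y ^ 2 ≤ majNorm T L V t :=
  integral_le_of_vanish (f := fun y => maj V t y ^ 2) (((continuous_maj h.sm).comp
    (f := fun y : ℝ => (t, y)) (by fun_prop)).pow 2) (fun y => sq_nonneg _)
    (by linarith [h.nonneg_L, h.nonneg_T]) hcd fun y hy => by
      simp only [h.maj_van ht y hy]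
      norm_num

theorem majNorm_mono (h : RadialSol T L t₁ V) {a b : ℝ} (ha : 0 ≤ a) (hab : a ≤ b) :
    majNorm T L V a ≤ majNorm T L V b := by
  have hc : ∀ t, Continuous fun y => maj V t y ^ 2 := fun t =>
    ((continuous_maj h.sm).comp (f := fun y : ℝ => (t, y)) (by fun_prop)).pow 2
  refine intervalIntegral.integral_mono_on (by linarith [h.nonneg_L, h.nonneg_T])
    ((hc a).intervalIntegrable _ _) ((hc b).intervalIntegrable _ _) fun y _ => ?_
  exact pow_le_pow_left₀ (maj_nonneg h.sm y ha) (maj_mono h.sm y hab) 2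

theorem majNorm_nonneg (h : RadialSol T L t₁ V) (t : ℝ) : 0 ≤ majNorm T L V t :=
  intervalIntegral.integral_nonneg (by linarith [h.nonneg_L, h.nonneg_T]) fun _ _ => sq_nonneg _

theorem dt_even (h : RadialSol T L t₁ V) (t r : ℝ) : dt V t (-r) = dt V t r := by
  simp only [dt, h.even]

theorem chi_eq (h : RadialSol T L t₁ V) (t r : ℝ) : chi V t r = r * dt V t r := dt_mulr h.sm t r

theorem chi_odd (h : RadialSol T L t₁ V) (t r : ℝ) : chi V t (-r) = -chi V t r := by
  rw [h.chi_eq, h.chi_eq, h.dt_even]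
  ring

theorem dt_chi_odd (h : RadialSol T L t₁ V) (t r : ℝ) :
    dt (chi V) t (-r) = -dt (chi V) t r := by
  simp only [dt, h.chi_odd]
  exact deriv.fun_neg

theorem dr_chi_even (h : RadialSol T L t₁ V) (t r : ℝ) :
    dr (chi V) t (-r) = dr (chi V) t r :=
  deriv_odd (h.chi_odd t) r

theorem integral_beta (h : RadialSol T L t₁ V) (t r : ℝ) :
    ∫ ρ in (-r)..r, beta V t ρ = 2 * (r * dt V t r) := by
  have hχ := sm_chi h.sm
  have c1 : Continuous (dt (chi V) t) := hχ.dt.cont_comp continuous_const continuous_id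
  have c2 : Continuous (dr (chi V) t) := hχ.dr.cont_comp continuous_const continuous_id
  have e1 : ∫ ρ in (-r)..r, dr (chi V) t ρ = chi V t r - chi V t (-r) :=
    intervalIntegral.integral_eq_sub_of_hasDerivAt (fun s _ => hχ.hasDr t s)
      (c2.intervalIntegrable _ _)
  unfold beta
  rw [intervalIntegral.integral_add (c1.intervalIntegrable _ _) (c2.intervalIntegrable _ _),
    integral_odd_eq_zero (h.dt_chi_odd t), e1, h.chi_odd, h.chi_eq]
  ring

theorem continuous_maj_right (hV : Sm V) (t : ℝ) : Continuous (maj V t) :=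
  (continuous_maj hV).comp (f := fun y : ℝ => (t, y)) (by fun_prop)

theorem mul_dt_sq_le (h : RadialSol T L t₁ V) {t : ℝ} (ht : t ∈ Set.Icc 0 t₁) (r : ℝ) :
    |r| * dt V t r ^ 2 ≤ 1 / 2 * majNorm T L V t := by
  wlog hr : 0 ≤ r generalizing r
  · have := this (-r) (by linarith)
    rwa [abs_neg, h.dt_even] at this
  rw [abs_of_nonneg hr]
  rcases hr.eq_or_lt with h0 | h0
  · rw [← h0]
    linarith [h.majNorm_nonneg t]
  have cβ : Continuous (beta V t) := (sm_beta h.sm).cont_comp continuous_const continuous_id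
  have cm := continuous_maj_right h.sm t
  have e1 := sq_integral_mul_le (f := fun _ => 1) (a := -r) (b := r) continuous_const cβ
    (by linarith)
  simp only [one_mul, one_pow, intervalIntegral.integral_const, smul_eq_mul, mul_one] at e1
  rw [h.integral_beta] at e1
  have e2 : ∫ ρ in (-r)..r, beta V t ρ ^ 2 ≤ majNorm T L V t := by
    calc ∫ ρ in (-r)..r, beta V t ρ ^ 2 ≤ ∫ ρ in (-r)..r, maj V t (ρ + t) ^ 2 := by
          refine intervalIntegral.integral_mono_on (by linarith)
            ((by fun_prop : Continuous _).intervalIntegrable _ _)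
            ((by fun_prop : Continuous _).intervalIntegrable _ _) fun ρ _ => ?_
          rw [← sq_abs (beta V t ρ)]
          exact pow_le_pow_left₀ (abs_nonneg _) (h.abs_beta_le ht ρ) 2
      _ = ∫ y in (-r + t)..(r + t), maj V t y ^ 2 :=
          intervalIntegral.integral_comp_add_right (fun y => maj V t y ^ 2) t
      _ ≤ _ := h.integral_maj_sq_le ht (by linarith)
  have e3 : (r * 4) * (r * dt V t r ^ 2) ≤ (r * 4) * (1 / 2 * majNorm T L V t) := by
    have := mul_le_mul_of_nonneg_left e2 hr
    nlinarith
  exact le_of_mul_le_mul_left e3 (by linarith)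

theorem hardy (h : RadialSol T L t₁ V) {a b : ℝ} (ha : 0 ≤ a) (hab : a ≤ b) (hb : b ≤ t₁)
    (y : ℝ) : ∫ s in a..b, dt V s (y - s) ^ 2 ≤ 4 * majNorm T L V b := by
  have hχ := sm_chi h.sm
  have ck : Continuous fun s => dt V s (y - s) :=
    h.sm.dt.cont_comp continuous_id (continuous_const.sub continuous_id)
  have cb : Continuous fun s => beta V s (-(y - s)) :=
    (sm_beta h.sm).cont_comp continuous_id (continuous_const.sub continuous_id).neg
  have cm := continuous_maj_right h.sm b
  have hk : ∀ s, HasDerivAt (fun s => (y - s) * dt V s (y - s) ^ 2)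
      (dt V s (y - s) ^ 2 - 2 * (dt V s (y - s) * beta V s (-(y - s)))) s := by
    intro s
    have hs : HasDerivAt (fun s : ℝ => y - s) (-1) s := (hasDerivAt_id s).const_sub y
    have k1 : HasDerivAt (fun s => dt V s (y - s))
        (dt (dt V) s (y - s) * 1 + dr (dt V) s (y - s) * -1) s :=
      hasDerivAt_comp_pair h.sm.dt.c1 (hasDerivAt_id s) hs
    have k2 := hs.mul (k1.pow 2)
    refine k2.congr_deriv ?_
    have d1 : dt (chi V) s (y - s) = (y - s) * dt (dt V) s (y - s) := dt_dt_mulr h.sm s (y - s)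
    have d2 : dr (chi V) s (y - s) = dt V s (y - s) + (y - s) * dr (dt V) s (y - s) := by
      have : chi V = mulr (dt V) := funext fun t => funext fun r => h.chi_eq t r
      rw [this, dr_mulr h.sm.dt]
    simp only [beta, h.dt_chi_odd, h.dr_chi_even, d1, d2, Pi.pow_apply]
    push_cast
    ring
  have hI := intervalIntegral.integral_eq_sub_of_hasDerivAt (a := a) (b := b) (fun s _ => hk s)
    ((by fun_prop : Continuous _).intervalIntegrable _ _)
  have hN : majNorm T L V a ≤ majNorm T L V b := h.majNorm_mono ha hab
  have hbd : (y - b) * dt V b (y - b) ^ 2 - (y - a) * dt V a (y - a) ^ 2 ≤ majNorm T L V b := by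
    have e1 := h.mul_dt_sq_le ⟨ha.trans hab, hb⟩ (y - b)
    have e2 := h.mul_dt_sq_le ⟨ha, hab.trans hb⟩ (y - a)
    have e3 := mul_le_mul_of_nonneg_right (le_abs_self (y - b)) (sq_nonneg (dt V b (y - b)))
    have e4 := mul_le_mul_of_nonneg_right (neg_abs_le (y - a)) (sq_nonneg (dt V a (y - a)))
    linarith
  have hβ : ∫ s in a..b, beta V s (-(y - s)) ^ 2 ≤ 1 / 2 * majNorm T L V b := by
    calc ∫ s in a..b, beta V s (-(y - s)) ^ 2 ≤ ∫ s in a..b, maj V b (2 * s - y) ^ 2 := by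
          refine intervalIntegral.integral_mono_on hab
            ((by fun_prop : Continuous _).intervalIntegrable _ _)
            ((by fun_prop : Continuous _).intervalIntegrable _ _) fun s hs => ?_
          rw [← sq_abs (beta V s _)]
          refine pow_le_pow_left₀ (abs_nonneg _) ?_ 2
          refine (h.abs_beta_le ⟨ha.trans hs.1, hs.2.trans hb⟩ _).trans ?_
          refine (maj_mono h.sm _ hs.2).trans_eq ?_
          congr 1
          ring
      _ = (2 : ℝ)⁻¹ • ∫ z in (2 * a - y)..(2 * b - y), maj V b z ^ 2 :=
          intervalIntegral.integral_comp_mul_sub (fun z => maj V b z ^ 2) two_ne_zero y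
      _ ≤ _ := by
          have := h.integral_maj_sq_le ⟨ha.trans hab, hb⟩
            (by linarith : 2 * a - y ≤ 2 * b - y)
          rw [smul_eq_mul]
          linarith
  have hlow : 1 / 2 * (∫ s in a..b, dt V s (y - s) ^ 2)
      - 2 * ∫ s in a..b, beta V s (-(y - s)) ^ 2
      ≤ ∫ s in a..b, (dt V s (y - s) ^ 2 - 2 * (dt V s (y - s) * beta V s (-(y - s)))) := by
    rw [← intervalIntegral.integral_const_mul, ← intervalIntegral.integral_const_mul,
      ← intervalIntegral.integral_sub ((by fun_prop : Continuous _).intervalIntegrable _ _)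
        ((by fun_prop : Continuous _).intervalIntegrable _ _)]
    refine intervalIntegral.integral_mono_on hab
      ((by fun_prop : Continuous _).intervalIntegrable _ _)
      ((by fun_prop : Continuous _).intervalIntegrable _ _) fun s _ => ?_
    nlinarith [sq_nonneg (dt V s (y - s) - 2 * beta V s (-(y - s)))]
  rw [hI] at hlow
  linarith

theorem van_mor (h : RadialSol T L t₁ V) : Van T L (mor V) := fun t r ht hr => by
  simp [mor, h.van t r ht hr]

theorem integral_force_sq_le (h : RadialSol T L t₁ V) {a b Λ : ℝ} (ha : 0 ≤ a) (hab : a ≤ b)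
    (hb : b ≤ t₁) (hΛ : ∀ t ∈ Set.Icc a b, ∀ r, lw (V t r) ≤ Λ) (y : ℝ) :
    (∫ s in a..b, |force V s (y - s)|) ^ 2
      ≤ 512 * energy L V 0 * Λ * majNorm T L V b * ∫ s in a..b, |mor V s (y - s)| := by
  have cy : Continuous fun s : ℝ => y - s := by fun_prop
  have cV : Continuous fun s => V s (y - s) := h.sm.cont_comp continuous_id cy
  have cVt : Continuous fun s => dt V s (y - s) := h.sm.dt.cont_comp continuous_id cy
  have cl := contDiff_lw.continuous.comp cV
  simp only [Function.comp_def] at cl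
  have cm : Continuous fun s => |mor V s (y - s)| :=
    (continuous_comp_pair (continuous_mor h.sm) continuous_id cy).abs
  set q : ℝ → ℝ := fun s => Real.sqrt (|y - s| * lw (V s (y - s))) with hq
  have cq : Continuous q := (cy.abs.mul cl).sqrt
  have hq2 : ∀ s, q s ^ 2 = |y - s| * lw (V s (y - s)) := fun s =>
    Real.sq_sqrt (mul_nonneg (abs_nonneg _) (lw_nonneg _))
  set f : ℝ → ℝ := fun s => 8 * (|V s (y - s)| ^ 3 * q s) with hf
  set g : ℝ → ℝ := fun s => |V s (y - s)| * q s * |dt V s (y - s)| with hg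
  have cf : Continuous f := continuous_const.mul ((cV.abs.pow 3).mul cq)
  have cg : Continuous g := (cV.abs.mul cq).mul cVt.abs
  have e1 : ∫ s in a..b, |force V s (y - s)| ≤ ∫ s in a..b, f s * g s := by
    refine intervalIntegral.integral_mono_on hab (force_intervalIntegrable h.sm y a b)
      ((cf.mul cg).intervalIntegrable _ _) fun s _ => ?_
    unfold force
    rw [abs_mul, h.chi_eq, abs_mul]
    refine (mul_le_mul_of_nonneg_right (abs_deriv_nonlin_le _)
      (mul_nonneg (abs_nonneg _) (abs_nonneg _))).trans_eq ?_
    have e : f s * g s = 8 * (|V s (y - s)| ^ 4 * q s ^ 2 * |dt V s (y - s)|) := by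
      simp only [hf, hg]
      ring
    rw [e, hq2, Even.pow_abs (by decide)]
    ring
  have e2 : ∫ s in a..b, f s ^ 2 = 64 * ∫ s in a..b, |mor V s (y - s)| := by
    rw [← intervalIntegral.integral_const_mul]
    congr 1
    funext s
    have e : f s ^ 2 = 64 * (|V s (y - s)| ^ 6 * q s ^ 2) := by
      simp only [hf]
      ring
    rw [e, hq2, Even.pow_abs (by decide)]
    unfold mor
    rw [abs_mul, abs_of_nonneg (mul_nonneg (by positivity) (lw_nonneg (V s (y - s))))]
    ring
  have hE := h.energy_nonneg 0
  have hΛ0 : 0 ≤ Λ := (lw_nonneg _).trans (hΛ a (Set.left_mem_Icc.2 hab) 0)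
  have e3 : ∫ s in a..b, g s ^ 2 ≤ 2 * energy L V 0 * Λ * (4 * majNorm T L V b) := by
    calc ∫ s in a..b, g s ^ 2 ≤ ∫ s in a..b, 2 * energy L V 0 * Λ * dt V s (y - s) ^ 2 := by
          refine intervalIntegral.integral_mono_on hab
            ((cg.pow 2).intervalIntegrable _ _)
            (((cVt.pow 2).const_mul _).intervalIntegrable _ _) fun s hs => ?_
          have e : g s ^ 2 = (|y - s| * V s (y - s) ^ 2) * lw (V s (y - s)) * dt V s (y - s) ^ 2 := by
            simp only [hg]
            rw [mul_pow, mul_pow, hq2, sq_abs, sq_abs]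
            ring
          rw [e]
          refine mul_le_mul_of_nonneg_right ?_ (sq_nonneg _)
          exact mul_le_mul (h.mul_sq_le ⟨ha.trans hs.1, hs.2.trans hb⟩ _) (hΛ s hs _)
            (lw_nonneg _) (by positivity)
      _ ≤ _ := by
          rw [intervalIntegral.integral_const_mul]
          exact mul_le_mul_of_nonneg_left (h.hardy ha hab hb y) (by positivity)
  have e4 := sq_integral_mul_le cf cg hab
  have e5 : 0 ≤ ∫ s in a..b, |force V s (y - s)| :=
    intervalIntegral.integral_nonneg hab fun _ _ => abs_nonneg _
  have e6 : 0 ≤ ∫ s in a..b, |mor V s (y - s)| :=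
    intervalIntegral.integral_nonneg hab fun _ _ => abs_nonneg _
  rw [e2] at e4
  have e7 := mul_le_mul_of_nonneg_left e3
    (by positivity : 0 ≤ 64 * ∫ s in a..b, |mor V s (y - s)|)
  have e8 := pow_le_pow_left₀ e5 e1 2
  linarith

/-- The Morawetz spacetime integral up to time `t`. -/
def morInt (L : ℝ) (V : ℝ → ℝ → ℝ) (t : ℝ) : ℝ :=
  ∫ s in (0 : ℝ)..t, ∫ r in (0 : ℝ)..(L + 1), mor V s r

theorem continuous_integral_mor (hV : Sm V) :
    Continuous fun s => ∫ r in (0 : ℝ)..(L + 1), mor V s r :=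
  intervalIntegral.continuous_parametric_intervalIntegral_of_continuous'
    (by exact continuous_mor hV) 0 (L + 1)

theorem morInt_sub (hV : Sm V) (a b : ℝ) :
    morInt L V b - morInt L V a = ∫ s in a..b, ∫ r in (0 : ℝ)..(L + 1), mor V s r := by
  unfold morInt
  have c := continuous_integral_mor (L := L) hV
  rw [intervalIntegral.integral_interval_sub_left (c.intervalIntegrable _ _)
    (c.intervalIntegrable _ _)]

theorem mor_odd (h : RadialSol T L t₁ V) (t r : ℝ) : mor V t (-r) = -mor V t r := by
  simp only [mor, h.even]
  ring

theorem integral_abs_mor_le (h : RadialSol T L t₁ V) {t : ℝ} (ht : t ∈ Set.Icc 0 t₁) {c d : ℝ}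
    (hcd : c ≤ d) :
    ∫ r in c..d, |mor V t r| ≤ 2 * ∫ r in (0 : ℝ)..(L + 1), mor V t r := by
  have hL := h.nonneg_L
  have cm : Continuous (mor V t) :=
    (continuous_mor h.sm).comp (f := fun y : ℝ => (t, y)) (by fun_prop)
  have e1 := integral_le_of_vanish (f := fun r => |mor V t r|) cm.abs (fun _ => abs_nonneg _)
    (B := L + 1) (by linarith) hcd
    (fun r hr => by rw [h.van_mor t r (h.abs_lt ht) (by linarith), abs_zero])
  rw [← intervalIntegral.integral_add_adjacent_intervals (a := -(L + 1)) (b := 0)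
      (c := L + 1)
    (cm.abs.intervalIntegrable _ _) (cm.abs.intervalIntegrable _ _)] at e1
  have e2 : ∫ r in (-(L + 1))..0, |mor V t r| = ∫ r in (0 : ℝ)..(L + 1), |mor V t r| := by
    have := intervalIntegral.integral_comp_neg (a := 0) (b := L + 1) fun r => |mor V t r|
    simp only [h.mor_odd, abs_neg, neg_zero] at this
    exact this.symm
  have e3 : ∫ r in (0 : ℝ)..(L + 1), |mor V t r| = ∫ r in (0 : ℝ)..(L + 1), mor V t r := by
    refine intervalIntegral.integral_congr fun r hr => ?_
    rw [Set.uIcc_of_le (by linarith)] at hr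
    exact abs_of_nonneg (mul_nonneg hr.1 (mul_nonneg (by positivity) (lw_nonneg _)))
  linarith

theorem morInt_mono (h : RadialSol T L t₁ V) {a b : ℝ} (hab : a ≤ b) :
    morInt L V a ≤ morInt L V b := by
  refine sub_nonneg.1 ?_
  rw [morInt_sub h.sm]
  refine intervalIntegral.integral_nonneg hab fun s _ =>
    intervalIntegral.integral_nonneg (by linarith [h.nonneg_L]) fun r hr => ?_
  exact mul_nonneg hr.1 (mul_nonneg (by positivity) (lw_nonneg _))

theorem majNorm_le (h : RadialSol T L t₁ V) {a b Λ : ℝ} (ha : 0 ≤ a) (hab : a ≤ b)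
    (hb : b ≤ t₁) (hΛ : ∀ t ∈ Set.Icc a b, ∀ r, lw (V t r) ≤ Λ) :
    majNorm T L V b ≤ 2 * majNorm T L V a
      + 2048 * energy L V 0 * Λ * (morInt L V b - morInt L V a) * majNorm T L V b := by
  have hL := h.nonneg_L
  have hT := h.nonneg_T
  have hE := h.energy_nonneg 0
  have hΛ0 : 0 ≤ Λ := (lw_nonneg _).trans (hΛ a (Set.left_mem_Icc.2 hab) 0)
  have hN := h.majNorm_nonneg b
  set B := L + T + 1 with hB
  have cI : Continuous fun y => ∫ s in a..b, |force V s (y - s)| :=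
    intervalIntegral.continuous_parametric_intervalIntegral_of_continuous'
      (by exact continuous_abs_force h.sm) a b
  have cab : Continuous fun p : ℝ × ℝ => |mor V p.2 (p.1 - p.2)| :=
    (continuous_comp_pair (continuous_mor h.sm) continuous_snd
      (continuous_fst.sub continuous_snd)).abs
  have cJ : Continuous fun y => ∫ s in a..b, |mor V s (y - s)| :=
    intervalIntegral.continuous_parametric_intervalIntegral_of_continuous' (by exact cab) a b
  have cab' : Continuous fun p : ℝ × ℝ => |mor V p.1 (p.2 - p.1)| :=
    (continuous_comp_pair (continuous_mor h.sm) continuous_fst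
      (continuous_snd.sub continuous_fst)).abs
  have cJ' : Continuous fun s => ∫ y in (-B)..B, |mor V s (y - s)| :=
    intervalIntegral.continuous_parametric_intervalIntegral_of_continuous' (by exact cab') (-B) B
  have ca := continuous_maj_right h.sm a
  have cb := continuous_maj_right h.sm b
  have e1 : ∫ y in (-B)..B, ∫ s in a..b, |mor V s (y - s)|
      ≤ 2 * (morInt L V b - morInt L V a) := by
    rw [intervalIntegral_intervalIntegral_swap]
    · rw [morInt_sub h.sm, ← intervalIntegral.integral_const_mul]
      refine intervalIntegral.integral_mono_on hab (cJ'.intervalIntegrable _ _)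
        (((continuous_integral_mor h.sm).const_mul 2).intervalIntegrable _ _) fun s hs => ?_
      rw [intervalIntegral.integral_comp_sub_right (fun y => |mor V s y|) s]
      exact h.integral_abs_mor_le ⟨ha.trans hs.1, hs.2.trans hb⟩ (by linarith)
    · refine (ContinuousOn.integrableOn_compact (K := Set.uIcc (-B) B ×ˢ Set.uIcc a b)
        (isCompact_uIcc.prod isCompact_uIcc) (by exact cab.continuousOn)).mono_set ?_
      exact Set.prod_mono Set.uIoc_subset_uIcc Set.uIoc_subset_uIcc
  have e2 : ∫ y in (-B)..B, (∫ s in a..b, |force V s (y - s)|) ^ 2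
      ≤ 512 * energy L V 0 * Λ * majNorm T L V b * (2 * (morInt L V b - morInt L V a)) := by
    refine le_trans ?_ (mul_le_mul_of_nonneg_left e1 (by positivity))
    rw [← intervalIntegral.integral_const_mul]
    exact intervalIntegral.integral_mono_on (by linarith) ((cI.pow 2).intervalIntegrable _ _)
      ((cJ.const_mul _).intervalIntegrable _ _)
      fun y _ => h.integral_force_sq_le ha hab hb hΛ y
  have e3 : majNorm T L V b ≤ 2 * majNorm T L V a
      + 2 * ∫ y in (-B)..B, (∫ s in a..b, |force V s (y - s)|) ^ 2 := by
    have c1 : Continuous fun y => 2 * maj V a y ^ 2 := (ca.pow 2).const_mul 2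
    have c2 : Continuous fun y => 2 * (∫ s in a..b, |force V s (y - s)|) ^ 2 :=
      (cI.pow 2).const_mul 2
    rw [show majNorm T L V b = ∫ y in (-B)..B, maj V b y ^ 2 from rfl,
      show majNorm T L V a = ∫ y in (-B)..B, maj V a y ^ 2 from rfl,
      ← intervalIntegral.integral_const_mul, ← intervalIntegral.integral_const_mul,
      ← intervalIntegral.integral_add (c1.intervalIntegrable _ _) (c2.intervalIntegrable _ _)]
    refine intervalIntegral.integral_mono_on (by linarith) ((cb.pow 2).intervalIntegrable _ _)
      ((c1.add c2).intervalIntegrable _ _) fun y _ => ?_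
    rw [maj_sub h.sm y a b]
    nlinarith [sq_nonneg (maj V a y - ∫ s in a..b, |force V s (y - s)|)]
  linarith

theorem abs_dr_mulr_le (h : RadialSol T L t₁ V) {t : ℝ} (ht : t ∈ Set.Icc 0 t₁) (r : ℝ) :
    |dr (mulr V) t r| ≤ |dr (mulr V) 0 r| + T / 2 + majNorm T L V t / 2 := by
  have hχ := sm_chi h.sm
  have cm := continuous_maj_right h.sm t
  have cd : Continuous fun s => dr (chi V) s r := hχ.dr.cont_comp continuous_id continuous_const
  have e1 : ∫ s in (0 : ℝ)..t, dr (chi V) s r = dr (mulr V) t r - dr (mulr V) 0 r := by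
    refine intervalIntegral.integral_eq_sub_of_hasDerivAt
      (f := fun s => dr (mulr V) s r) (fun s _ => ?_)
      (cd.intervalIntegrable _ _)
    rw [chi, ← h.sm.mulr.dt_dr]
    exact h.sm.mulr.dr.hasDt s r
  have e2 := intervalIntegral.abs_integral_le_integral_abs (μ := volume)
    (f := fun s => dr (chi V) s r) ht.1
  have key : ∀ s ∈ Set.Icc 0 t, |dr (chi V) s r|
      ≤ 1 / 2 + 1 / 4 * (maj V t (s + r) ^ 2 + maj V t (s + -r) ^ 2) := by
    intro s hs
    have hs' : s ∈ Set.Icc 0 t₁ := ⟨hs.1, hs.2.trans ht.2⟩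
    have b : ∀ r, |beta V s r| ≤ maj V t (s + r) := fun r => by
      rw [add_comm s r]
      exact (h.abs_beta_le hs' r).trans (maj_mono h.sm _ hs.2)
    have e : dr (chi V) s r = 1 / 2 * (beta V s r + beta V s (-r)) := by
      simp only [beta, h.dt_chi_odd, h.dr_chi_even]
      ring
    have e' := abs_add_le (beta V s r) (beta V s (-r))
    rw [e, abs_mul, abs_of_pos (by norm_num : (0 : ℝ) < 1 / 2)]
    have b1 := b r
    have b2 := b (-r)
    nlinarith [sq_nonneg (maj V t (s + r) - 1), sq_nonneg (maj V t (s + -r) - 1)]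
  have c1 : ∀ r, Continuous fun s => maj V t (s + r) ^ 2 := fun r => by fun_prop
  have e3 : ∫ s in (0 : ℝ)..t, |dr (chi V) s r|
      ≤ ∫ s in (0 : ℝ)..t, (1 / 2 + 1 / 4 * (maj V t (s + r) ^ 2 + maj V t (s + -r) ^ 2)) :=
    intervalIntegral.integral_mono_on ht.1 (cd.abs.intervalIntegrable _ _)
      ((by fun_prop : Continuous _).intervalIntegrable _ _) key
  have e4 : ∀ r, ∫ s in (0 : ℝ)..t, maj V t (s + r) ^ 2 ≤ majNorm T L V t := fun r => by
    rw [intervalIntegral.integral_comp_add_right (fun y => maj V t y ^ 2) r]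
    exact h.integral_maj_sq_le ht (by linarith [ht.1])
  rw [intervalIntegral.integral_add (intervalIntegrable_const)
    ((by fun_prop : Continuous _).intervalIntegrable _ _), intervalIntegral.integral_const_mul,
    intervalIntegral.integral_add ((c1 r).intervalIntegrable _ _)
      ((c1 (-r)).intervalIntegrable _ _), intervalIntegral.integral_const] at e3
  rw [e1] at e2
  have e5 := e4 r
  have e6 := e4 (-r)
  have e7 := abs_sub_abs_le_abs_sub (dr (mulr V) t r) (dr (mulr V) 0 r)
  have e8 : t ≤ T := ht.2.trans h.le_T
  simp only [sub_zero, smul_eq_mul] at e3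
  linarith

theorem abs_le_of_dr_mulr_le (hV : Sm V) {t M : ℝ} (hM : ∀ r, |dr (mulr V) t r| ≤ M) (r : ℝ) :
    |V t r| ≤ M := by
  rcases eq_or_ne r 0 with h0 | h0
  · have := hM 0
    rw [dr_mulr hV, zero_mul, add_zero] at this
    rwa [h0]
  · have h1 := convex_univ.norm_image_sub_le_of_norm_hasDerivWithin_le (f := mulr V t)
      (fun x _ => (hV.mulr.hasDr t x).hasDerivWithinAt) (fun x _ => hM x)
      (Set.mem_univ 0) (Set.mem_univ r)
    simp only [mulr, zero_mul, sub_zero, norm_eq_abs, abs_mul] at h1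
    rw [mul_comm] at h1
    exact le_of_mul_le_mul_right h1 (abs_pos.2 h0)

theorem abs_le_majNorm (h : RadialSol T L t₁ V) {C : ℝ} (hC : ∀ r, |dr (mulr V) 0 r| ≤ C)
    {t : ℝ} (ht : t ∈ Set.Icc 0 t₁) (r : ℝ) :
    |V t r| ≤ C + T / 2 + majNorm T L V t / 2 :=
  abs_le_of_dr_mulr_le h.sm (fun r => (h.abs_dr_mulr_le ht r).trans (by linarith [hC r])) r

end RadialSol

/-- A doubling argument: if each quadrupling of `N` costs at least a multiple of
`1 / log N` in a bounded quantity `x`, then `N` stays bounded. -/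
theorem harmonic_le_of_doubling {N x : ℝ → ℝ} {t₁ P K C : ℝ} (hN : Continuous N)
    (hx : ∀ a b, a ≤ b → x a ≤ x b) (hx0 : 0 ≤ x 0) (hP : 1 ≤ P)
    (hNP : N 0 ≤ P) (hK : 0 ≤ K) (hC : 0 ≤ C)
    (hstep : ∀ a b, 0 ≤ a → a ≤ b → b ≤ t₁ →
      N b ≤ 2 * N a + K * Real.log (2 + (C + N b / 2) ^ 2) * (x b - x a) * N b) (m : ℕ) :
    ∀ b ∈ Set.Icc 0 t₁, 4 ^ m * P ≤ N b → ∑ k ∈ Finset.range m, 1 / ((k : ℝ) + 1)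
      ≤ 2 * K * (2 * Real.log (2 + C + P) + 2 * Real.log 4) * x b := by
  have hl1 : 0 ≤ Real.log (2 + C + P) := Real.log_nonneg (by linarith)
  have hl2 : 0 ≤ Real.log 4 := Real.log_nonneg (by norm_num)
  set D := 2 * Real.log (2 + C + P) + 2 * Real.log 4 with hD
  induction m with
  | zero =>
    intro b hb _
    have := hx0.trans (hx 0 b hb.1)
    simp only [Finset.range_zero, Finset.sum_empty]
    positivity
  | succ m ih =>
    intro b hb hNb
    have h4 : (1 : ℝ) ≤ 4 ^ m := one_le_pow₀ (by norm_num)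
    have hpos : 0 < 4 ^ m * P := by positivity
    obtain ⟨b', hb', hNb'⟩ : 4 ^ (m + 1) * P ∈ N '' Set.Icc 0 b :=
      intermediate_value_Icc hb.1 hN.continuousOn ⟨by rw [pow_succ]; nlinarith, hNb⟩
    obtain ⟨a, ha, hNa⟩ : 4 ^ m * P ∈ N '' Set.Icc 0 b' :=
      intermediate_value_Icc hb'.1 hN.continuousOn
        ⟨by nlinarith, by rw [hNb', pow_succ]; nlinarith⟩
    have h1 := ih a ⟨ha.1, ha.2.trans (hb'.2.trans hb.2)⟩ hNa.ge
    have h2 := hstep a b' ha.1 ha.2 (hb'.2.trans hb.2)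
    have hxx := hx a b' ha.2
    have hxb := hx b' b hb'.2
    have hlog : Real.log (2 + (C + N b' / 2) ^ 2) ≤ D * ((m : ℝ) + 1) := by
      have e1 : 2 + (C + N b' / 2) ^ 2 ≤ ((2 + C + P) * 4 ^ (m + 1)) ^ 2 := by
        have h5 : 2 + (C + N b' / 2) ^ 2 ≤ (2 + C + N b' / 2) ^ 2 := by
          have : 0 ≤ N b' := by rw [hNb']; positivity
          nlinarith
        refine h5.trans (pow_le_pow_left₀ (by rw [hNb']; positivity) ?_ 2)
        rw [hNb', pow_succ]
        nlinarith [mul_nonneg (sub_nonneg.2 h4) (by linarith : 0 ≤ 2 + C), mul_pos hpos hpos]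
      refine (Real.log_le_log (by positivity) e1).trans ?_
      rw [Real.log_pow, Real.log_mul (by positivity) (by positivity), Real.log_pow]
      push_cast
      rw [hD]
      nlinarith [mul_nonneg (Nat.cast_nonneg (α := ℝ) m) hl1]
    rw [hNa, hNb', pow_succ] at h2
    rw [hNb', pow_succ] at hlog
    have h3 : 1 / 2 ≤ K * Real.log (2 + (C + 4 ^ m * 4 * P / 2) ^ 2) * (x b' - x a) := by
      by_contra hlt
      push Not at hlt
      nlinarith
    have h6 : 1 / 2 ≤ K * (D * ((m : ℝ) + 1)) * (x b' - x a) :=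
      h3.trans (mul_le_mul_of_nonneg_right (mul_le_mul_of_nonneg_left hlog hK)
        (sub_nonneg.2 hxx))
    have hm : (0 : ℝ) < (m : ℝ) + 1 := by positivity
    have h7 : 1 / ((m : ℝ) + 1) ≤ 2 * K * D * (x b' - x a) := by
      rw [div_le_iff₀ hm]
      nlinarith
    rw [Finset.sum_range_succ]
    have h8 : 0 ≤ 2 * K * D := by positivity
    have h9 := mul_le_mul_of_nonneg_left hxb h8
    linarith

namespace RadialSol

variable {T L t₁ t₂ : ℝ} {V W : ℝ → ℝ → ℝ}

theorem dr_mulr_zero_congr (h0 : ∀ r, V 0 r = W 0 r) (r : ℝ) :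
    dr (mulr V) 0 r = dr (mulr W) 0 r := by
  simp only [dr, mulr, h0]

theorem energy_zero_congr (hV : Sm V) (hW : Sm W) (h0 : ∀ r, V 0 r = W 0 r)
    (h1 : ∀ r, dt V 0 r = dt W 0 r) : energy L V 0 = energy L W 0 := by
  simp only [energy, dt_mulr hV, dt_mulr hW, dr_mulr_zero_congr h0, h0, h1]

theorem majNorm_zero_congr (hV : RadialSol T L t₁ V) (hW : RadialSol T L t₂ W)
    (h0 : ∀ r, V 0 r = W 0 r) (h1 : ∀ r, dt V 0 r = dt W 0 r) :
    majNorm T L V 0 = majNorm T L W 0 := by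
  have hχ : ∀ r, chi V 0 r = chi W 0 r := fun r => by rw [hV.chi_eq, hW.chi_eq, h1]
  have hβ : ∀ r, beta V 0 r = beta W 0 r := fun r => by
    have e1 : dr (chi V) 0 r = dr (chi W) 0 r := by simp only [dr, hχ]
    have e2 : dr (dr (mulr V)) 0 r = dr (dr (mulr W)) 0 r := by
      unfold dr
      exact congrArg (fun f => deriv f r) (funext fun s => dr_mulr_zero_congr h0 s)
    have e3 := hV.wave (Set.left_mem_Icc.2 hV.pos.le) r
    have e4 := hW.wave (Set.left_mem_Icc.2 hW.pos.le) r
    simp only [beta, e1]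
    simp only [chi]
    rw [e3, e4, e2, h0]
  simp only [majNorm, maj, hβ, intervalIntegral.integral_same, add_zero]

theorem exists_dr_mulr_zero_le (h : RadialSol T L t₁ V) :
    ∃ C, 0 ≤ C ∧ ∀ r, |dr (mulr V) 0 r| ≤ C := by
  have c : Continuous (dr (mulr V) 0) := h.sm.mulr.dr.cont_comp continuous_const continuous_id
  obtain ⟨C, hC⟩ := (isCompact_Icc (a := -L) (b := L)).exists_bound_of_continuousOn c.continuousOn
  refine ⟨max C 0, le_max_right _ _, fun r => ?_⟩
  rcases lt_or_ge L |r| with hr | hr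
  · rw [h.van.mulr.dr 0 r (h.abs_lt (Set.left_mem_Icc.2 h.pos.le)) hr, abs_zero]
    exact le_max_right _ _
  · exact (hC r (abs_le.1 hr)).trans (le_max_left _ _)

theorem lw_le_of_abs_le {v c : ℝ} (h : |v| ≤ c) : lw v ≤ Real.log (2 + c ^ 2) := by
  refine Real.log_le_log (by positivity) ?_
  have := pow_le_pow_left₀ (abs_nonneg v) h 2
  rw [sq_abs] at this
  linarith

end RadialSol

open RadialSol in
/-- Solutions of the radial equation are bounded uniformly in terms of the initial data. -/
theorem exists_apriori_bound (V₀ V₁ : ℝ → ℝ) (T L : ℝ) : ∃ M, ∀ V t₁, RadialSol T L t₁ V →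
    (∀ r, V 0 r = V₀ r) → (∀ r, dt V 0 r = V₁ r) → ∀ t ∈ Set.Icc 0 t₁, ∀ r, |V t r| ≤ M := by
  by_cases hex : ∃ W t₂, RadialSol T L t₂ W ∧ (∀ r, W 0 r = V₀ r) ∧ ∀ r, dt W 0 r = V₁ r
  swap
  · exact ⟨0, fun V t₁ h h0 h1 => absurd ⟨V, t₁, h, h0, h1⟩ hex⟩
  obtain ⟨W, t₂, hW, hW0, hW1⟩ := hex
  obtain ⟨C₀, hC₀, hWC⟩ := hW.exists_dr_mulr_zero_le
  have hT := hW.nonneg_T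
  have hEW := hW.energy_nonneg 0
  set E := energy L W 0 with hE
  set C := C₀ + T / 2 with hC
  set P := majNorm T L W 0 + 1 with hP
  have hP1 : 1 ≤ P := by linarith [hW.majNorm_nonneg 0]
  set S := 2 * (2048 * E) * (2 * Real.log (2 + C + P) + 2 * Real.log 4) * (3 * E) with hS
  obtain ⟨m, hm⟩ :=
    ((Filter.tendsto_atTop.1 Real.tendsto_sum_range_one_div_nat_succ_atTop) (S + 1)).exists
  refine ⟨C + 4 ^ m * P / 2, fun V t₁ h h0 h1 => ?_⟩
  have e0 : ∀ r, V 0 r = W 0 r := fun r => (h0 r).trans (hW0 r).symm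
  have e1 : ∀ r, dt V 0 r = dt W 0 r := fun r => (h1 r).trans (hW1 r).symm
  have hVE : energy L V 0 = E := energy_zero_congr h.sm hW.sm e0 e1
  have hVN : majNorm T L V 0 = majNorm T L W 0 := majNorm_zero_congr h hW e0 e1
  have hVC : ∀ r, |dr (mulr V) 0 r| ≤ C₀ := fun r => by
    rw [dr_mulr_zero_congr e0]
    exact hWC r
  have hstep : ∀ a b, 0 ≤ a → a ≤ b → b ≤ t₁ → majNorm T L V b ≤ 2 * majNorm T L V a
      + 2048 * E * Real.log (2 + (C + majNorm T L V b / 2) ^ 2)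
        * (morInt L V b - morInt L V a) * majNorm T L V b := by
    intro a b ha hab hb
    have := h.majNorm_le ha hab hb (Λ := Real.log (2 + (C + majNorm T L V b / 2) ^ 2))
      fun t ht r => lw_le_of_abs_le <|
        (h.abs_le_majNorm hVC ⟨ha.trans ht.1, ht.2.trans hb⟩ r).trans (by
          linarith [h.majNorm_mono (ha.trans ht.1) ht.2])
    rwa [hVE] at this
  have hl1 : 0 ≤ Real.log (2 + C + P) := Real.log_nonneg (by linarith)
  have hl2 : 0 ≤ Real.log 4 := Real.log_nonneg (by norm_num)
  intro t ht r
  have hlt : majNorm T L V t < 4 ^ m * P := by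
    by_contra hge
    push Not at hge
    have := harmonic_le_of_doubling (continuous_majNorm h.sm) (fun a b => h.morInt_mono)
      (by simp [morInt]) hP1 (by rw [hVN]; linarith) (by positivity : 0 ≤ 2048 * E)
      (by positivity : 0 ≤ C) hstep m t ht hge
    have hx : morInt L V t ≤ 3 * E := by
      have := h.morawetz t ht
      rwa [hVE] at this
    have h9 := mul_le_mul_of_nonneg_left hx
      (by positivity : 0 ≤ 2 * (2048 * E) * (2 * Real.log (2 + C + P) + 2 * Real.log 4))
    linarith
  exact (h.abs_le_majNorm hVC ht r).trans (by linarith)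

theorem deriv_deriv_comp_neg (f : ℝ → ℝ) (t : ℝ) :
    deriv (deriv fun s => f (-s)) t = deriv (deriv f) (-t) := by
  have : (deriv fun s => f (-s)) = fun s => -deriv f (-s) := funext fun s => deriv_comp_neg f s
  rw [this, deriv.fun_neg, deriv_comp_neg (deriv f), neg_neg]

/-- Two-sided domain of dependence. -/
theorem eq_of_data_eq_of_abs_le {g : ℝ → ℝ} (hg : ContDiff ℝ 1 g) {u v : ℝ → Sp → ℝ}
    (hu : ContDiff ℝ (⊤ : ℕ∞) fun p : ℝ × Sp => u p.1 p.2)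
    (hv : ContDiff ℝ (⊤ : ℕ∞) fun p : ℝ × Sp => v p.1 p.2) {T R : ℝ} {x0 : Sp} (hTR : T < R)
    (eu : ∀ t, |t| ≤ T → ∀ x, deriv (deriv fun s => u s x) t = lap (u t) x - g (u t x))
    (ev : ∀ t, |t| ≤ T → ∀ x, deriv (deriv fun s => v s x) t = lap (v t) x - g (v t x))
    (d0 : ∀ x ∈ Metric.ball x0 R, u 0 x = v 0 x)
    (d1 : ∀ x ∈ Metric.ball x0 R, deriv (fun s => u s x) 0 = deriv (fun s => v s x) 0) {t : ℝ}
    (ht : |t| ≤ T) : u t x0 = v t x0 := by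
  have habs : ∀ t ∈ Set.Icc 0 T, |t| ≤ T := fun t ht => by rw [abs_of_nonneg ht.1]; exact ht.2
  rcases le_total 0 t with h | h
  · exact eq_of_data_eq hg hu hv hTR (fun t ht => eu t (habs t ht)) (fun t ht => ev t (habs t ht))
      d0 d1 t ⟨h, (le_abs_self t).trans ht⟩
  · have hc : ContDiff ℝ (⊤ : ℕ∞) fun p : ℝ × Sp => (-p.1, p.2) := by fun_prop
    have := eq_of_data_eq hg (u := fun s => u (-s)) (v := fun s => v (-s)) (hu.comp hc)
      (hv.comp hc) hTR
      (fun t ht x => by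
        rw [deriv_deriv_comp_neg (fun s => u s x)]
        exact eu (-t) (by rw [abs_neg]; exact habs t ht) x)
      (fun t ht x => by
        rw [deriv_deriv_comp_neg (fun s => v s x)]
        exact ev (-t) (by rw [abs_neg]; exact habs t ht) x)
      (fun x hx => by simpa using d0 x hx)
      (fun x hx => by
        rw [deriv_comp_neg (fun s => u s x), deriv_comp_neg (fun s => v s x), neg_zero, d1 x hx])
      (-t) ⟨by linarith, (neg_le_abs t).trans ht⟩
    simpa using this

/-- Finite speed of propagation. -/
theorem eq_zero_of_data_eq_zero {g : ℝ → ℝ} (hg : ContDiff ℝ 1 g) (hg0 : g 0 = 0)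
    {u : ℝ → Sp → ℝ} (hu : ContDiff ℝ (⊤ : ℕ∞) fun p : ℝ × Sp => u p.1 p.2) {T R : ℝ}
    (eu : ∀ t, |t| ≤ T → ∀ x, deriv (deriv fun s => u s x) t = lap (u t) x - g (u t x))
    (d0 : ∀ x, R < ‖x‖ → u 0 x = 0) (d1 : ∀ x, R < ‖x‖ → deriv (fun s => u s x) 0 = 0)
    {t : ℝ} (ht : |t| ≤ T) {x : Sp} (hx : R + |t| < ‖x‖) : u t x = 0 := by
  have hball : ∀ y ∈ Metric.ball x (‖x‖ - R), R < ‖y‖ := fun y hy => by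
    rw [Metric.mem_ball, dist_comm, dist_eq_norm] at hy
    linarith [norm_sub_norm_le x y]
  refine eq_of_data_eq_of_abs_le (g := g) hg hu (v := fun _ _ => 0) contDiff_const
    (T := |t|) (R := ‖x‖ - R) (by linarith) (fun s hs => eu s (hs.trans ht)) (fun s _ y => ?_)
    (fun y hy => d0 y (hball y hy)) (fun y hy => ?_) le_rfl
  · have hpd : ∀ i, pd i (fun _ => 0) = fun _ => 0 := fun i => funext fun y => by simp [pd]
    simp [lap, hpd, hg0]
  · simpa using d1 y (hball y hy)

/-- A continuity argument: the a priori bound keeps a solution of the truncated equation below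
the truncation threshold. -/
theorem abs_lt_of_apriori {V : ℝ → ℝ → ℝ} {g : ℝ → ℝ} {T L M n : ℝ} (hV : Sm V)
    (he : ∀ t r, V t (-r) = V t r) (hT : 0 ≤ T) (hL : 0 ≤ L)
    (heq : ∀ t r, r * dt (dt V) t r = r * dr (dr V) t r + 2 * dr V t r - r * g (V t r))
    (hg : ∀ v, |v| ≤ n → g v = nonlin v) (hvan : Van T L V) (hMn : M < n)
    (h0 : ∀ r, |V 0 r| < n)
    (hM : ∀ t₁, RadialSol T L t₁ V → ∀ t ∈ Set.Icc 0 t₁, ∀ r, |V t r| ≤ M) :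
    ∀ t ∈ Set.Icc 0 T, ∀ r, |V t r| < n := by
  have hn : 0 < n := (abs_nonneg _).trans_lt (h0 0)
  have hout : ∀ t ∈ Set.Icc 0 T, ∀ r, L < |r| → V t r = 0 := fun t ht r hr =>
    hvan t r (by rw [abs_of_nonneg ht.1]; linarith [ht.2]) hr
  by_contra! hbad
  obtain ⟨s₀, hs₀, r₀, hr₀⟩ := hbad
  set B : Set (ℝ × ℝ) := (Set.Icc 0 T ×ˢ Set.Icc (-L) L) ∩ {p | n ≤ |V p.1 p.2|} with hB
  have hBc : IsCompact B := (isCompact_Icc.prod isCompact_Icc).inter_right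
    (isClosed_le continuous_const hV.cont.abs)
  have hmem : ∀ s ∈ Set.Icc 0 T, ∀ r, n ≤ |V s r| → (s, r) ∈ B := fun s hs r hr => by
    refine ⟨⟨hs, abs_le.1 ?_⟩, hr⟩
    by_contra! hlt
    rw [hout s hs r hlt, abs_zero] at hr
    linarith
  obtain ⟨⟨t₁, r₁⟩, ⟨⟨ht₁, -⟩, hr₁⟩, hmin⟩ :=
    hBc.exists_isMinOn ⟨_, hmem s₀ hs₀ r₀ hr₀⟩ continuous_fst.continuousOn
  change t₁ ∈ Set.Icc 0 T at ht₁
  change n ≤ |V t₁ r₁| at hr₁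
  have hpos : 0 < t₁ := by
    refine ht₁.1.lt_of_ne fun h => ?_
    rw [← h] at hr₁
    linarith [h0 r₁]
  have hlt : ∀ s ∈ Set.Ico 0 t₁, ∀ r, |V s r| ≤ n := fun s hs r => by
    by_contra! hgt
    have := hmin (hmem s ⟨hs.1, hs.2.le.trans ht₁.2⟩ r hgt.le)
    exact absurd hs.2 (not_lt.2 this)
  have hle : ∀ s ∈ Set.Icc 0 t₁, ∀ r, |V s r| ≤ n := fun s hs r => by
    have hc : IsClosed {s | |V s r| ≤ n} :=
      isClosed_le (hV.cont_comp continuous_id continuous_const).abs continuous_const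
    rw [← closure_Ico hpos.ne] at hs
    exact hc.closure_subset_iff.2 (fun s hs => hlt s hs r) hs
  have hR : RadialSol T L t₁ V := ⟨hV, he, fun t ht r => by rw [heq t r, hg _ (hle t ht r)],
    hvan, hT, hL, hpos, ht₁.2⟩
  linarith [hM t₁ hR t₁ (Set.right_mem_Icc.2 hpos.le) r₁]

theorem exists_truncation {f : ℝ → ℝ} (hf : ContDiff ℝ (⊤ : ℕ∞) f) {n : ℝ} (hn : 0 < n) :
    ∃ g : ℝ → ℝ, ContDiff ℝ (⊤ : ℕ∞) g ∧ (∀ v, |v| ≤ n → g v = f v) ∧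
      ∃ C, ∀ u v, |g u - g v| ≤ C * |u - v| := by
  let φ : ContDiffBump (0 : ℝ) := ⟨n, n + 1, hn, by linarith⟩
  have hg : ContDiff ℝ (⊤ : ℕ∞) fun v => φ v * f v := φ.contDiff.mul hf
  refine ⟨_, hg, fun v hv => ?_, ?_⟩
  · rw [φ.one_of_mem_closedBall (by simpa using hv), one_mul]
  · obtain ⟨C, hC⟩ := hg.lipschitzWith_of_hasCompactSupport (φ.hasCompactSupport.mul_right)
      (by simp)
    exact ⟨C, fun u v => by simpa [Real.dist_eq] using hC.dist_le_mul u v⟩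

theorem nonlin_zero : nonlin 0 = 0 := by simp [nonlin]

theorem dt_comp_neg (V : ℝ → ℝ → ℝ) (t r : ℝ) : dt (fun s r => V (-s) r) t r = -dt V (-t) r :=
  deriv_comp_neg (fun s => V s r) t

theorem dt_dt_comp_neg (V : ℝ → ℝ → ℝ) (t r : ℝ) :
    dt (dt fun s r => V (-s) r) t r = dt (dt V) (-t) r :=
  deriv_deriv_comp_neg (fun s => V s r) t

theorem exists_abs_le_of_vanish {V₀ : ℝ → ℝ} (h : Continuous V₀) {R : ℝ}
    (hR : ∀ r, R < |r| → V₀ r = 0) : ∃ C, 0 ≤ C ∧ ∀ r, |V₀ r| ≤ C := by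
  obtain ⟨C, hC⟩ := (isCompact_Icc (a := -R) (b := R)).exists_bound_of_continuousOn h.continuousOn
  refine ⟨max C 0, le_max_right _ _, fun r => ?_⟩
  rcases lt_or_ge R |r| with hr | hr
  · rw [hR r hr, abs_zero]
    exact le_max_right _ _
  · exact (hC r (abs_le.1 hr)).trans (le_max_left _ _)

/-- Existence on arbitrarily long time intervals. -/
theorem exists_solution_of_abs_le {u₀ u₁ : Sp → ℝ} (hu₀ : ContDiff ℝ (⊤ : ℕ∞) u₀)
    (hu₁ : ContDiff ℝ (⊤ : ℕ∞) u₁) (hs₀ : HasCompactSupport u₀) (hs₁ : HasCompactSupport u₁)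
    (hr₀ : ∀ x y : Sp, ‖x‖ = ‖y‖ → u₀ x = u₀ y) (hr₁ : ∀ x y : Sp, ‖x‖ = ‖y‖ → u₁ x = u₁ y)
    {T : ℝ} (hT : 0 ≤ T) : ∃ u : ℝ → Sp → ℝ, ContDiff ℝ (⊤ : ℕ∞) (fun p : ℝ × Sp => u p.1 p.2) ∧
      (∀ t, |t| ≤ T → ∀ x, deriv (deriv fun s => u s x) t = lap (u t) x - nonlin (u t x)) ∧
      (∀ x, u 0 x = u₀ x) ∧ ∀ x, deriv (fun s => u s x) 0 = u₁ x := by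
  obtain ⟨V₀, hV₀, ev₀, hU₀, R₀, hR₀, hv₀⟩ := exists_profile hu₀ hr₀ hs₀
  obtain ⟨V₁, hV₁, ev₁, hU₁, R₁, hR₁, hv₁⟩ := exists_profile hu₁ hr₁ hs₁
  set R := max R₀ R₁ with hR
  set L := R + T + 1 with hL
  have hR0 : 0 ≤ R := hR₀.trans (le_max_left _ _)
  obtain ⟨M, hM⟩ := exists_apriori_bound V₀ V₁ T L
  obtain ⟨M', hM'⟩ := exists_apriori_bound V₀ (fun r => -V₁ r) T L
  obtain ⟨C, hC0, hC⟩ := exists_abs_le_of_vanish hV₀.continuous hv₀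
  set n := max (max M M') C + 1 with hn
  have hMn : M < n := by linarith [le_max_left M M', le_max_left (max M M') C]
  have hMn' : M' < n := by linarith [le_max_right M M', le_max_left (max M M') C]
  have hCn : C < n := by linarith [le_max_right (max M M') C]
  obtain ⟨g, hg, hgn, Λ, hΛ⟩ := exists_truncation contDiff_nonlin (hC0.trans_lt hCn)
  obtain ⟨V, hV, he, h0, h1, heq⟩ := exists_radial_solution hg hΛ hV₀ hV₁ ev₀ ev₁
  obtain ⟨hlift, hpde⟩ := radial_lift hV he hg.continuous heq
  have hg0 : g 0 = 0 := by
    rw [hgn 0 (by rw [abs_zero]; exact (hC0.trans_lt hCn).le), nonlin_zero]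
  have hvan : Van T L V := by
    intro t r ht hr
    have hnorm : ‖EuclideanSpace.single (0 : Fin 3) r‖ = |r| := by simp
    have := eq_zero_of_data_eq_zero (hg.of_le (by exact_mod_cast le_top)) hg0
      (u := fun t x => V t ‖x‖) hlift (T := |t|) (R := R) (fun t _ x => hpde t x)
      (fun x hx => by
        rw [h0]
        exact hv₀ _ (((le_max_left _ _).trans_lt hx).trans_le (le_abs_self _)))
      (fun x hx => by
        refine (h1 ‖x‖).trans ?_
        exact hv₁ _ (((le_max_right _ _).trans_lt hx).trans_le (le_abs_self _)))
      le_rfl (x := EuclideanSpace.single 0 r) (by rw [hnorm]; linarith)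
    rw [hnorm] at this
    rcases abs_choice r with h | h
    · rwa [h] at this
    · rwa [h, he] at this
  have hb0 : ∀ r, |V 0 r| < n := fun r => by
    rw [h0]
    exact (hC r).trans_lt hCn
  have hpos := abs_lt_of_apriori hV he hT (by linarith) heq hgn hvan hMn hb0
    fun t₁ h => hM V t₁ h h0 h1
  have hneg := abs_lt_of_apriori (V := fun t r => V (-t) r) (hV.comp (by fun_prop :
      ContDiff ℝ (⊤ : ℕ∞) fun p : ℝ × ℝ => (-p.1, p.2))) (fun t r => he (-t) r) hT (by linarith)
    (fun t r => by
      rw [dt_dt_comp_neg]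
      exact heq (-t) r) hgn (fun t r ht hr => hvan (-t) r (by rwa [abs_neg]) hr) hMn'
    (fun r => by simpa using hb0 r)
    fun t₁ h => hM' _ t₁ h (fun r => by simpa using h0 r) fun r => by
      rw [dt_comp_neg, neg_zero, h1]
  refine ⟨fun t x => V t ‖x‖, hlift, fun t ht x => ?_, fun x => ?_, fun x => ?_⟩
  · rw [hpde t x, hgn _ ?_]
    rcases le_total 0 t with h | h
    · exact (hpos t ⟨h, (le_abs_self t).trans ht⟩ _).le
    · simpa using (hneg (-t) ⟨by linarith, (neg_le_abs t).trans ht⟩ ‖x‖).le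
  · exact (h0 ‖x‖).trans (hU₀ x).symm
  · exact (h1 ‖x‖).trans (hU₁ x).symm

/-- Two solutions of the nonlinear wave equation with the same data agree. -/
theorem eq_of_same_data {u v : ℝ → Sp → ℝ}
    (hu : ContDiff ℝ (⊤ : ℕ∞) fun p : ℝ × Sp => u p.1 p.2)
    (hv : ContDiff ℝ (⊤ : ℕ∞) fun p : ℝ × Sp => v p.1 p.2) {T : ℝ}
    (eu : ∀ t, |t| ≤ T → ∀ x, deriv (deriv fun s => u s x) t = lap (u t) x - nonlin (u t x))
    (ev : ∀ t, |t| ≤ T → ∀ x, deriv (deriv fun s => v s x) t = lap (v t) x - nonlin (v t x))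
    (d0 : ∀ x, u 0 x = v 0 x)
    (d1 : ∀ x, deriv (fun s => u s x) 0 = deriv (fun s => v s x) 0) {t : ℝ} (ht : |t| ≤ T)
    (x : Sp) : u t x = v t x :=
  eq_of_data_eq_of_abs_le (contDiff_nonlin.of_le (by exact_mod_cast le_top)) hu hv (lt_add_one T)
    eu ev (fun x _ => d0 x) (fun x _ => d1 x) ht

/-- **Theorem 1 (global regularity).** For any spherically symmetric smooth compactly
supported initial data `u₀, u₁` there is a unique global classical solution of
`∂ₜₜ u = Δu - u⁵ log(2+u²)` with that data. -/
theorem global_regularity_log_supercritical_nlw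
    (u₀ u₁ : Sp → ℝ)
    (hu₀smooth : ContDiff ℝ (⊤ : ℕ∞) u₀) (hu₁smooth : ContDiff ℝ (⊤ : ℕ∞) u₁)
    (hu₀supp : HasCompactSupport u₀) (hu₁supp : HasCompactSupport u₁)
    (hu₀rad : ∀ x y : Sp, ‖x‖ = ‖y‖ → u₀ x = u₀ y)
    (hu₁rad : ∀ x y : Sp, ‖x‖ = ‖y‖ → u₁ x = u₁ y) :
    ∃! u : ℝ → Sp → ℝ,
      ContDiff ℝ (⊤ : ℕ∞) (fun p : ℝ × Sp => u p.1 p.2) ∧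
      (∀ t, HasCompactSupport (u t)) ∧
      (∀ t x, deriv (deriv fun s => u s x) t = lap (u t) x - nonlin (u t x)) ∧
      (∀ x, u 0 x = u₀ x) ∧
      (∀ x, deriv (fun s => u s x) 0 = u₁ x) := by
  have hex := fun N : ℕ => exists_solution_of_abs_le hu₀smooth hu₁smooth hu₀supp hu₁supp
    hu₀rad hu₁rad (Nat.cast_nonneg (α := ℝ) N)
  choose w hw heq h0 h1 using hex
  have hww : ∀ N K : ℕ, ∀ t : ℝ, |t| ≤ N → |t| ≤ K → ∀ x, w N t x = w K t x :=
    fun N K t hN hK x => eq_of_same_data (hw N) (hw K) (T := |t|)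
      (fun s hs => heq N s (hs.trans hN)) (fun s hs => heq K s (hs.trans hK))
      (fun x => by rw [h0, h0]) (fun x => by rw [h1, h1]) le_rfl x
  set u : ℝ → Sp → ℝ := fun t => w (⌈|t|⌉₊ + 1) t with hu
  have hlt : ∀ t : ℝ, |t| < (⌈|t|⌉₊ + 1 : ℕ) := fun t => by
    push_cast
    linarith [Nat.le_ceil |t|]
  have huw : ∀ N : ℕ, ∀ t : ℝ, |t| < N → u t = w N t := fun N t ht =>
    funext fun x => hww _ N t (hlt t).le ht.le x
  have hnhds : ∀ N : ℕ, ∀ t : ℝ, |t| < N → ∀ᶠ s : ℝ in nhds t, |s| < (N : ℝ) := fun N t ht =>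
    continuous_abs.continuousAt.eventually_lt continuousAt_const ht
  have hev : ∀ N : ℕ, ∀ t : ℝ, |t| < N → ∀ x,
      (fun s => u s x) =ᶠ[nhds t] fun s => w N s x := fun N t ht x =>
    (hnhds N t ht).mono fun s hs => congrFun (huw N s hs) x
  have husm : ContDiff ℝ (⊤ : ℕ∞) fun p : ℝ × Sp => u p.1 p.2 := by
    refine contDiff_iff_contDiffAt.2 fun p => ?_
    refine (hw (⌈|p.1|⌉₊ + 1)).contDiffAt.congr_of_eventuallyEq ?_
    exact (continuous_fst.continuousAt.eventually (hnhds _ p.1 (hlt p.1))).mono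
      fun q hq => congrFun (huw _ q.1 hq) q.2
  have hupde : ∀ t x, deriv (deriv fun s => u s x) t = lap (u t) x - nonlin (u t x) :=
    fun t x => by
      rw [(hev _ t (hlt t) x).deriv.deriv_eq, huw _ t (hlt t)]
      exact heq _ t (hlt t).le x
  have hu0 : ∀ x, u 0 x = u₀ x := fun x => h0 _ x
  have hu1 : ∀ x, deriv (fun s => u s x) 0 = u₁ x := fun x => by
    rw [(hev _ 0 (hlt 0) x).deriv_eq]
    exact h1 _ x
  obtain ⟨R₀, hR₀⟩ := hu₀supp.isCompact.isBounded.subset_closedBall (0 : Sp)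
  obtain ⟨R₁, hR₁⟩ := hu₁supp.isCompact.isBounded.subset_closedBall (0 : Sp)
  have hout : ∀ {f : Sp → ℝ} {R : ℝ}, tsupport f ⊆ Metric.closedBall 0 R →
      ∀ x, R < ‖x‖ → f x = 0 := fun {f R} hf x hx =>
    image_eq_zero_of_notMem_tsupport fun hmem => by
      have := hf hmem
      rw [mem_closedBall_zero_iff] at this
      linarith
  refine ⟨u, ⟨husm, fun t => ?_, hupde, hu0, hu1⟩, ?_⟩
  · refine HasCompactSupport.intro (isCompact_closedBall (0 : Sp) (max R₀ R₁ + |t|)) fun x hx => ?_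
    rw [mem_closedBall_zero_iff, not_le] at hx
    refine eq_zero_of_data_eq_zero (contDiff_nonlin.of_le (by exact_mod_cast le_top)) nonlin_zero
      husm (T := |t|) (fun t _ x => hupde t x) (fun x hx => ?_) (fun x hx => ?_) le_rfl hx
    · rw [hu0]
      exact hout hR₀ x ((le_max_left _ _).trans_lt hx)
    · rw [hu1]
      exact hout hR₁ x ((le_max_right _ _).trans_lt hx)
  · rintro v ⟨hv, -, hvpde, hv0, hv1⟩
    funext t x
    exact eq_of_same_data hv husm (fun t _ x => hvpde t x) (fun t _ x => hupde t x)
      (fun x => by rw [hv0, hu0]) (fun x => by rw [hv1, hu1]) le_rfl x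
end
end

section
/- Let g : ℝ → ℝ be continuous, even, and nondecreasing on [0,∞), let f(u) := u·g(u), F(u) := ∫₀ᵘ f(v) dv, and G(u) := u·f(u) − 2·F(u). Then G(u) ≥ 0 for every real u. -/
open MeasureTheory intervalIntegral

/-- The integral of `v g(v)` over `[0,u]` is at most `g(u) u² / 2` when `g` is nondecreasing. -/
theorem integral_mul_le_of_monotoneOn {g : ℝ → ℝ} (hg : Continuous g)
    (hgmono : MonotoneOn g (Set.Ici (0:ℝ))) {u : ℝ} (hu : 0 ≤ u) :
    (∫ v in (0:ℝ)..u, v * g v) ≤ u ^ 2 / 2 * g u := by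
  have h : (∫ v in (0:ℝ)..u, v * g v) ≤ ∫ v in (0:ℝ)..u, v * g u := by
    refine integral_mono_on hu (Continuous.intervalIntegrable (by fun_prop) _ _)
      (Continuous.intervalIntegrable (by fun_prop) _ _) fun v hv => ?_
    exact mul_le_mul_of_nonneg_left (hgmono hv.1 hu hv.2) hv.1
  simpa [intervalIntegral.integral_mul_const, integral_id] using h

/-- The primitive vanishing at `0` of `v g(v)` with `g` even is an even function. -/
theorem integral_mul_neg_of_even {g : ℝ → ℝ} (hgeven : ∀ v : ℝ, g (-v) = g v) (u : ℝ) :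
    (∫ v in (0:ℝ)..-u, v * g v) = ∫ v in (0:ℝ)..u, v * g v := by
  have h := intervalIntegral.integral_comp_neg (a := u) (b := 0) fun v => v * g v
  simp only [hgeven, neg_mul, intervalIntegral.integral_neg, neg_zero] at h
  rw [← h, ← intervalIntegral.integral_symm]

/-- For `g` continuous, even and nondecreasing on `[0,∞)`, with `f(u) = u g(u)`,
`F(u) = ∫₀ᵘ f(v) dv` and `G(u) = u f(u) - 2 F(u)`, one has `G(u) ≥ 0` for all `u`. -/
theorem G_nonneg (g : ℝ → ℝ) (hg : Continuous g)
    (hgeven : ∀ v : ℝ, g (-v) = g v)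
    (hgmono : MonotoneOn g (Set.Ici (0:ℝ))) (u : ℝ) :
    0 ≤ u * (u * g u) - 2 * (∫ v in (0:ℝ)..u, v * g v) := by
  rcases le_total 0 u with hu | hu
  · linarith [integral_mul_le_of_monotoneOn hg hgmono hu]
  · have h := integral_mul_le_of_monotoneOn hg hgmono (neg_nonneg.mpr hu)
    rw [integral_mul_neg_of_even hgeven, hgeven, neg_sq] at h
    linarith
end

section
/- Let f(u) := u⁵ log(2+u²), F(u) := ∫₀ᵘ f(v) dv, and G(u) := u·f(u) − 2·F(u). Then there exist absolute constants c, C > 0 such that for all real u, c · |u|⁶ · log(2+u²) ≤ G(u) ≤ C · |u|⁶ · log(2+u²). -/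
open MeasureTheory Real

noncomputable section

/-- The nonlinear potential `F(u) = ∫₀ᵘ f(v) dv`. -/
noncomputable def Fpot (u : ℝ) : ℝ := ∫ v in (0:ℝ)..u, nonlin v

/-- `G(u) = u f(u) - 2 F(u)`. -/
noncomputable def Gfun (u : ℝ) : ℝ := u * nonlin u - 2 * Fpot u

theorem continuous_nonlin : Continuous nonlin := by
  unfold nonlin
  exact (continuous_pow 5).mul
    (Continuous.log (by fun_prop) fun x => (by positivity : (0:ℝ) < 2 + x ^ 2).ne')

theorem nonlin_neg (u : ℝ) : nonlin (-u) = -nonlin u := by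
  simp only [nonlin, neg_sq]
  ring

theorem Fpot_neg (u : ℝ) : Fpot (-u) = Fpot u := by
  have h := intervalIntegral.integral_comp_neg (a := 0) (b := u) nonlin
  simp only [nonlin_neg, intervalIntegral.integral_neg, neg_zero] at h
  rw [Fpot, intervalIntegral.integral_symm, ← h, neg_neg, Fpot]

theorem Fpot_abs (u : ℝ) : Fpot |u| = Fpot u := by
  rcases abs_choice u with h | h <;> rw [h]
  exact Fpot_neg u

theorem log_two_add_sq_nonneg (u : ℝ) : 0 ≤ Real.log (2 + u ^ 2) :=
  Real.log_nonneg (by nlinarith [sq_nonneg u])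

theorem Fpot_nonneg (u : ℝ) : 0 ≤ Fpot u := by
  rw [← Fpot_abs]
  exact intervalIntegral.integral_nonneg (abs_nonneg u) fun v hv =>
    mul_nonneg (pow_nonneg hv.1 5) (log_two_add_sq_nonneg v)

theorem Fpot_le (u : ℝ) : Fpot u ≤ |u| ^ 6 / 6 * Real.log (2 + u ^ 2) := by
  rw [← Fpot_abs, ← sq_abs]
  have h : Fpot |u| ≤ ∫ v in (0:ℝ)..|u|, v ^ 5 * Real.log (2 + |u| ^ 2) := by
    refine intervalIntegral.integral_mono_on (abs_nonneg u)
      (continuous_nonlin.intervalIntegrable _ _)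
      (Continuous.intervalIntegrable (by fun_prop) _ _) fun v hv => ?_
    exact mul_le_mul_of_nonneg_left
      (Real.log_le_log (by positivity)
        (add_le_add le_rfl (pow_le_pow_left₀ hv.1 hv.2 2)))
      (pow_nonneg hv.1 5)
  refine h.trans_eq ?_
  rw [intervalIntegral.integral_mul_const, integral_pow]
  norm_num

/-- For `f(u) = u⁵ log(2+u²)`, the quantity `G(u) = u f(u) - 2F(u)` is comparable to
`|u|⁶ log(2+u²)`. -/
theorem Gfun_comparable :
    ∃ c > (0:ℝ), ∃ C > (0:ℝ), ∀ u : ℝ,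
      c * |u| ^ 6 * Real.log (2 + u ^ 2) ≤ Gfun u ∧
      Gfun u ≤ C * |u| ^ 6 * Real.log (2 + u ^ 2) := by
  refine ⟨2 / 3, by norm_num, 1, one_pos, fun u => ?_⟩
  have hu : u * nonlin u = |u| ^ 6 * Real.log (2 + u ^ 2) := by
    rw [Even.pow_abs (by decide), nonlin]
    ring
  have h0 := Fpot_nonneg u
  have h1 := Fpot_le u
  rw [Gfun, hu]
  constructor <;> linarith
end
end
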